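/- arXiv:2104.04253 — 4 statements merged into one kernel-verified Lean document; each statement's English description precedes it below -/
import Mathlib

section
/- Let 0 < γ₀ ≤ Γ. There exists a constant C₀ ≥ 1, depending only on γ₀ and Γ, such that for every ε ∈ (0,1] and every G ∈ C¹([0,∞);ℝ) with γ₀ ≤ G(Y) ≤ Γ for all Y ≥ 0 and M_G := sup_{Y≥0}(1+Y)³|G'(Y)| < ∞, there exists a function Z ∈ C²([0,∞);ℝ) satisfying: (1) 0 ≤ Z(y) ≤ C₀ and Z'(y) ≥ 0 for all y ≥ 0, C₀⁻¹·y ≤ Z(y) ≤ C₀·y for y ∈ [0,2], and Z(y) = Z(2) for y ≥ 2; (2) G(y/√ε)·Z'(y) = 1 for y ∈ [0,1], and |y^k Z''(y)| ≤ C₀ M_G ε^{(k-1)/2} for y ∈ [0,3/2] and k = 0,1,2,3; (3) −d/dy[G(y/√ε)Z'(y)] ≥ −C₀ M_G ε for y ≥ 1, and Z''(y) ≤ 0 for y ≥ 3/2; (4) (1+y)|Z'(y)| ≤ C₀ and y|Z''(y)| ≤ C₀(M_G + 1) for all y ≥ 0. -/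
open Set

noncomputable section


lemma ftc_aux (f : ℝ → ℝ) (hf : Continuous f) (c y : ℝ) :
    HasDerivAt (fun y => c + ∫ t in (0:ℝ)..y, f t) (f y) y :=
  (intervalIntegral.integral_hasDerivAt_right (hf.intervalIntegrable _ _)
    (hf.stronglyMeasurableAtFilter _ _) hf.continuousAt).const_add c

lemma cd2_aux (Z p q : ℝ → ℝ) (hZ : ∀ y, HasDerivAt Z (p y) y)
    (hp : ∀ y, HasDerivAt p (q y) y) (hq : Continuous q) : ContDiff ℝ 2 Z := by
  have e1 : deriv Z = p := funext fun y => (hZ y).deriv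
  have e2 : deriv p = q := funext fun y => (hp y).deriv
  have hp1 : ContDiff ℝ 1 p := by
    rw [contDiff_one_iff_deriv, e2]
    exact ⟨fun y => (hp y).differentiableAt, hq⟩
  have : ((2 : WithTop ℕ∞)) = 1 + 1 := by norm_num
  rw [this, contDiff_succ_iff_deriv, e1]
  exact ⟨fun y => (hZ y).differentiableAt, by simp, hp1⟩

/-- comparison of functions through derivatives. -/
lemma cmp_aux (A B dA dB : ℝ → ℝ) (a b : ℝ) (hab : a ≤ b) (hA : ∀ y, HasDerivAt A (dA y) y)
    (hB : ∀ y, HasDerivAt B (dB y) y) (h0 : A a ≤ B a)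
    (h : ∀ y, a ≤ y → y ≤ b → dA y ≤ dB y) : A b ≤ B b := by
  have hm : MonotoneOn (fun y => B y - A y) (Icc a b) := by
    apply monotoneOn_of_deriv_nonneg (convex_Icc a b)
    · exact fun y _ => ((hB y).sub (hA y)).continuousAt.continuousWithinAt
    · exact fun y _ => ((hB y).sub (hA y)).differentiableAt.differentiableWithinAt
    · intro y hy
      rw [interior_Icc] at hy
      have e : deriv (fun y => B y - A y) y = dB y - dA y := ((hB y).sub (hA y)).deriv
      rw [e]
      linarith [h y hy.1.le hy.2.le]
  have := hm (left_mem_Icc.2 hab) (right_mem_Icc.2 hab) hab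
  simp only at this
  linarith

lemma step_aux : ∃ s ds : ℝ → ℝ, Continuous ds ∧ (∀ x, HasDerivAt s (ds x) x) ∧
    (∀ x, 0 ≤ ds x) ∧ (∀ x, ds x ≤ 2) ∧ (∀ x, x ≤ 0 → s x = 0) ∧ (∀ x, 1 ≤ x → s x = 1) ∧
    (∀ x, x ≤ 0 → ds x = 0) ∧ (∀ x, 1 ≤ x → ds x = 0) ∧ (∀ x, 0 ≤ s x) ∧ (∀ x, s x ≤ 1) := by
  let g : ℝ → ℝ := fun t => max 0 (6 * t * (1 - t))
  have hg : Continuous g := by fun_prop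
  have hd := ftc_aux g hg 0
  have g0 : ∀ x, 0 ≤ g x := fun x => le_max_left _ _
  have gl : ∀ x, x ≤ 0 → g x = 0 := fun x hx => max_eq_left (by nlinarith)
  have gr : ∀ x, 1 ≤ x → g x = 0 := fun x hx => max_eq_left (by nlinarith)
  have hzero : ∀ x : ℝ, HasDerivAt (fun _ : ℝ => (0:ℝ)) ((fun _ => (0:ℝ)) x) x :=
    fun x => hasDerivAt_const x 0
  have hone : ∀ x : ℝ, HasDerivAt (fun _ : ℝ => (1:ℝ)) ((fun _ => (0:ℝ)) x) x :=
    fun x => hasDerivAt_const x 1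
  set s : ℝ → ℝ := fun y => 0 + ∫ t in (0:ℝ)..y, g t with hs
  have s0 : s 0 = 0 := by simp [hs]
  have sm : ∀ x y, x ≤ y → s x ≤ s y := fun x y hxy => by
    have := cmp_aux (fun _ => s x) s (fun _ => 0) g x y hxy (fun z => hasDerivAt_const z _) hd
      le_rfl (fun z _ _ => g0 z)
    exact this
  have sl : ∀ x, x ≤ 0 → s x = 0 := fun x hx => by
    have := cmp_aux s (fun _ => s x) g (fun _ => 0) x 0 hx hd (fun z => hasDerivAt_const z _)
      le_rfl (fun z _ hz => (gl z hz).le)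
    have h2 := sm x 0 hx
    simp only [s0] at this h2
    linarith
  have s1 : s 1 = 1 := by
    have hpoly : ∀ x : ℝ, HasDerivAt (fun x : ℝ => 3 * x^2 - 2 * x^3) (6 * x * (1 - x)) x := by
      intro x
      have := ((hasDerivAt_pow 2 x).const_mul 3).sub ((hasDerivAt_pow 3 x).const_mul 2)
      refine HasDerivAt.congr_deriv this ?_
      push_cast; ring
    have h1 := cmp_aux s (fun x : ℝ => 3 * x^2 - 2 * x^3) g (fun x => 6 * x * (1 - x)) 0 1
      zero_le_one hd hpoly (by simp [s0]) (fun y h0 h1 => max_le (by nlinarith) le_rfl)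
    have h2 := cmp_aux (fun x : ℝ => 3 * x^2 - 2 * x^3) s (fun x => 6 * x * (1 - x)) g 0 1
      zero_le_one hpoly hd (by simp [s0]) (fun y h0 h1 => le_max_right _ _)
    norm_num at h1 h2
    linarith
  have sr : ∀ x, 1 ≤ x → s x = 1 := fun x hx => by
    have := cmp_aux s (fun _ => s 1) g (fun _ => 0) 1 x hx hd (fun z => hasDerivAt_const z _)
      le_rfl (fun z hz _ => (gr z hz).le)
    have h2 := sm 1 x hx
    simp only [s1] at this h2
    linarith
  refine ⟨s, g, hg, hd, g0, fun x => max_le (by norm_num) (by nlinarith [sq_nonneg (x - 1/2)]),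
    sl, sr, gl, gr, fun x => ?_, fun x => ?_⟩
  · rw [← sl (min x 0) (min_le_right _ _)]; exact sm _ _ (min_le_left _ _)
  · rw [← sr (max x 1) (le_max_right _ _)]; exact sm _ _ (le_max_left _ _)

lemma build_aux (F f : ℝ → ℝ) (α β : ℝ) (hα : 0 < α) (hf : Continuous f)
    (hF : ∀ y, HasDerivAt F (f y) y) (hb : ∀ y, 0 ≤ y → α ≤ F y ∧ F y ≤ β) :
    ∃ p q : ℝ → ℝ, Continuous q ∧ (∀ y, HasDerivAt p (q y) y) ∧
      (∀ y, 0 ≤ y → y ≤ 1 → p y = F y) ∧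
      (∀ y, 0 ≤ y → y ≤ 3/2 → |q y| ≤ |f y|) ∧
      (∀ y, 0 ≤ y → y ≤ 3/2 → α ≤ p y) ∧
      (∀ y, 0 ≤ y → 0 ≤ p y ∧ p y ≤ β) ∧
      (∀ y, 2 ≤ y → p y = 0 ∧ q y = 0) ∧
      (∀ y, 3/2 ≤ y → q y ≤ 0 ∧ -(4 * β) ≤ q y) := by
  obtain ⟨s, ds, hdsc, hs, ds0, ds2, sl, sr, dsl, dsr, s0, s1⟩ := step_aux
  have hFc : Continuous F := continuous_iff_continuousAt.2 fun y => (hF y).continuousAt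
  have hw : Continuous (fun t => 2 * ds (2 * t - 2) * F t) := by fun_prop
  have hI := ftc_aux _ hw 0
  set I : ℝ → ℝ := fun y => 0 + ∫ t in (0:ℝ)..y, 2 * ds (2 * t - 2) * F t with hIdef
  have I0 : I 0 = 0 := by simp [hIdef]
  have hsc : ∀ c y : ℝ, HasDerivAt (fun y => s (2 * y - c)) (2 * ds (2 * y - c)) y := by
    intro c y
    have h1 : HasDerivAt (fun y : ℝ => 2 * y - c) 2 y := by
      simpa using ((hasDerivAt_id y).const_mul 2).sub_const c
    have := (hs (2 * y - c)).comp y h1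
    rw [mul_comm]; exact this
  have Ilo : ∀ y, 0 ≤ y → α * s (2 * y - 2) ≤ I y := fun y hy =>
    cmp_aux (fun y => α * s (2 * y - 2)) I (fun y => α * (2 * ds (2 * y - 2))) _ 0 y hy
      (fun z => (hsc 2 z).const_mul α) hI (by simp [I0, sl (-2) (by norm_num)])
      (fun z hz _ => by nlinarith [ds0 (2 * z - 2), (hb z hz).1])
  have Ihi : ∀ y, 0 ≤ y → I y ≤ β * s (2 * y - 2) := fun y hy =>
    cmp_aux I (fun y => β * s (2 * y - 2)) _ (fun y => β * (2 * ds (2 * y - 2))) 0 y hy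
      hI (fun z => (hsc 2 z).const_mul β) (by simp [I0, sl (-2) (by norm_num)])
      (fun z hz _ => by nlinarith [ds0 (2 * z - 2), (hb z hz).2])
  have Ic : ∀ y, 3/2 ≤ y → I y = I (3/2) := fun y hy => by
    have hz : ∀ z, 3/2 ≤ z → 2 * ds (2 * z - 2) * F z = 0 := fun z hz => by
      rw [dsr _ (by linarith)]; ring
    apply le_antisymm
    · exact cmp_aux I (fun _ => I (3/2)) _ (fun _ => 0) (3/2) y hy hI
        (fun z => hasDerivAt_const z _) le_rfl (fun z h _ => (hz z h).le)
    · exact cmp_aux (fun _ => I (3/2)) I (fun _ => 0) _ (3/2) y hy 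
        (fun z => hasDerivAt_const z _) hI le_rfl (fun z h _ => (hz z h).ge)
  have e32 : s (2 * (3/2) - 2) = 1 := sr _ (by norm_num)
  have alo : α ≤ I (3/2) := by have := Ilo (3/2) (by norm_num); rw [e32] at this; linarith
  have ahi : I (3/2) ≤ β := by have := Ihi (3/2) (by norm_num); rw [e32] at this; linarith
  set a := I (3/2) with ha
  have pA : ∀ y, y ≤ 3/2 → (1 - s (2 * y - 2)) * F y + I y - a * s (2 * y - 3)
      = (1 - s (2 * y - 2)) * F y + I y := fun y hy => by
    rw [sl (2 * y - 3) (by linarith)]; ring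
  have pB : ∀ y, 3/2 ≤ y → (1 - s (2 * y - 2)) * F y + I y - a * s (2 * y - 3)
      = a * (1 - s (2 * y - 3)) := fun y hy => by
    rw [sr (2 * y - 2) (by linarith), Ic y hy]; ring
  refine ⟨fun y => (1 - s (2 * y - 2)) * F y + I y - a * s (2 * y - 3),
    fun y => (1 - s (2 * y - 2)) * f y - a * (2 * ds (2 * y - 3)), ?_, ?_, ?_, ?_, ?_, ?_, ?_, ?_⟩
  · have hsC : Continuous s := continuous_iff_continuousAt.2 fun y => (hs y).continuousAt
    fun_prop
  · intro y
    have := ((((hsc 2 y).const_sub 1).mul (hF y)).add (hI y)).sub ((hsc 3 y).const_mul a)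
    refine HasDerivAt.congr_deriv this ?_
    ring
  · intro y h0 h1
    simp only
    have e := sl (2 * y - 2) (by linarith)
    have i1 := Ilo y h0
    have i2 := Ihi y h0
    rw [pA y (by linarith), e]
    rw [e] at i1 i2
    linarith
  · intro y h0 h1
    simp only
    rw [dsl (2 * y - 3) (by linarith)]
    have : (1 - s (2 * y - 2)) * f y - a * (2 * 0) = (1 - s (2 * y - 2)) * f y := by ring
    rw [this, abs_mul]
    have h3 : |1 - s (2 * y - 2)| ≤ 1 := by
      rw [abs_le]; constructor <;> linarith [s0 (2 * y - 2), s1 (2 * y - 2)]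
    nlinarith [abs_nonneg (f y)]
  · intro y h0 h1
    simp only
    rw [pA y h1]
    nlinarith [s0 (2 * y - 2), s1 (2 * y - 2), (hb y h0).1, Ilo y h0]
  · intro y h0
    simp only
    rcases le_total y (3/2) with h1 | h1
    · rw [pA y h1]
      constructor
      · nlinarith [s0 (2 * y - 2), s1 (2 * y - 2), (hb y h0).1, Ilo y h0]
      · nlinarith [s0 (2 * y - 2), s1 (2 * y - 2), (hb y h0).2, Ihi y h0]
    · rw [pB y h1]
      constructor
      · nlinarith [s0 (2 * y - 3), s1 (2 * y - 3)]
      · nlinarith [s0 (2 * y - 3), s1 (2 * y - 3)]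
  · intro y h
    simp only
    rw [pB y (by linarith), sr (2 * y - 3) (by linarith), sr (2 * y - 2) (by linarith),
      dsr (2 * y - 3) (by linarith)]
    constructor <;> ring
  · intro y h
    simp only
    rw [sr (2 * y - 2) (by linarith)]
    constructor
    · nlinarith [ds0 (2 * y - 3)]
    · nlinarith [ds0 (2 * y - 3), ds2 (2 * y - 3)]

/-- existence of the weight function `Z` associated with a
boundary-layer profile function `G` (modelling `G_s = H_s² − U_s²`). -/
theorem stmt2 (γ₀ Γ : ℝ) (hγ₀ : 0 < γ₀) (hγΓ : γ₀ ≤ Γ) :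
    ∃ C₀ : ℝ, 1 ≤ C₀ ∧
      ∀ ε : ℝ, ε ∈ Set.Ioc (0:ℝ) 1 →
      ∀ G : ℝ → ℝ, ContDiff ℝ 1 G →
        (∀ Y, 0 ≤ Y → γ₀ ≤ G Y ∧ G Y ≤ Γ) →
        ∀ MG : ℝ, (∀ Y, 0 ≤ Y → (1 + Y)^3 * |deriv G Y| ≤ MG) →
        ∃ Z : ℝ → ℝ, ContDiff ℝ 2 Z ∧
          -- (1)
          (∀ y, 0 ≤ y → 0 ≤ Z y ∧ Z y ≤ C₀ ∧ 0 ≤ deriv Z y) ∧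
          (∀ y ∈ Set.Icc (0:ℝ) 2, C₀⁻¹ * y ≤ Z y ∧ Z y ≤ C₀ * y) ∧
          (∀ y, 2 ≤ y → Z y = Z 2) ∧
          -- (2)
          (∀ y ∈ Set.Icc (0:ℝ) 1, G (y / Real.sqrt ε) * deriv Z y = 1) ∧
          (∀ y ∈ Set.Icc (0:ℝ) (3/2), ∀ k : ℕ, k ≤ 3 →
            |y ^ k * deriv (deriv Z) y| ≤ C₀ * MG * ε ^ (((k:ℝ) - 1)/2)) ∧
          -- (3)
          (∀ y, 1 ≤ y →
            -(C₀ * MG * ε) ≤ -(deriv (fun t => G (t / Real.sqrt ε) * deriv Z t) y)) ∧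
          (∀ y, 3/2 ≤ y → deriv (deriv Z) y ≤ 0) ∧
          -- (4)
          (∀ y, 0 ≤ y →
            (1 + y) * |deriv Z y| ≤ C₀ ∧ y * |deriv (deriv Z) y| ≤ C₀ * (MG + 1)) := by
  have hΓ : 0 < Γ := lt_of_lt_of_le hγ₀ hγΓ
  have b0 : 0 < γ₀⁻¹ := inv_pos.2 hγ₀
  have c0 : 0 < (γ₀^2)⁻¹ := by positivity
  have d0 : 0 < Γ * (γ₀^2)⁻¹ := by positivity
  set C : ℝ := 1 + 8 * γ₀⁻¹ + 2 * Γ + (γ₀^2)⁻¹ + Γ * (γ₀^2)⁻¹ with hC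
  have hC1 : 1 ≤ C := by linarith
  refine ⟨C, hC1, ?_⟩
  rintro ε ⟨hε, hε1⟩ G hG hGb M hM
  set r := Real.sqrt ε with hr
  have r0 : 0 < r := Real.sqrt_pos.2 hε
  have hr2 : r * r = ε := Real.mul_self_sqrt hε.le
  have M0 : 0 ≤ M := by
    have := hM 0 le_rfl
    have h2 := abs_nonneg (deriv G 0)
    norm_num at this
    linarith
  have hGd : ∀ Y, HasDerivAt G (deriv G Y) Y := fun Y =>
    (hG.differentiable (by norm_num) Y).hasDerivAt
  have hdGc : Continuous (deriv G) := hG.continuous_deriv le_rfl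
  have hGc : Continuous G := hG.continuous
  have hYn : ∀ y : ℝ, 0 ≤ y → 0 ≤ y / r := fun y hy => by positivity
  have hgpos : ∀ y : ℝ, 0 ≤ y → 0 < G (y / r) := fun y hy =>
    lt_of_lt_of_le hγ₀ (hGb _ (hYn y hy)).1
  have hgd : ∀ y, HasDerivAt (fun t => G (t / r)) (deriv G (y / r) * (1 / r)) y := fun y =>
    (hGd (y / r)).comp y ((hasDerivAt_id y).div_const r)
  set f : ℝ → ℝ := fun y => -(deriv G (|y| / r) * (1 / r)) / (G (|y| / r))^2 with hf
  have hfc : Continuous f := by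
    have : ∀ y : ℝ, (G (|y| / r))^2 ≠ 0 := fun y => (pow_pos (hgpos _ (abs_nonneg y)) 2).ne'
    apply Continuous.div _ _ this <;> fun_prop
  have hFd := ftc_aux f hfc (G 0)⁻¹
  set F : ℝ → ℝ := fun y => (G 0)⁻¹ + ∫ t in (0:ℝ)..y, f t with hF
  have hFeq : ∀ y, 0 ≤ y → F y = (G (y / r))⁻¹ := by
    intro y hy
    have : ∫ t in (0:ℝ)..y, f t = (G (y / r))⁻¹ - (G (0 / r))⁻¹ := by
      apply intervalIntegral.integral_eq_sub_of_hasDerivAt (f := fun y => (G (y / r))⁻¹)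
      · intro x hx
        rw [uIcc_of_le hy] at hx
        have := (hgd x).inv (hgpos x hx.1).ne'
        simp only [hf, abs_of_nonneg hx.1]
        exact this
      · exact hfc.intervalIntegrable _ _
    simp only [hF, this, zero_div]
    ring
  have hFb : ∀ y, 0 ≤ y → Γ⁻¹ ≤ F y ∧ F y ≤ γ₀⁻¹ := by
    intro y hy
    rw [hFeq y hy]
    have := hGb _ (hYn y hy)
    exact ⟨inv_anti₀ (hgpos y hy) this.2, inv_anti₀ hγ₀ this.1⟩
  obtain ⟨p, q, hqc, hpd, pF, qf, plo, pb, p2, q32⟩ :=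
    build_aux F f Γ⁻¹ γ₀⁻¹ (inv_pos.2 hΓ) hfc hFd hFb
  have hpc : Continuous p := continuous_iff_continuousAt.2 fun y => (hpd y).continuousAt
  have hZd := ftc_aux p hpc 0
  set Z : ℝ → ℝ := fun y => 0 + ∫ t in (0:ℝ)..y, p t with hZ
  have Z0 : Z 0 = 0 := by simp [hZ]
  have e1 : deriv Z = p := funext fun y => (hZd y).deriv
  have e2 : deriv p = q := funext fun y => (hpd y).deriv
  have hlin : ∀ c y : ℝ, HasDerivAt (fun y : ℝ => c * y) ((fun _ => c) y) y := fun c y => by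
    simpa using (hasDerivAt_id y).const_mul c
  have Zm : ∀ x y, 0 ≤ x → x ≤ y → Z x ≤ Z y := fun x y hx hxy =>
    cmp_aux (fun _ => Z x) Z (fun _ => 0) p x y hxy (fun z => hasDerivAt_const z _) hZd
      le_rfl (fun z hz _ => (pb z (hx.trans hz)).1)
  have Zhi : ∀ y, 0 ≤ y → Z y ≤ γ₀⁻¹ * y := fun y hy =>
    cmp_aux Z (fun y => γ₀⁻¹ * y) p (fun _ => γ₀⁻¹) 0 y hy hZd (hlin _) (by simp [Z0])
      (fun z hz _ => (pb z hz).2)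
  have Zlo : ∀ y, 0 ≤ y → y ≤ 3/2 → Γ⁻¹ * y ≤ Z y := fun y hy hy2 =>
    cmp_aux (fun y => Γ⁻¹ * y) Z (fun _ => Γ⁻¹) p 0 y hy (hlin _) hZd (by simp [Z0])
      (fun z hz hz2 => plo z hz (hz2.trans hy2))
  have Zc : ∀ y, 2 ≤ y → Z y = Z 2 := fun y hy =>
    le_antisymm (cmp_aux Z (fun _ => Z 2) p (fun _ => 0) 2 y hy hZd
      (fun z => hasDerivAt_const z _) le_rfl (fun z hz _ => (p2 z hz).1.le))
      (Zm 2 y (by norm_num) hy)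
  have Gi0 : 0 < Γ⁻¹ := inv_pos.2 hΓ
  have hCinv : C⁻¹ ≤ Γ⁻¹ / 2 := by
    have : Γ⁻¹ / 2 = (2 * Γ)⁻¹ := by rw [mul_inv]; ring
    rw [this]
    exact inv_anti₀ (by positivity) (by linarith)
  -- bound on the derivative of G
  have hdGb : ∀ y, 0 ≤ y → |deriv G (y / r)| ≤ M / (1 + y / r)^3 := fun y hy => by
    have h1 := hYn y hy
    rw [le_div_iff₀ (by positivity), mul_comm]
    exact hM _ h1
  have hqb : ∀ y, 0 ≤ y → y ≤ 3/2 → |q y| ≤ |deriv G (y / r)| * (1 / r) * (γ₀^2)⁻¹ := by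
    intro y h0 h1
    refine (qf y h0 h1).trans ?_
    simp only [hf, abs_of_nonneg h0]
    rw [abs_div, abs_neg, abs_mul, abs_of_pos (show 0 < 1 / r by positivity),
      abs_of_pos (pow_pos (hgpos y h0) 2), div_eq_mul_inv]
    gcongr
    exact (hGb _ (hYn y h0)).1
  have hk : ∀ y ∈ Set.Icc (0:ℝ) (3/2), ∀ k : ℕ, k ≤ 3 →
      |y ^ k * q y| ≤ C * M * ε ^ (((k:ℝ) - 1)/2) := by
    rintro y ⟨h0, h1⟩ k hk
    have he : ε ^ (((k:ℝ) - 1)/2) = r ^ k / r := by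
      rw [← Real.rpow_natCast r k, ← Real.rpow_sub_one r0.ne', hr, Real.sqrt_eq_rpow,
        ← Real.rpow_mul hε.le]
      congr 1; ring
    have hY := hYn y h0
    have hyY : y = r * (y / r) := by field_simp
    rw [he, abs_mul, abs_of_nonneg (pow_nonneg h0 k)]
    set Y := y / r with hYdef
    have hpow : Y ^ k ≤ (1 + Y)^3 := 
      (pow_le_pow_left₀ hY (by linarith) k).trans (pow_le_pow_right₀ (by linarith) hk)
    have h3 : 0 < (1 + Y)^3 := by positivity
    have hq1 := hqb y h0 h1
    rw [← hYdef] at hq1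
    have hkey : Y ^ k * |deriv G Y| ≤ M :=
      (mul_le_mul_of_nonneg_right hpow (abs_nonneg _)).trans (hM Y hY)
    calc y ^ k * |q y| ≤ y ^ k * (|deriv G Y| * (1 / r) * (γ₀^2)⁻¹) := by gcongr
      _ = (γ₀^2)⁻¹ * (Y ^ k * |deriv G Y|) * (r ^ k / r) := by
          rw [hyY, mul_pow]; ring
      _ ≤ C * M * (r ^ k / r) := by
          gcongr
          linarith
  have hGε : ∀ y, 1 ≤ y → |deriv G (y / r)| * (1 / r) ≤ M * ε := by
    intro y hy
    have h1 := hdGb y (by linarith)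
    have hY := hYn y (by linarith)
    have hyY : r * (1 + y / r) = r + y := by field_simp
    have h3 : 1 ≤ r^3 * (1 + y / r)^3 := by
      rw [← mul_pow, hyY]
      exact one_le_pow₀ (by linarith)
    calc |deriv G (y / r)| * (1 / r) ≤ M / (1 + y / r)^3 * (1 / r) := by gcongr
      _ ≤ M * ε := by
        rw [← hr2, div_mul_div_comm, div_le_iff₀ (by positivity)]
        have : M * (r * r) * ((1 + y / r)^3 * r) = M * (r^3 * (1 + y / r)^3) := by ring
        rw [this]
        nlinarith
  refine ⟨Z, cd2_aux Z p q hZd hpd hqc, ?_, ?_, Zc, ?_, ?_, ?_, ?_, ?_⟩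
  · intro y hy
    rw [e1]
    refine ⟨by rw [← Z0]; exact Zm 0 y le_rfl hy, ?_, (pb y hy).1⟩
    rcases le_total y 2 with h | h
    · have := Zhi y hy
      nlinarith
    · rw [Zc y h]
      have := Zhi 2 (by norm_num)
      linarith
  · rintro y ⟨h0, h2⟩
    constructor
    · rcases le_total y (3/2) with h | h
      · have := Zlo y h0 h
        nlinarith
      · have h4 := Zlo (3/2) (by norm_num) le_rfl
        have h5 := Zm (3/2) y (by norm_num) h
        nlinarith
    · have := Zhi y h0
      nlinarith
  · rintro y ⟨h0, h1⟩
    rw [e1, pF y h0 h1, hFeq y h0]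
    exact mul_inv_cancel₀ (hgpos y h0).ne'
  · rw [e1, e2]
    exact hk
  · intro y hy
    have hy0 : 0 ≤ y := by linarith
    rw [e1]
    have hd : deriv (fun t => G (t / r) * p t) y
        = deriv G (y / r) * (1 / r) * p y + G (y / r) * q y := ((hgd y).mul (hpd y)).deriv
    rw [hd]
    have hgε := hGε y hy
    have hMε : 0 ≤ M * ε := by positivity
    have t1 : deriv G (y / r) * (1 / r) * p y ≤ M * ε * γ₀⁻¹ := by
      have hp := pb y hy0
      calc deriv G (y / r) * (1 / r) * p y ≤ |deriv G (y / r)| * (1 / r) * p y := by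
            gcongr
            · exact hp.1
            · exact le_abs_self _
        _ ≤ M * ε * γ₀⁻¹ := mul_le_mul hgε hp.2 hp.1 hMε
    have t2 : G (y / r) * q y ≤ M * ε * (Γ * (γ₀^2)⁻¹) := by
      have hg := hgpos y hy0
      rcases le_total y (3/2) with h | h
      · have h1 : q y ≤ M * ε * (γ₀^2)⁻¹ := by
          refine (le_abs_self _).trans ((hqb y hy0 h).trans ?_)
          gcongr
        calc G (y / r) * q y ≤ G (y / r) * (M * ε * (γ₀^2)⁻¹) := by gcongr
          _ ≤ Γ * (M * ε * (γ₀^2)⁻¹) := by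
            gcongr
            exact (hGb _ (hYn y hy0)).2
          _ = _ := by ring
      · have h1 := (q32 y h).1
        have h2 : 0 ≤ M * ε * (Γ * (γ₀^2)⁻¹) := by positivity
        nlinarith
    have t3 : M * ε * (γ₀⁻¹ + Γ * (γ₀^2)⁻¹) ≤ M * ε * C := by
      gcongr
      linarith
    linarith
  · intro y hy
    rw [e1, e2]
    exact (q32 y hy).1
  · intro y hy
    rw [e1, e2]
    have hp := pb y hy
    constructor
    · rw [abs_of_nonneg hp.1]
      rcases le_total y 2 with h | h
      · nlinarith
      · rw [(p2 y h).1]; linarith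
    · rcases le_total y (3/2) with h | h
      · have := hk y ⟨hy, h⟩ 1 (by norm_num)
        rw [abs_mul] at this
        simp only [pow_one, abs_of_nonneg hy] at this
        norm_num at this
        linarith
      · rcases le_total y 2 with h2 | h2
        · have h3 := q32 y h
          rw [abs_of_nonpos h3.1]
          have : y * -q y ≤ 8 * γ₀⁻¹ := by nlinarith
          have h4 : 0 ≤ C * M := by positivity
          linarith
        · rw [(p2 y h2).2]
          have h4 : 0 ≤ C * (M + 1) := by positivity
          simpa using h4
end
end

section
/- There exists a constant C > 0, depending only on C₀, such that for every vector field q = (q₁,q₂) : Ω → ℝ² of class C² with ∂ₓq₁ + ∂_yq₂ = 0 on Ω, q₂(x,0) = 0 for all x, q and all its partial derivatives up to order two square-integrable on Ω, and q(x,y) → 0 as y → ∞ uniformly in x, one has ‖Z^{1/2}∇q‖_{L²(Ω)} ≤ C·‖Z^{1/2}ω_q‖_{L²(Ω)}, where ω_q := ∂_yq₁ − ∂ₓq₂ is the vorticity of q. -/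
open MeasureTheory Set

noncomputable section

/-- Partial derivative in the first (tangential) variable. -/
def pdx (f : ℝ → ℝ → ℝ) (x y : ℝ) : ℝ := deriv (fun t => f t y) x

/-- Partial derivative in the second (normal) variable. -/
def pdy (f : ℝ → ℝ → ℝ) (x y : ℝ) : ℝ := deriv (fun t => f x t) y

/-- Square-integrability on `Ω = 𝕋_ϱ × (0,∞)` (one periodicity cell). -/
def SqInt (ϱ : ℝ) (f : ℝ → ℝ → ℝ) : Prop :=
  MeasureTheory.IntegrableOn (fun z : ℝ × ℝ => (f z.1 z.2) ^ 2)
    ((Set.Ioc 0 (2 * Real.pi * ϱ)) ×ˢ (Set.Ioi 0))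


lemma hasDerivAt_pdx {f : ℝ → ℝ → ℝ} (hf : ContDiff ℝ 1 (Function.uncurry f)) (x y : ℝ) :
    HasDerivAt (fun t => f t y) (fderiv ℝ (Function.uncurry f) (x, y) (1, 0)) x := by
  have h := (hf.differentiable (by norm_num) (x, y)).hasFDerivAt
  have h2 : HasDerivAt (fun t : ℝ => (t, y)) ((1 : ℝ), (0 : ℝ)) x :=
    (hasDerivAt_id x).prodMk (hasDerivAt_const x y)
  exact h.comp_hasDerivAt x h2

lemma hasDerivAt_pdy {f : ℝ → ℝ → ℝ} (hf : ContDiff ℝ 1 (Function.uncurry f)) (x y : ℝ) :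
    HasDerivAt (fun t => f x t) (fderiv ℝ (Function.uncurry f) (x, y) (0, 1)) y := by
  have h := (hf.differentiable (by norm_num) (x, y)).hasFDerivAt
  have h2 : HasDerivAt (fun t : ℝ => (x, t)) ((0 : ℝ), (1 : ℝ)) y :=
    (hasDerivAt_const y x).prodMk (hasDerivAt_id y)
  exact h.comp_hasDerivAt y h2

lemma pdx_eq {f : ℝ → ℝ → ℝ} (hf : ContDiff ℝ 1 (Function.uncurry f)) (x y : ℝ) :
    pdx f x y = fderiv ℝ (Function.uncurry f) (x, y) (1, 0) := (hasDerivAt_pdx hf x y).deriv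

lemma pdy_eq {f : ℝ → ℝ → ℝ} (hf : ContDiff ℝ 1 (Function.uncurry f)) (x y : ℝ) :
    pdy f x y = fderiv ℝ (Function.uncurry f) (x, y) (0, 1) := (hasDerivAt_pdy hf x y).deriv

lemma hasDerivAt_pdx' {f : ℝ → ℝ → ℝ} (hf : ContDiff ℝ 1 (Function.uncurry f)) (x y : ℝ) :
    HasDerivAt (fun t => f t y) (pdx f x y) x := by
  rw [pdx_eq hf]; exact hasDerivAt_pdx hf x y

lemma hasDerivAt_pdy' {f : ℝ → ℝ → ℝ} (hf : ContDiff ℝ 1 (Function.uncurry f)) (x y : ℝ) :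
    HasDerivAt (fun t => f x t) (pdy f x y) y := by
  rw [pdy_eq hf]; exact hasDerivAt_pdy hf x y

lemma unc_pdx {f : ℝ → ℝ → ℝ} (hf : ContDiff ℝ 1 (Function.uncurry f)) :
    Function.uncurry (pdx f) = fun z => fderiv ℝ (Function.uncurry f) z (1, 0) := by
  ext ⟨x, y⟩; exact pdx_eq hf x y

lemma unc_pdy {f : ℝ → ℝ → ℝ} (hf : ContDiff ℝ 1 (Function.uncurry f)) :
    Function.uncurry (pdy f) = fun z => fderiv ℝ (Function.uncurry f) z (0, 1) := by
  ext ⟨x, y⟩; exact pdy_eq hf x y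

lemma cd_pdx {f : ℝ → ℝ → ℝ} (hf : ContDiff ℝ 2 (Function.uncurry f)) :
    ContDiff ℝ 1 (Function.uncurry (pdx f)) := by
  rw [unc_pdx (hf.of_le (by norm_num))]
  exact (hf.fderiv_right (m := 1) (by norm_num)).clm_apply contDiff_const

lemma cd_pdy {f : ℝ → ℝ → ℝ} (hf : ContDiff ℝ 2 (Function.uncurry f)) :
    ContDiff ℝ 1 (Function.uncurry (pdy f)) := by
  rw [unc_pdy (hf.of_le (by norm_num))]
  exact (hf.fderiv_right (m := 1) (by norm_num)).clm_apply contDiff_const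

lemma cont_pdx {f : ℝ → ℝ → ℝ} (hf : ContDiff ℝ 1 (Function.uncurry f)) :
    Continuous (Function.uncurry (pdx f)) := by
  rw [unc_pdx hf]
  exact (hf.continuous_fderiv (by norm_num)).clm_apply continuous_const

lemma cont_pdy {f : ℝ → ℝ → ℝ} (hf : ContDiff ℝ 1 (Function.uncurry f)) :
    Continuous (Function.uncurry (pdy f)) := by
  rw [unc_pdy hf]
  exact (hf.continuous_fderiv (by norm_num)).clm_apply continuous_const

lemma pd_symm {f : ℝ → ℝ → ℝ} (hf : ContDiff ℝ 2 (Function.uncurry f)) (x y : ℝ) :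
    pdx (pdy f) x y = pdy (pdx f) x y := by
  have h1 : ContDiff ℝ 1 (Function.uncurry f) := hf.of_le (by norm_num)
  have hd : Differentiable ℝ (fderiv ℝ (Function.uncurry f)) :=
    (hf.fderiv_right (m := 1) (by norm_num)).differentiable (by norm_num)
  have hs : IsSymmSndFDerivAt ℝ (Function.uncurry f) (x, y) :=
    hf.contDiffAt.isSymmSndFDerivAt (by simp)
  rw [pdx_eq (cd_pdy hf), pdy_eq (cd_pdx hf), unc_pdx h1, unc_pdy h1]
  have e : ∀ v : ℝ × ℝ, ∀ w : ℝ × ℝ,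
      fderiv ℝ (fun z => fderiv ℝ (Function.uncurry f) z v) (x, y) w
        = fderiv ℝ (fderiv ℝ (Function.uncurry f)) (x, y) w v := by
    intro v w
    have := ((hd (x, y)).hasFDerivAt.clm_apply (hasFDerivAt_const v (x, y))).fderiv
    rw [this]; simp
  rw [e, e]
  exact hs.eq _ _

lemma hasDerivAt_slice {g g' : ℝ → ℝ → ℝ} (L : ℝ) (hg : Continuous (Function.uncurry g))
    (hg' : Continuous (Function.uncurry g'))
    (hd : ∀ x y, HasDerivAt (fun t => g x t) (g' x y) y) (y : ℝ) :
    HasDerivAt (fun y => ∫ x in (0:ℝ)..L, g x y) (∫ x in (0:ℝ)..L, g' x y) y := by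
  obtain ⟨M, hM⟩ := ((isCompact_uIcc (a := (0:ℝ)) (b := L)).prod
    (isCompact_Icc (a := y - 1) (b := y + 1))).exists_bound_of_continuousOn hg'.continuousOn
  have c1 : ∀ y, Continuous (fun x => g x y) := fun y =>
    hg.comp (Continuous.prodMk_left y)
  have c2 : ∀ y, Continuous (fun x => g' x y) := fun y =>
    hg'.comp (Continuous.prodMk_left y)
  refine (intervalIntegral.hasDerivAt_integral_of_dominated_loc_of_deriv_le
    (F := fun y x => g x y) (F' := fun y x => g' x y) (bound := fun _ => M)
    (s := Icc (y - 1) (y + 1)) (Icc_mem_nhds (by linarith) (by linarith))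
    (Filter.Eventually.of_forall fun y => (c1 y).aestronglyMeasurable)
    ((c1 y).intervalIntegrable _ _) (c2 y).aestronglyMeasurable
    (Filter.Eventually.of_forall fun x hx t ht => hM (x, t) ⟨uIoc_subset_uIcc hx, ht⟩)
    (continuous_const.intervalIntegrable _ _)
    (Filter.Eventually.of_forall fun x hx t ht => hd x t)).2

/-- one-dimensional core -/
lemma core (H H' H'' : ℝ → ℝ) (h1 : ∀ y, HasDerivAt H (H' y) y)
    (h2 : ∀ y, HasDerivAt H' (H'' y) y) (c2 : Continuous H'')
    (i1 : IntegrableOn H' (Ioi 0)) (i2 : IntegrableOn H'' (Ioi 0))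
    (z : H 0 = 0) :
    ∫ y in Ioi (0:ℝ), min y 2 * H'' y = - H 2 := by
  have ht := tendsto_zero_of_hasDerivAt_of_integrableOn_Ioi (fun x _ => h2 x) i2 i1
  have i22 : IntegrableOn H'' (Ioi 2) := i2.mono_set (Ioi_subset_Ioi (by norm_num))
  have e1 : ∫ y in Ioi (2:ℝ), H'' y = 0 - H' 2 :=
    integral_Ioi_of_hasDerivAt_of_tendsto' (fun x _ => h2 x) i22 ht
  have cm : Continuous fun y : ℝ => min y 2 * H'' y := (continuous_id.min continuous_const).mul c2
  have e2 : ∫ y in Ioi (2:ℝ), min y 2 * H'' y = 2 * (0 - H' 2) := by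
    rw [← e1, ← integral_const_mul]
    refine setIntegral_congr_fun measurableSet_Ioi fun y hy => ?_
    have hy' : (2:ℝ) < y := hy
    simp [min_eq_right hy'.le]
  have e3 : ∫ y in (0:ℝ)..2, min y 2 * H'' y = 2 * H' 2 - H 2 := by
    have : ∫ y in (0:ℝ)..2, min y 2 * H'' y = ∫ y in (0:ℝ)..2, y * H'' y := by
      refine intervalIntegral.integral_congr fun y hy => ?_
      rw [uIcc_of_le (by norm_num)] at hy
      simp [min_eq_left hy.2]
    rw [this]
    have hd : ∀ y ∈ uIcc (0:ℝ) 2, HasDerivAt (fun y => y * H' y - H y) (y * H'' y) y := by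
      intro y _
      refine (((hasDerivAt_id y).mul (h2 y)).sub (h1 y)).congr_deriv ?_
      simp only [id]; ring
    rw [intervalIntegral.integral_eq_sub_of_hasDerivAt hd
      ((continuous_id.mul c2).intervalIntegrable _ _)]
    simp [z]
  have i3 : IntegrableOn (fun y => min y 2 * H'' y) (Ioi 2) := by
    have i4 : IntegrableOn (fun y => 2 * H'' y) (Ioi 2) := i22.const_mul 2
    refine i4.congr_fun (fun y hy => ?_) measurableSet_Ioi
    have hy' : (2:ℝ) < y := hy
    simp [min_eq_right hy'.le]
  rw [← Ioc_union_Ioi_eq_Ioi (show (0:ℝ) ≤ 2 by norm_num),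
    setIntegral_union (Ioc_disjoint_Ioi le_rfl) measurableSet_Ioi
      (cm.integrableOn_Ioc) i3, e2, ← intervalIntegral.integral_of_le (by norm_num), e3]
  ring

/-- slice identity -/
lemma slice {q1 q2 : ℝ → ℝ → ℝ} (L : ℝ)
    (c1 : ContDiff ℝ 2 (Function.uncurry q1)) (c2 : ContDiff ℝ 2 (Function.uncurry q2))
    (p1 : ∀ x y, q1 (x + L) y = q1 x y) (p2 : ∀ x y, q2 (x + L) y = q2 x y)
    (hdiv : ∀ x y, 0 < y → pdx q1 x y + pdy q2 x y = 0) (y : ℝ) (hy : 0 < y) :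
    ∫ x in (0:ℝ)..L, ((pdx q1 x y) ^ 2 + (pdy q1 x y) ^ 2
              + (pdx q2 x y) ^ 2 + (pdy q2 x y) ^ 2 - (pdy q1 x y - pdx q2 x y) ^ 2)
      = ∫ x in (0:ℝ)..L, (2 * (pdy q2 x y) ^ 2 + 2 * (q2 x y * pdy (pdy q2) x y)) := by
  have c1' : ContDiff ℝ 1 (Function.uncurry q1) := c1.of_le (by norm_num)
  have c2' : ContDiff ℝ 1 (Function.uncurry q2) := c2.of_le (by norm_num)
  have s : ∀ {g : ℝ → ℝ → ℝ}, Continuous (Function.uncurry g) → Continuous (fun x => g x y) :=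
    fun hg => hg.comp (Continuous.prodMk_left y)
  have hxy : ∀ x, pdx (pdy q1) x y = - pdy (pdy q2) x y := by
    intro x
    rw [pd_symm c1]
    have : (fun t => pdx q1 x t) =ᶠ[nhds y] fun t => - pdy q2 x t := by
      filter_upwards [lt_mem_nhds hy] with t ht
      linarith [hdiv x t ht]
    have h := this.deriv_eq
    rw [deriv.fun_neg] at h
    exact h
  have d : ∀ x ∈ uIcc 0 L, HasDerivAt (fun x => q2 x y * pdy q1 x y)
      (pdx q2 x y * pdy q1 x y - q2 x y * pdy (pdy q2) x y) x := by
    intro x _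
    have := (hasDerivAt_pdx' c2' x y).mul (hasDerivAt_pdx' (cd_pdy c1) x y)
    rw [hxy] at this
    refine this.congr_deriv ?_
    ring
  have cA := s (cont_pdx c1')
  have cB := s (cont_pdy c1')
  have cC := s (cont_pdx c2')
  have cD := s (cont_pdy c2')
  have cE := s (cont_pdy (cd_pdy c2))
  have cF := s c2.continuous
  have hp : pdy q1 L y = pdy q1 0 y := by
    have : (fun t => q1 L t) = fun t => q1 0 t := by
      ext t; simpa using p1 0 t
    simp only [pdy, this]
  have hq : q2 L y = q2 0 y := by simpa using p2 0 y
  have I := intervalIntegral.integral_eq_sub_of_hasDerivAt d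
    (((cC.mul cB).sub (cF.mul cE)).intervalIntegrable _ _)
  rw [hp, hq, sub_self] at I
  rw [← sub_eq_zero, ← intervalIntegral.integral_sub]
  · have I2 : 2 * (∫ x in (0:ℝ)..L, (pdx q2 x y * pdy q1 x y - q2 x y * pdy (pdy q2) x y)) = 0 := by
      rw [I, mul_zero]
    refine Eq.trans ?_ I2
    rw [← intervalIntegral.integral_const_mul]
    refine intervalIntegral.integral_congr fun x _ => ?_
    have := hdiv x y hy
    have e : pdx q1 x y = - pdy q2 x y := by linarith
    simp only [e]; ring
  · apply Continuous.intervalIntegrable; fun_prop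
  · apply Continuous.intervalIntegrable; fun_prop


lemma wint {A : Set ℝ} {w : ℝ → ℝ} {M : ℝ}
    (hw : ContinuousOn w (Ioi 0)) (hM : ∀ y, 0 < y → |w y| ≤ M) {E : ℝ × ℝ → ℝ}
    (hE : Integrable E ((volume.restrict A).prod (volume.restrict (Ioi (0:ℝ))))) :
    Integrable (fun z => w z.2 * E z)
      ((volume.restrict A).prod (volume.restrict (Ioi (0:ℝ)))) := by
  have hm : AEStronglyMeasurable w (volume.restrict (Ioi (0:ℝ))) :=
    hw.aestronglyMeasurable measurableSet_Ioi
  refine hE.bdd_mul (c := M) hm.comp_snd ?_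
  have h1 : ∀ᵐ y ∂(volume.restrict (Ioi (0:ℝ))), |w y| ≤ M := by
    filter_upwards [ae_restrict_mem measurableSet_Ioi] with y hy using hM y hy
  exact Measure.quasiMeasurePreserving_snd.ae h1

lemma sq_int {ϱ : ℝ} {f : ℝ → ℝ → ℝ} (h : SqInt ϱ f) :
    Integrable (fun z : ℝ × ℝ => (f z.1 z.2) ^ 2)
      ((volume.restrict (Ioc 0 (2 * Real.pi * ϱ))).prod (volume.restrict (Ioi (0:ℝ)))) := by
  rw [Measure.prod_restrict, ← Measure.volume_eq_prod]
  exact h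

lemma mul_int {μ : Measure (ℝ × ℝ)} {f g : ℝ → ℝ → ℝ} (hf : Continuous (Function.uncurry f))
    (hg : Continuous (Function.uncurry g))
    (h1 : Integrable (fun z : ℝ × ℝ => (f z.1 z.2) ^ 2) μ)
    (h2 : Integrable (fun z : ℝ × ℝ => (g z.1 z.2) ^ 2) μ) :
    Integrable (fun z : ℝ × ℝ => f z.1 z.2 * g z.1 z.2) μ := by
  refine (h1.add h2).mono' ((show Continuous (fun z : ℝ × ℝ => f z.1 z.2 * g z.1 z.2) from
    hf.mul hg).aestronglyMeasurable) (Filter.Eventually.of_forall fun z => ?_)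
  simp only [Pi.add_apply, Real.norm_eq_abs, abs_le]
  constructor <;> nlinarith [sq_nonneg (f z.1 z.2 + g z.1 z.2), sq_nonneg (f z.1 z.2 - g z.1 z.2),
    sq_nonneg (f z.1 z.2), sq_nonneg (g z.1 z.2)]

/-- the weighted gradient of a divergence-free vector field is
controlled by its weighted vorticity:
`‖Z^{1/2}∇q‖_{L²(Ω)} ≤ C ‖Z^{1/2}ω_q‖_{L²(Ω)}`. -/
theorem stmt8
    (C₀ : ℝ) (hC₀ : 1 ≤ C₀) :
    ∃ C : ℝ, 0 < C ∧
      ∀ ϱ : ℝ, 0 < ϱ →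
      ∀ Z : ℝ → ℝ,
        ContinuousOn Z (Set.Ici 0) →
        MonotoneOn Z (Set.Ici 0) →
        (∀ y, 0 ≤ y → 0 ≤ Z y) →
        (∀ y ∈ Set.Icc (0:ℝ) 2, C₀⁻¹ * y ≤ Z y ∧ Z y ≤ C₀ * y) →
        (∀ y, 2 ≤ y → Z y = Z 2) →
      ∀ q1 q2 : ℝ → ℝ → ℝ,
        ContDiff ℝ 2 (Function.uncurry q1) → ContDiff ℝ 2 (Function.uncurry q2) →
        (∀ x y, q1 (x + 2 * Real.pi * ϱ) y = q1 x y) →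
        (∀ x y, q2 (x + 2 * Real.pi * ϱ) y = q2 x y) →
        (∀ x y, 0 < y → pdx q1 x y + pdy q2 x y = 0) →
        (∀ x, q2 x 0 = 0) →
        (SqInt ϱ q1 ∧ SqInt ϱ q2) →
        (SqInt ϱ (pdx q1) ∧ SqInt ϱ (pdy q1) ∧ SqInt ϱ (pdx q2) ∧ SqInt ϱ (pdy q2)) →
        (SqInt ϱ (pdx (pdx q1)) ∧ SqInt ϱ (pdx (pdy q1)) ∧ SqInt ϱ (pdy (pdx q1)) ∧
          SqInt ϱ (pdy (pdy q1)) ∧ SqInt ϱ (pdx (pdx q2)) ∧ SqInt ϱ (pdx (pdy q2)) ∧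
          SqInt ϱ (pdy (pdx q2)) ∧ SqInt ϱ (pdy (pdy q2))) →
        (∀ δ : ℝ, 0 < δ → ∃ Y : ℝ, ∀ y, Y ≤ y → ∀ x, |q1 x y| + |q2 x y| ≤ δ) →
        Real.sqrt (∫ x in (0:ℝ)..(2 * Real.pi * ϱ), ∫ y in Set.Ioi (0:ℝ),
            Z y * ((pdx q1 x y) ^ 2 + (pdy q1 x y) ^ 2
              + (pdx q2 x y) ^ 2 + (pdy q2 x y) ^ 2))
          ≤ C * Real.sqrt (∫ x in (0:ℝ)..(2 * Real.pi * ϱ), ∫ y in Set.Ioi (0:ℝ),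
              Z y * (pdy q1 x y - pdx q2 x y) ^ 2) := by
  refine ⟨C₀, by linarith, ?_⟩
  intro ϱ hϱ Z Zc Zm Z0 Zb Z2 q1 q2 c1 c2 p1 p2 hdiv hz hq hdq hddq hlim
  clear hddq hlim
  have hL : (0:ℝ) ≤ 2 * Real.pi * ϱ := by positivity
  have c1' : ContDiff ℝ 1 (Function.uncurry q1) := c1.of_le (by norm_num)
  have c2' : ContDiff ℝ 1 (Function.uncurry q2) := c2.of_le (by norm_num)
  obtain ⟨i1, i2, i3, i4⟩ := hdq
  have i1 := sq_int i1
  have i2 := sq_int i2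
  have i3 := sq_int i3
  have i4 := sq_int i4
  have i0 := sq_int hq.2
  set L := 2 * Real.pi * ϱ with hLdef
  set μ := volume.restrict (Ioc 0 L) with hμ
  set ν := volume.restrict (Ioi (0:ℝ)) with hν
  set E : ℝ × ℝ → ℝ := fun z => (pdx q1 z.1 z.2) ^ 2 + (pdy q1 z.1 z.2) ^ 2
              + (pdx q2 z.1 z.2) ^ 2 + (pdy q2 z.1 z.2) ^ 2 with hE
  set W : ℝ × ℝ → ℝ := fun z => (pdy q1 z.1 z.2 - pdx q2 z.1 z.2) ^ 2 with hW
  have IE : Integrable E (μ.prod ν) := ((i1.add i2).add i3).add i4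
  have IW : Integrable W (μ.prod ν) := by
    have := (i2.add i3).sub ((mul_int (cont_pdy c1') (cont_pdx c2') i2 i3).const_mul 2)
    refine this.congr (Filter.Eventually.of_forall fun z => ?_)
    simp only [hW, Pi.add_apply, Pi.sub_apply]; ring
  -- the weights
  have ζc : ContinuousOn (fun y : ℝ => min y 2) (Ioi 0) :=
    (continuous_id.min continuous_const).continuousOn
  have ζb : ∀ y : ℝ, 0 < y → |min y 2| ≤ 2 := by
    intro y hy
    rw [abs_of_pos (lt_min hy (by norm_num))]
    exact min_le_right _ _
  have hC : 0 < C₀ := by linarith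
  have Zu : ∀ y : ℝ, 0 < y → Z y ≤ C₀ * min y 2 := by
    intro y hy
    rcases le_total y 2 with h | h
    · rw [min_eq_left h]; exact (Zb y ⟨hy.le, h⟩).2
    · rw [min_eq_right h, Z2 y h]; exact (Zb 2 ⟨by norm_num, le_rfl⟩).2
  have Zl : ∀ y : ℝ, 0 < y → min y 2 ≤ C₀ * Z y := by
    intro y hy
    have key : ∀ a b : ℝ, C₀⁻¹ * a ≤ b → a ≤ C₀ * b := by
      intro a b h
      rwa [inv_mul_le_iff₀ hC] at h
    rcases le_total y 2 with h | h
    · rw [min_eq_left h]; exact key _ _ (Zb y ⟨hy.le, h⟩).1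
    · rw [min_eq_right h, Z2 y h]; exact key _ _ (Zb 2 ⟨by norm_num, le_rfl⟩).1
  have Zbd : ∀ y : ℝ, 0 < y → |Z y| ≤ C₀ * 2 := by
    intro y hy
    rw [abs_of_nonneg (Z0 y hy.le)]
    exact (Zu y hy).trans (by gcongr; exact min_le_right _ _)
  have Zc' : ContinuousOn Z (Ioi 0) := Zc.mono Ioi_subset_Ici_self
  have IZE := wint Zc' Zbd IE
  have IZW := wint Zc' Zbd IW
  have IζE := wint ζc ζb IE
  have IζW := wint ζc ζb IW
  have hpos : ∀ᵐ z ∂(μ.prod ν), 0 < z.2 := by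
    have h1 : ∀ᵐ y ∂ν, 0 < y := ae_restrict_mem measurableSet_Ioi
    exact Measure.quasiMeasurePreserving_snd.ae h1
  have E0 : ∀ z, 0 ≤ E z := fun z => by simp only [hE]; positivity
  have W0 : ∀ z, 0 ≤ W z := fun z => by simp only [hW]; positivity
  -- main inequality with the concave weight
  have key : ∫ z, min z.2 2 * E z ∂(μ.prod ν) ≤ ∫ z, min z.2 2 * W z ∂(μ.prod ν) := by
    rw [← sub_nonpos, ← integral_sub IζE IζW]
    have Isub : Integrable (fun z : ℝ × ℝ => min z.2 2 * E z - min z.2 2 * W z) (μ.prod ν) :=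
      IζE.sub IζW
    rw [integral_prod_symm _ Isub]
    set H : ℝ → ℝ := fun y => ∫ x in (0:ℝ)..L, (q2 x y) ^ 2 with hH
    set H' : ℝ → ℝ := fun y => ∫ x in (0:ℝ)..L, 2 * (q2 x y * pdy q2 x y) with hH'
    set H'' : ℝ → ℝ := fun y => ∫ x in (0:ℝ)..L,
      (2 * (pdy q2 x y) ^ 2 + 2 * (q2 x y * pdy (pdy q2) x y)) with hH''
    have k0 : Continuous (fun z : ℝ × ℝ => q2 z.1 z.2) := c2.continuous
    have k1 : Continuous (fun z : ℝ × ℝ => pdy q2 z.1 z.2) := cont_pdy c2'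
    have k2 : Continuous (fun z : ℝ × ℝ => pdy (pdy q2) z.1 z.2) := cont_pdy (cd_pdy c2)
    have d1 : ∀ y, HasDerivAt H (H' y) y := by
      refine hasDerivAt_slice L (g := fun x y => (q2 x y) ^ 2)
        (g' := fun x y => 2 * (q2 x y * pdy q2 x y)) (k0.pow 2)
        (continuous_const.mul (k0.mul k1)) ?_
      intro x y
      refine ((hasDerivAt_pdy' c2' x y).pow 2).congr_deriv ?_
      push_cast; ring
    have d2 : ∀ y, HasDerivAt H' (H'' y) y := by
      refine hasDerivAt_slice L (g := fun x y => 2 * (q2 x y * pdy q2 x y))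
        (g' := fun x y => 2 * (pdy q2 x y) ^ 2 + 2 * (q2 x y * pdy (pdy q2) x y))
        (continuous_const.mul (k0.mul k1))
        ((continuous_const.mul (k1.pow 2)).add (continuous_const.mul (k0.mul k2))) ?_
      intro x y
      refine (((hasDerivAt_pdy' c2' x y).mul (hasDerivAt_pdy' (cd_pdy c2) x y)).const_mul
        2).congr_deriv ?_
      ring
    have cH : Continuous H'' := by
      refine intervalIntegral.continuous_parametric_intervalIntegral_of_continuous'
        (f := fun y x => 2 * (pdy q2 x y) ^ 2 + 2 * (q2 x y * pdy (pdy q2) x y)) ?_ 0 L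
      exact ((continuous_const.mul (k1.pow 2)).add (continuous_const.mul (k0.mul k2))).comp
        continuous_swap
    have eH : ∀ y, 0 < y → ∫ x, (E (x, y) - W (x, y)) ∂μ = H'' y := by
      intro y hy
      have := slice L c1 c2 p1 p2 hdiv y hy
      rw [intervalIntegral.integral_of_le hL] at this
      exact this
    have iH1 : IntegrableOn H' (Ioi 0) := by
      have := ((mul_int c2.continuous (cont_pdy c2') i0 i4).const_mul 2).integral_prod_right
      refine this.congr (Filter.Eventually.of_forall fun y => ?_)
      simp only [hH', intervalIntegral.integral_of_le hL, hμ]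
    have iH2 : IntegrableOn H'' (Ioi 0) := by
      have := (IE.sub IW).integral_prod_right
      refine this.congr ?_
      filter_upwards [ae_restrict_mem measurableSet_Ioi] with y hy using eH y hy
    have hH0 : H 0 = 0 := by simp [hH, hz]
    have hcore := core H H' H'' d1 d2 cH iH1 iH2 hH0
    have hH2 : 0 ≤ H 2 := intervalIntegral.integral_nonneg hL fun x _ => sq_nonneg _
    have : ∫ y, ∫ x, (min y 2 * E (x, y) - min y 2 * W (x, y)) ∂μ ∂ν
        = ∫ y in Ioi (0:ℝ), min y 2 * H'' y := by
      refine setIntegral_congr_fun measurableSet_Ioi fun y hy => ?_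
      simp only [← eH y hy, ← mul_sub, integral_const_mul]
    simp only [this, hcore]
    linarith
  have e1 : ∫ z, Z z.2 * E z ∂(μ.prod ν) ≤ C₀ * ∫ z, min z.2 2 * E z ∂(μ.prod ν) := by
    rw [← integral_const_mul]
    refine integral_mono_ae IZE (IζE.const_mul _) ?_
    filter_upwards [hpos] with z hz
    rw [← mul_assoc]
    exact mul_le_mul_of_nonneg_right (Zu _ hz) (E0 z)
  have e2 : ∫ z, min z.2 2 * W z ∂(μ.prod ν) ≤ C₀ * ∫ z, Z z.2 * W z ∂(μ.prod ν) := by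
    rw [← integral_const_mul]
    refine integral_mono_ae IζW (IZW.const_mul _) ?_
    filter_upwards [hpos] with z hz
    rw [← mul_assoc]
    exact mul_le_mul_of_nonneg_right (Zl _ hz) (W0 z)
  rw [integral_prod _ IZE] at e1
  rw [integral_prod _ IZW] at e2
  rw [intervalIntegral.integral_of_le hL, intervalIntegral.integral_of_le hL]
  have fin : ∫ x, ∫ y, Z y * E (x, y) ∂ν ∂μ ≤ C₀ ^ 2 * ∫ x, ∫ y, Z y * W (x, y) ∂ν ∂μ := by
    calc _ ≤ _ := e1
      _ ≤ C₀ * (C₀ * ∫ x, ∫ y, Z y * W (x, y) ∂ν ∂μ) :=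
        mul_le_mul_of_nonneg_left (key.trans e2) hC.le
      _ = _ := by ring
  refine (Real.sqrt_le_sqrt fin).trans ?_
  rw [Real.sqrt_mul (sq_nonneg _), Real.sqrt_sq hC.le]
end
end

section
/- There exists a constant C₃ > 0, depending only on μ, κ, γ₀ and γ̄ and in particular independent of ε, ñ and M̄, such that every solution as in the hypotheses satisfies √ε·(‖∂_yŴ‖_{L²} + |ñ|·‖Ŵ‖_{L²}) ≤ C₃·M̄^{1/2}(1+M̄^{1/2})·‖Ŵ‖_{L²} + C₃·‖R‖_{L²}^{1/2}·‖Ŵ‖_{L²}^{1/2}. -/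
open MeasureTheory Set Filter

noncomputable section

/-- Squared L² integral on the half line `(0,∞)`. -/
def nsq (f : ℝ → ℂ) : ℝ := ∫ y in Set.Ioi (0:ℝ), ‖f y‖ ^ 2

/-- L² norm of a quadruple of functions on `(0,∞)`. -/
def nrm4 (a b c d : ℝ → ℂ) : ℝ := Real.sqrt (nsq a + nsq b + nsq c + nsq d)

/-- Membership in `L²((0,∞))` (square integrability). -/
def ML2 (f : ℝ → ℂ) : Prop := MeasureTheory.IntegrableOn (fun y => ‖f y‖ ^ 2) (Set.Ioi 0)

open ComplexConjugate in
lemma aux_hasDeriv {f g : ℝ → ℂ} {f' g' : ℂ} {y : ℝ} (hf : HasDerivAt f f' y)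
    (hg : HasDerivAt g g' y) :
    HasDerivAt (fun y => (f y * conj (g y)).re) ((f' * conj (g y) + f y * conj g').re) y := by
  have h1 : HasDerivAt (fun y => conj (g y)) (conj g') y := by
    simpa using hg.star
  have h2 := hf.mul h1
  exact (Complex.reCLM.hasFDerivAt (x := f y * conj (g y))).comp_hasDerivAt y h2

open ComplexConjugate in
lemma aux_identity (N μ κ ε G GY c : ℝ)
    (u v h g u1 v1 h1 g1 u2 v2 h2 g2 p p1 E1 E2 E3 E4 R1 R2 R3 R4 : ℂ)
    (hR1 : Complex.I * (N:ℂ) * ((c:ℂ) * u - (G:ℂ) * h) + E1 + Complex.I * (N:ℂ) * p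
      - ((μ * ε : ℝ) : ℂ) * (u2 - (N:ℂ)^2 * u) = R1)
    (hR2 : Complex.I * (N:ℂ) * ((c:ℂ) * v - (G:ℂ) * g) + E2 + p1
      - ((μ * ε : ℝ) : ℂ) * (v2 - (N:ℂ)^2 * v) = R2)
    (hR3 : -(Complex.I * (N:ℂ)) * u + E3 - ((κ * ε : ℝ) : ℂ) * (h2 - (N:ℂ)^2 * h) = R3)
    (hR4 : -(Complex.I * (N:ℂ)) * v + E4 - ((κ * ε : ℝ) : ℂ) * (g2 - (N:ℂ)^2 * g) = R4)
    (hdiv : Complex.I * (N:ℂ) * u + v1 = 0) :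
    (p1 * conj v + p * conj v1).re
      - μ * ε * ((u2 * conj u + u1 * conj u1).re + (v2 * conj v + v1 * conj v1).re)
      - (κ * ε * GY * ((h1 * conj h).re + (g1 * conj g).re)
        + κ * ε * G * ((h2 * conj h + h1 * conj h1).re + (g2 * conj g + g1 * conj g1).re))
    = (R1 * conj u).re + (R2 * conj v).re + G * ((R3 * conj h).re + (R4 * conj g).re)
      - ((E1 * conj u).re + (E2 * conj v).re + G * ((E3 * conj h).re + (E4 * conj g).re))
      - μ * ε * (‖u1‖^2 + ‖v1‖^2 + N^2 * (‖u‖^2 + ‖v‖^2))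
      - κ * ε * G * (‖h1‖^2 + ‖g1‖^2 + N^2 * (‖h‖^2 + ‖g‖^2))
      - κ * ε * GY * ((h1 * conj h).re + (g1 * conj g).re) := by
  have hv1 : v1 = -(Complex.I * (N:ℂ) * u) := by linear_combination hdiv
  subst hv1
  subst hR1 hR2 hR3 hR4
  simp only [Complex.sq_norm, Complex.normSq_apply]
  simp only [pow_two]
  simp
  ring

/-- one product bounded by norms -/
lemma aux_re (z w : ℂ) : |(z * (starRingEnd ℂ) w).re| ≤ ‖z‖ * ‖w‖ := by
  refine (Complex.abs_re_le_norm _).trans ?_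
  simp

lemma aux_young (k M x w c : ℝ) (hc : 0 < c) :
    k * M * (x * w) ≤ c / 2 * x ^ 2 + k ^ 2 / (2 * c) * M ^ 2 * w ^ 2 := by
  have : c / 2 * x ^ 2 + k ^ 2 / (2 * c) * M ^ 2 * w ^ 2 - k * M * (x * w)
      = (c * x - k * M * w) ^ 2 / (2 * c) := by field_simp; ring
  have h2 : 0 ≤ (c * x - k * M * w) ^ 2 / (2 * c) := by positivity
  linarith

set_option maxHeartbeats 1600000 in
/-- Pointwise real inequality. -/
lemma aux_pointwise (μ κ γ Γ γ₀ : ℝ) (hκ : 0 < κ) (hγ : 0 < γ) (hΓ : 0 < Γ)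
    (hγ₀ : 0 < γ₀) (c0 : ℝ) (hc0 : 0 < c0) (hc1 : c0 ≤ μ) (hc2 : c0 ≤ κ * γ₀)
    (a N M G GY s φ1 : ℝ) (ha : 0 < a) (hM : 0 ≤ M)
    (hG : γ₀ ≤ G) (hG2 : G ≤ Γ ^ 2) (hGY : a * |GY| ≤ 4 * Γ * M) (hs : 0 ≤ s)
    (u v h g u1 v1 h1 g1 E1 E2 E3 E4 R1 R2 R3 R4 : ℂ)
    (hφ : φ1 ≤ -(1/2) * s ^ 2 + 2 * ‖h‖ ^ 2)
    (hE1 : ‖E1‖ ≤ a * |N| * M * (‖h‖ + ‖g‖) + a * M * (‖h1‖ + ‖g1‖)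
      + M * (1 + M) * (‖h‖ + ‖g‖) + M * (1 + M) * s)
    (hE2 : ‖E2‖ ≤ a * |N| * M * (‖h‖ + ‖g‖) + a * M * (‖h1‖ + ‖g1‖)
      + M * (1 + M) * (‖h‖ + ‖g‖) + M * (1 + M) * s)
    (hE3 : ‖E3‖ ≤ 2 * κ * a * (M / γ) * ‖h1‖
      + M * (1 + M) * (‖h‖ + ‖g‖) + M * (1 + M) * s)
    (hE4 : ‖E4‖ ≤ 2 * κ * a * (M / γ) * ‖g1‖
      + M * (1 + M) * (‖h‖ + ‖g‖) + M * (1 + M) * s) (lam : ℝ) (hlam : 0 < lam) :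
    (R1 * (starRingEnd ℂ) u).re + (R2 * (starRingEnd ℂ) v).re
      + G * ((R3 * (starRingEnd ℂ) h).re + (R4 * (starRingEnd ℂ) g).re)
      - ((E1 * (starRingEnd ℂ) u).re + (E2 * (starRingEnd ℂ) v).re
        + G * ((E3 * (starRingEnd ℂ) h).re + (E4 * (starRingEnd ℂ) g).re))
      - μ * a ^ 2 * (‖u1‖^2 + ‖v1‖^2 + N^2 * (‖u‖^2 + ‖v‖^2))
      - κ * a ^ 2 * G * (‖h1‖^2 + ‖g1‖^2 + N^2 * (‖h‖^2 + ‖g‖^2))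
      - κ * a ^ 2 * GY * ((h1 * (starRingEnd ℂ) h).re + (g1 * (starRingEnd ℂ) g).re)
      + M * (1 + M) * (2 + 2 * Γ ^ 2) * φ1
    ≤ (((4 + 4 * κ * Γ ^ 2 / γ + 8 * κ * Γ) ^ 2 + 16) / (2 * c0) + 9 + 9 * Γ ^ 2)
        * (M * (1 + M)) * (‖u‖^2 + ‖v‖^2 + ‖h‖^2 + ‖g‖^2)
      + (2 + 2 * Γ ^ 2) * (lam / 2 * (‖R1‖^2 + ‖R2‖^2 + ‖R3‖^2 + ‖R4‖^2)
        + 1 / (2 * lam) * (‖u‖^2 + ‖v‖^2 + ‖h‖^2 + ‖g‖^2))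
      - c0 / 2 * a ^ 2 * (‖u1‖^2 + ‖v1‖^2 + ‖h1‖^2 + ‖g1‖^2)
      - c0 / 2 * a ^ 2 * N ^ 2 * (‖u‖^2 + ‖v‖^2 + ‖h‖^2 + ‖g‖^2) := by
  have hG0 : 0 < G := lt_of_lt_of_le hγ₀ hG
  set W2 := ‖u‖^2 + ‖v‖^2 + ‖h‖^2 + ‖g‖^2 with hW2
  set D2 := ‖u1‖^2 + ‖v1‖^2 + ‖h1‖^2 + ‖g1‖^2 with hD2
  set r2 := ‖R1‖^2 + ‖R2‖^2 + ‖R3‖^2 + ‖R4‖^2 with hr2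
  have W20 : 0 ≤ W2 := by positivity
  have D20 : 0 ≤ D2 := by positivity
  have r20 : 0 ≤ r2 := by positivity
  obtain ⟨w, hw, hww⟩ : ∃ w : ℝ, 0 ≤ w ∧ w ^ 2 = W2 := ⟨√W2, Real.sqrt_nonneg _, Real.sq_sqrt W20⟩
  obtain ⟨d, hd, hdd⟩ : ∃ w : ℝ, 0 ≤ w ∧ w ^ 2 = D2 := ⟨√D2, Real.sqrt_nonneg _, Real.sq_sqrt D20⟩
  obtain ⟨r, hr, hrr⟩ : ∃ w : ℝ, 0 ≤ w ∧ w ^ 2 = r2 := ⟨√r2, Real.sqrt_nonneg _, Real.sq_sqrt r20⟩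
  have q := fun z : ℂ => sq_nonneg ‖z‖
  have bu : ‖u‖ ≤ w := abs_le_of_sq_le_sq' (by linarith [q u, q v, q h, q g]) hw |>.2
  have bv : ‖v‖ ≤ w := abs_le_of_sq_le_sq' (by linarith [q u, q v, q h, q g]) hw |>.2
  have bh : ‖h‖ ≤ w := abs_le_of_sq_le_sq' (by linarith [q u, q v, q h, q g]) hw |>.2
  have bg : ‖g‖ ≤ w := abs_le_of_sq_le_sq' (by linarith [q u, q v, q h, q g]) hw |>.2
  have bh1 : ‖h1‖ ≤ d := abs_le_of_sq_le_sq' (by linarith [q u1, q v1, q h1, q g1]) hd |>.2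
  have bg1 : ‖g1‖ ≤ d := abs_le_of_sq_le_sq' (by linarith [q u1, q v1, q h1, q g1]) hd |>.2
  have bR1 : ‖R1‖ ≤ r := abs_le_of_sq_le_sq' (by linarith [q R1, q R2, q R3, q R4]) hr |>.2
  have bR2 : ‖R2‖ ≤ r := abs_le_of_sq_le_sq' (by linarith [q R1, q R2, q R3, q R4]) hr |>.2
  have bR3 : ‖R3‖ ≤ r := abs_le_of_sq_le_sq' (by linarith [q R1, q R2, q R3, q R4]) hr |>.2
  have bR4 : ‖R4‖ ≤ r := abs_le_of_sq_le_sq' (by linarith [q R1, q R2, q R3, q R4]) hr |>.2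
  have prod : ∀ z x : ℂ, ∀ A B : ℝ, ‖z‖ ≤ A → ‖x‖ ≤ B →
      |(z * (starRingEnd ℂ) x).re| ≤ A * B := fun z x A B hA hB =>
    (aux_re z x).trans (mul_le_mul hA hB (norm_nonneg _) ((norm_nonneg _).trans hA))
  set Q := M * (1 + M) with hQ
  have hQ0 : 0 ≤ Q := by positivity
  have hMQ : M ^ 2 ≤ Q := by
    have : Q = M + M ^ 2 := by rw [hQ]; ring
    linarith
  set e1 := a * |N| * M * (2 * w) + a * M * (2 * d) + Q * (2 * w) + Q * s with he1
  set e3 := 2 * κ * a * (M / γ) * d + Q * (2 * w) + Q * s with he3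
  have e30 : 0 ≤ e3 := by positivity
  have cE1 : ‖E1‖ ≤ e1 := hE1.trans (by
    have A1 : ‖h‖ + ‖g‖ ≤ 2 * w := by linarith
    have A2 : ‖h1‖ + ‖g1‖ ≤ 2 * d := by linarith
    rw [he1]; gcongr)
  have cE2 : ‖E2‖ ≤ e1 := hE2.trans (by
    have A1 : ‖h‖ + ‖g‖ ≤ 2 * w := by linarith
    have A2 : ‖h1‖ + ‖g1‖ ≤ 2 * d := by linarith
    rw [he1]; gcongr)
  have cE3 : ‖E3‖ ≤ e3 := hE3.trans (by
    have A1 : ‖h‖ + ‖g‖ ≤ 2 * w := by linarith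
    rw [he3]; gcongr)
  have cE4 : ‖E4‖ ≤ e3 := hE4.trans (by
    have A1 : ‖h‖ + ‖g‖ ≤ 2 * w := by linarith
    rw [he3]; gcongr)
  have t1 := (abs_le.1 (prod _ _ _ _ cE1 bu)).1
  have t2 := (abs_le.1 (prod _ _ _ _ cE2 bv)).1
  have t3 := (abs_le.1 (prod _ _ _ _ cE3 bh)).1
  have t4 := (abs_le.1 (prod _ _ _ _ cE4 bg)).1
  have s1 := (abs_le.1 (prod _ _ _ _ bR1 bu)).2
  have s2 := (abs_le.1 (prod _ _ _ _ bR2 bv)).2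
  have s3 := (abs_le.1 (prod _ _ _ _ bR3 bh)).2
  have s4 := (abs_le.1 (prod _ _ _ _ bR4 bg)).2
  have o3 := prod _ _ _ _ bh1 bh
  have o4 := prod _ _ _ _ bg1 bg
  have e3w : 0 ≤ e3 * w := by positivity
  have rw0 : 0 ≤ r * w := by positivity
  -- G terms
  have GE : -(G * ((E3 * (starRingEnd ℂ) h).re + (E4 * (starRingEnd ℂ) g).re))
      ≤ Γ ^ 2 * (2 * (e3 * w)) := by
    have : -((E3 * (starRingEnd ℂ) h).re + (E4 * (starRingEnd ℂ) g).re) ≤ 2 * (e3 * w) := by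
      linarith
    calc _ = G * -((E3 * (starRingEnd ℂ) h).re + (E4 * (starRingEnd ℂ) g).re) := by ring
      _ ≤ G * (2 * (e3 * w)) := by gcongr
      _ ≤ _ := by gcongr
  have GR : G * ((R3 * (starRingEnd ℂ) h).re + (R4 * (starRingEnd ℂ) g).re)
      ≤ Γ ^ 2 * (2 * (r * w)) := by
    calc _ ≤ G * (2 * (r * w)) := by gcongr; linarith
      _ ≤ _ := by gcongr
  have GYb : -(κ * a ^ 2 * GY * ((h1 * (starRingEnd ℂ) h).re + (g1 * (starRingEnd ℂ) g).re))
      ≤ κ * a * (4 * Γ * M) * (2 * (d * w)) := by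
    refine (neg_le_abs _).trans ?_
    have hsum : |(h1 * (starRingEnd ℂ) h).re + (g1 * (starRingEnd ℂ) g).re| ≤ 2 * (d * w) :=
      (abs_add_le _ _).trans (by linarith)
    rw [abs_mul, abs_mul, abs_of_pos (by positivity : 0 < κ * a ^ 2)]
    calc _ = κ * a * (a * |GY|) * |(h1 * (starRingEnd ℂ) h).re + (g1 * (starRingEnd ℂ) g).re| := by
          ring
      _ ≤ _ := by gcongr
  -- diffusion
  have dif : c0 * a ^ 2 * (d ^ 2 + N ^ 2 * w ^ 2)
      ≤ μ * a ^ 2 * (‖u1‖^2 + ‖v1‖^2 + N^2 * (‖u‖^2 + ‖v‖^2))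
      + κ * a ^ 2 * G * (‖h1‖^2 + ‖g1‖^2 + N^2 * (‖h‖^2 + ‖g‖^2)) := by
    have hk : c0 ≤ κ * G := hc2.trans (by gcongr)
    calc c0 * a ^ 2 * (d ^ 2 + N ^ 2 * w ^ 2)
        = c0 * a ^ 2 * (‖u1‖^2 + ‖v1‖^2 + N^2 * (‖u‖^2 + ‖v‖^2))
          + c0 * a ^ 2 * (‖h1‖^2 + ‖g1‖^2 + N^2 * (‖h‖^2 + ‖g‖^2)) := by
            rw [hww, hdd, hW2, hD2]; ring
      _ ≤ μ * a ^ 2 * (‖u1‖^2 + ‖v1‖^2 + N^2 * (‖u‖^2 + ‖v‖^2))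
          + (κ * G) * a ^ 2 * (‖h1‖^2 + ‖g1‖^2 + N^2 * (‖h‖^2 + ‖g‖^2)) := by gcongr
      _ = _ := by ring
  have y1 := aux_young (4 + 4 * κ * Γ ^ 2 / γ + 8 * κ * Γ) M (a * d) w c0 hc0
  have y2 := aux_young 4 M (a * |N|  * w) w c0 hc0
  have y2' : (a * |N| * w) ^ 2 = a ^ 2 * N ^ 2 * w ^ 2 := by rw [mul_pow, mul_pow, sq_abs]
  rw [y2'] at y2
  have y3 : r * w ≤ lam / 2 * r ^ 2 + 1 / (2 * lam) * w ^ 2 := by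
    have := aux_young 1 1 r w lam hlam
    linarith
  have y3' : (2 + 2 * Γ ^ 2) * (r * w)
    ≤ (2 + 2 * Γ ^ 2) * (lam / 2 * r ^ 2 + 1 / (2 * lam) * w ^ 2) := by gcongr
  have hh : ‖h‖ ^ 2 ≤ w ^ 2 := by gcongr
  have y4 : s * w ≤ -φ1 + 5 / 2 * w ^ 2 := by
    have sq := sq_nonneg (s - w)
    have sq2 : (s - w) ^ 2 = s ^ 2 - 2 * (s * w) + w ^ 2 := by ring
    linarith
  have y4' : (Q * (2 + 2 * Γ ^ 2)) * (s * w) ≤ (Q * (2 + 2 * Γ ^ 2)) * (-φ1 + 5 / 2 * w ^ 2) := by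
    gcongr
  have y5 : ((4 + 4 * κ * Γ ^ 2 / γ + 8 * κ * Γ) ^ 2 + 16) / (2 * c0) * M ^ 2 * w ^ 2
    ≤ ((4 + 4 * κ * Γ ^ 2 / γ + 8 * κ * Γ) ^ 2 + 16) / (2 * c0) * Q * w ^ 2 := by gcongr
  have expand : 2 * (e1 * w) + Γ ^ 2 * (2 * (e3 * w)) + κ * a * (4 * Γ * M) * (2 * (d * w))
     = (4 + 4 * κ * Γ ^ 2 / γ + 8 * κ * Γ) * M * (a * d * w) + 4 * M * (a * |N| * w * w)
      + Q * (4 + 4 * Γ ^ 2) * w ^ 2 + (Q * (2 + 2 * Γ ^ 2)) * (s * w) := by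
    rw [he1, he3]; field_simp; ring
  have y5' : ((4 + 4 * κ * Γ ^ 2 / γ + 8 * κ * Γ) ^ 2 + 16) / (2 * c0) * M ^ 2 * w ^ 2
    = (4 + 4 * κ * Γ ^ 2 / γ + 8 * κ * Γ) ^ 2 / (2 * c0) * M ^ 2 * w ^ 2
     + 4 ^ 2 / (2 * c0) * M ^ 2 * w ^ 2 := by ring
  rw [← hww, ← hdd, ← hrr]
  linarith

/-- Integration of a differential inequality. -/
lemma aux_integrate (q φ q' f : ℝ → ℝ) (hq : ∀ y, 0 < y → HasDerivAt q (q' y) y)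
    (hqc : ContinuousOn q (Ici 0)) (q0 : q 0 ≤ 0)
    (hlow : ∀ y, 0 < y → φ y ≤ q y) (hφ : Tendsto φ atTop (nhds 0))
    (hf : IntegrableOn f (Ioi 0)) (hle : ∀ y, 0 < y → q' y ≤ f y) :
    0 ≤ ∫ y in Ioi (0:ℝ), f y := by
  have ht := intervalIntegral_tendsto_integral_Ioi 0 hf tendsto_id
  refine le_of_tendsto_of_tendsto hφ ht ?_
  filter_upwards [eventually_gt_atTop 0] with T hT
  have := intervalIntegral.sub_le_integral_of_hasDeriv_right_of_le (a := 0) (b := T) hT.le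
    (hqc.mono Icc_subset_Ici_self) (fun x hx => (hq x hx.1).hasDerivWithinAt)
    (φ := f) ((integrableOn_Icc_iff_integrableOn_Ioc).2 (hf.mono_set Ioc_subset_Ioi_self))
    (fun x hx => hle x hx.1)
  have h2 := hlow T hT
  simp only [id]
  linarith

lemma aux_lam (X A r w : ℝ) (hr : 0 ≤ r) (hw : 0 ≤ w)
    (h : ∀ lam : ℝ, 0 < lam → X ≤ A + (lam / 2 * r ^ 2 + 1 / (2 * lam) * w ^ 2)) :
    X ≤ A + r * w := by
  rcases hr.eq_or_lt with rfl | hr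
  · have ht : Tendsto (fun lam : ℝ => A + (lam / 2 * (0:ℝ) ^ 2 + 1 / (2 * lam) * w ^ 2)) atTop
        (nhds (A + 0 * w)) := by
      have : Tendsto (fun lam : ℝ => A + 1 / 2 * w ^ 2 * lam⁻¹) atTop
        (nhds (A + 1 / 2 * w ^ 2 * 0)) := (tendsto_inv_atTop_zero.const_mul _).const_add _
      convert this using 2
      · field_simp; ring
      · ring
    exact ge_of_tendsto ht ((eventually_gt_atTop 0).mono fun x hx => h x hx)
  rcases hw.eq_or_lt with rfl | hw
  · have ht : Tendsto (fun lam : ℝ => A + (lam / 2 * r ^ 2 + 1 / (2 * lam) * (0:ℝ) ^ 2))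
        (nhdsWithin 0 (Ioi 0)) (nhds (A + r * 0)) := by
      have : Tendsto (fun lam : ℝ => A + lam / 2 * r ^ 2) (nhds 0) (nhds (A + 0 / 2 * r ^ 2)) :=
        Continuous.tendsto (by fun_prop) 0
      convert this.mono_left nhdsWithin_le_nhds using 2
      · ring
      · ring
    exact ge_of_tendsto ht (eventually_mem_nhdsWithin.mono fun x hx => h x hx)
  · refine (h (w / r) (by positivity)).trans (le_of_eq ?_)
    field_simp; ring

lemma aux_final (c0 K1 K2 ε N M D W R C : ℝ) (hc0 : 0 < c0) (hK1 : 0 ≤ K1) (hK2 : 0 ≤ K2)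
    (hε : 0 < ε) (hM : 0 ≤ M) (hW : 0 ≤ W) (hR : 0 ≤ R)
    (hC : C = 1 + 4 / c0 * (K1 + K2))
    (h : c0 / 2 * ε * (D ^ 2 + N ^ 2 * W ^ 2) ≤ K1 * (M * (1 + M)) * W ^ 2 + K2 * (R * W)) :
    √ε * (D + |N| * W) ≤ C * (√M * (1 + √M)) * W + C * √R * √W := by
  have hC1 : 1 ≤ C := by rw [hC]; have : 0 ≤ 4 / c0 * (K1 + K2) := by positivity
                         linarith
  obtain ⟨m, hm, hmm⟩ : ∃ m : ℝ, 0 ≤ m ∧ m ^ 2 = M := ⟨√M, Real.sqrt_nonneg _, Real.sq_sqrt hM⟩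
  obtain ⟨r, hr, hrr⟩ : ∃ m : ℝ, 0 ≤ m ∧ m ^ 2 = R := ⟨√R, Real.sqrt_nonneg _, Real.sq_sqrt hR⟩
  obtain ⟨w, hw, hww⟩ : ∃ m : ℝ, 0 ≤ m ∧ m ^ 2 = W := ⟨√W, Real.sqrt_nonneg _, Real.sq_sqrt hW⟩
  obtain ⟨e, he, hee⟩ : ∃ m : ℝ, 0 ≤ m ∧ m ^ 2 = ε := ⟨√ε, Real.sqrt_nonneg _, Real.sq_sqrt hε.le⟩
  have sm : √M = m := by rw [← hmm, Real.sqrt_sq hm]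
  have sr : √R = r := by rw [← hrr, Real.sqrt_sq hr]
  have sw : √W = w := by rw [← hww, Real.sqrt_sq hw]
  have se : √ε = e := by rw [← hee, Real.sqrt_sq he]
  rw [sm, sr, sw, se]
  have hC0 : 0 ≤ C := by linarith
  refine abs_le_of_sq_le_sq' ?_ (by positivity) |>.2
  have h1 : (e * (D + |N| * W)) ^ 2 ≤ 2 * ε * (D ^ 2 + N ^ 2 * W ^ 2) := by
    have : 0 ≤ e ^ 2 * (D - |N| * W) ^ 2 := by positivity
    rw [← sq_abs N, ← hee]; nlinarith
  have h2 : 2 * ε * (D ^ 2 + N ^ 2 * W ^ 2)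
      ≤ 4 / c0 * (K1 * (M * (1 + M)) * W ^ 2 + K2 * (R * W)) := by
    calc _ = 4 / c0 * (c0 / 2 * ε * (D ^ 2 + N ^ 2 * W ^ 2)) := by field_simp; ring
      _ ≤ _ := by gcongr
  have h3 : 4 / c0 * (K1 * (M * (1 + M)) * W ^ 2 + K2 * (R * W))
      ≤ C * (M * (1 + M) * W ^ 2 + R * W) := by
    have a1 : 4 / c0 * K1 ≤ C := by
      rw [hC]; have : 0 ≤ 4 / c0 * K2 := by positivity
      linarith
    have a2 : 4 / c0 * K2 ≤ C := by
      rw [hC]; have : 0 ≤ 4 / c0 * K1 := by positivity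
      linarith
    calc _ = (4 / c0 * K1) * (M * (1 + M) * W ^ 2) + (4 / c0 * K2) * (R * W) := by ring
      _ ≤ C * (M * (1 + M) * W ^ 2) + C * (R * W) := by gcongr
      _ = _ := by ring
  have h4 : C * (M * (1 + M) * W ^ 2 + R * W) ≤ C ^ 2 * (M * (1 + M) * W ^ 2 + R * W) := by
    gcongr; nlinarith
  have h5 : C ^ 2 * (M * (1 + M) * W ^ 2 + R * W)
      ≤ (C * (m * (1 + m)) * W + C * r * w) ^ 2 := by
    have : (C * (m * (1 + m)) * W + C * r * w) ^ 2
      = C ^ 2 * (M * (1 + M) * W ^ 2 + R * W) +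
        C ^ 2 * (2 * m * M * W ^ 2 + 2 * (m * (1 + m)) * W * r * w) := by
      rw [← hmm, ← hrr, ← hww]; ring
    rw [this]
    have : 0 ≤ C ^ 2 * (2 * m * M * W ^ 2 + 2 * (m * (1 + m)) * W * r * w) := by positivity
    linarith
  linarith

lemma aux_D (a y Q : ℝ) (ha : 0 < a) (hy : 0 < y) (ψ D : ℂ)
    (hD : (1 + y / a) ^ 2 * ‖D‖ ≤ Q) :
    ‖((a⁻¹ : ℝ) : ℂ) * ψ * D‖ ≤ Q * (‖ψ‖ / (a + y)) := by
  have h1 : (1 + y / a) * ‖D‖ ≤ Q := by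
    refine le_trans ?_ hD
    have : 0 ≤ y / a := by positivity
    gcongr
    nlinarith
  have h2 : a⁻¹ * ‖D‖ ≤ Q / (a + y) := by
    rw [le_div_iff₀ (by positivity)]
    calc a⁻¹ * ‖D‖ * (a + y) = (1 + y / a) * ‖D‖ := by field_simp
      _ ≤ Q := h1
  rw [norm_mul, norm_mul, Complex.norm_real, Real.norm_of_nonneg (by positivity)]
  calc a⁻¹ * ‖ψ‖ * ‖D‖ = (a⁻¹ * ‖D‖) * ‖ψ‖ := by ring
    _ ≤ Q / (a + y) * ‖ψ‖ := by gcongr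
    _ = _ := by ring

lemma aux_lin (C0 C1 h g : ℂ) (Q : ℝ) (h0 : ‖C0‖ ≤ Q) (h1 : ‖C1‖ ≤ Q) :
    ‖C0 * h + C1 * g‖ ≤ Q * (‖h‖ + ‖g‖) := by
  refine (norm_add_le _ _).trans ?_
  rw [norm_mul, norm_mul, mul_add]
  gcongr

lemma aux_E1 (a y N M Q : ℝ) (ha : 0 < a) (hy : 0 < y)
    (A0 A1 B0 B1 C0 C1 D h g h1 g1 ψ : ℂ) (hA0 : ‖A0‖ ≤ M) (hA1 : ‖A1‖ ≤ M)
    (hB0 : ‖B0‖ ≤ M) (hB1 : ‖B1‖ ≤ M) (hC0 : ‖C0‖ ≤ Q) (hC1 : ‖C1‖ ≤ Q)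
    (hD : (1 + y / a) ^ 2 * ‖D‖ ≤ Q) :
    ‖Complex.I * (N:ℂ) * ((a:ℂ) * (A0 * h + A1 * g)) + (a:ℂ) * (B0 * h1 + B1 * g1)
      + (C0 * h + C1 * g) + ((a⁻¹ : ℝ) : ℂ) * ψ * D‖
    ≤ a * |N| * M * (‖h‖ + ‖g‖) + a * M * (‖h1‖ + ‖g1‖)
      + Q * (‖h‖ + ‖g‖) + Q * (‖ψ‖ / (a + y)) := by
  refine (norm_add_le _ _).trans (add_le_add ?_ (aux_D a y Q ha hy ψ D hD))
  refine (norm_add_le _ _).trans (add_le_add ?_ (aux_lin _ _ _ _ _ hC0 hC1))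
  refine (norm_add_le _ _).trans (add_le_add ?_ ?_)
  · have := aux_lin _ _ h g _ hA0 hA1
    rw [norm_mul, norm_mul, norm_mul, Complex.norm_I, Complex.norm_real, Complex.norm_real,
      Real.norm_of_nonneg ha.le, Real.norm_eq_abs]
    calc 1 * |N| * (a * ‖A0 * h + A1 * g‖) ≤ 1 * |N| * (a * (M * (‖h‖ + ‖g‖))) := by gcongr
      _ = _ := by ring
  · have := aux_lin _ _ h1 g1 _ hB0 hB1
    rw [norm_mul, Complex.norm_real, Real.norm_of_nonneg ha.le, mul_assoc]
    gcongr

lemma aux_E3 (a y κ γ M Q H H1 : ℝ) (ha : 0 < a) (hy : 0 < y) (hκ : 0 < κ) (hγ : 0 < γ)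
    (hH : γ ≤ |H|) (hH1 : |H1| ≤ M)
    (C0 C1 D h g h1 ψ : ℂ) (hC0 : ‖C0‖ ≤ Q) (hC1 : ‖C1‖ ≤ Q)
    (hD : (1 + y / a) ^ 2 * ‖D‖ ≤ Q) :
    ‖-(((2 * κ * a * (H1 / H) : ℝ) : ℂ) * h1)
      + (C0 * h + C1 * g) + ((a⁻¹ : ℝ) : ℂ) * ψ * D‖
    ≤ 2 * κ * a * (M / γ) * ‖h1‖ + Q * (‖h‖ + ‖g‖) + Q * (‖ψ‖ / (a + y)) := by
  refine (norm_add_le _ _).trans (add_le_add ?_ (aux_D a y Q ha hy ψ D hD))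
  refine (norm_add_le _ _).trans (add_le_add ?_ (aux_lin _ _ _ _ _ hC0 hC1))
  rw [norm_neg, norm_mul, Complex.norm_real, Real.norm_eq_abs, abs_mul, abs_div,
    abs_of_pos (by positivity : 0 < 2 * κ * a)]
  have : 0 ≤ M := (abs_nonneg _).trans hH1
  gcongr

lemma aux_hardy (a y : ℝ) (ha : 0 < a) (hy : 0 < y) (ψ h : ℂ) :
    ((h * (starRingEnd ℂ) ψ + ψ * (starRingEnd ℂ) h).re * (a + y)
      - (ψ * (starRingEnd ℂ) ψ).re * 1) / (a + y) ^ 2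
    ≤ -(1/2) * (‖ψ‖ / (a + y)) ^ 2 + 2 * ‖h‖ ^ 2 := by
  have hb : 0 < a + y := by positivity
  have e1 : (ψ * (starRingEnd ℂ) ψ).re = ‖ψ‖ ^ 2 := by
    rw [Complex.mul_conj, Complex.ofReal_re, Complex.normSq_eq_norm_sq]
  have e2 : (h * (starRingEnd ℂ) ψ + ψ * (starRingEnd ℂ) h).re ≤ 2 * (‖h‖ * ‖ψ‖) := by
    have t1 := (abs_le.1 (aux_re h ψ)).2
    have t2 := (abs_le.1 (aux_re ψ h)).2
    rw [Complex.add_re]; linarith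
  rw [e1]
  calc _ ≤ (2 * (‖h‖ * ‖ψ‖) * (a + y) - ‖ψ‖ ^ 2 * 1) / (a + y) ^ 2 := by gcongr
    _ = 2 * (‖h‖ * (‖ψ‖ / (a + y))) - (‖ψ‖ / (a + y)) ^ 2 := by field_simp
    _ ≤ _ := by linarith [sq_nonneg (‖ψ‖ / (a + y) - 2 * ‖h‖), show (‖ψ‖ / (a + y) - 2 * ‖h‖) ^ 2
                  = (‖ψ‖ / (a + y)) ^ 2 - 4 * (‖h‖ * (‖ψ‖ / (a + y))) + 4 * ‖h‖ ^ 2 by ring]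

lemma aux_nrm4_sq (a b c d : ℝ → ℂ) : nrm4 a b c d ^ 2 = nsq a + nsq b + nsq c + nsq d := by
  have : ∀ f : ℝ → ℂ, 0 ≤ nsq f := fun f => integral_nonneg (fun y => by positivity)
  exact Real.sq_sqrt (by linarith [this a, this b, this c, this d])

lemma aux_int4 {a b c d : ℝ → ℂ} (h : ML2 a ∧ ML2 b ∧ ML2 c ∧ ML2 d) :
    IntegrableOn (fun y => ‖a y‖^2 + ‖b y‖^2 + ‖c y‖^2 + ‖d y‖^2) (Ioi 0) ∧
    ∫ y in Ioi (0:ℝ), (‖a y‖^2 + ‖b y‖^2 + ‖c y‖^2 + ‖d y‖^2) = nrm4 a b c d ^ 2 := by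
  obtain ⟨ha, hb, hc, hd⟩ := h
  unfold ML2 IntegrableOn at *
  refine ⟨((ha.add hb).add hc).add hd, ?_⟩
  rw [aux_nrm4_sq]
  unfold nsq
  have e1 := integral_add ((ha.add hb).add hc) hd
  have e2 := integral_add (ha.add hb) hc
  have e3 := integral_add ha hb
  simp only [Pi.add_apply] at e1 e2 e3
  rw [e1, e2, e3]

lemma aux_comb (W2 r2 D2 : ℝ → ℝ) (k1 k2 k3 : ℝ) (hW : IntegrableOn W2 (Ioi 0))
    (hr : IntegrableOn r2 (Ioi 0)) (hD : IntegrableOn D2 (Ioi 0)) :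
    IntegrableOn (fun y => k1 * W2 y + k2 * r2 y - k3 * D2 y) (Ioi 0) ∧
    ∫ y in Ioi (0:ℝ), (k1 * W2 y + k2 * r2 y - k3 * D2 y)
      = k1 * (∫ y in Ioi (0:ℝ), W2 y) + k2 * (∫ y in Ioi (0:ℝ), r2 y)
        - k3 * (∫ y in Ioi (0:ℝ), D2 y) := by
  unfold IntegrableOn at *
  have h1 := hW.const_mul k1
  have h2 := hr.const_mul k2
  have h3 := hD.const_mul k3
  refine ⟨(h1.add h2).sub h3, ?_⟩
  have e1 := integral_sub (h1.add h2) h3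
  have e2 := integral_add h1 h2
  simp only [Pi.add_apply] at e1 e2
  rw [e1, e2, integral_const_mul, integral_const_mul, integral_const_mul]

lemma aux_le_of_weight (Y x z B : ℝ) (k : ℕ) (hY : 0 ≤ Y) (hx : 0 ≤ x) (hz : 0 ≤ z)
    (h : (1 + Y) ^ k * (x + z) ≤ B) : x ≤ B ∧ z ≤ B ∧ x + z ≤ B := by
  have h1 : 1 ≤ (1 + Y) ^ k := one_le_pow₀ (by linarith)
  have h2 : x + z ≤ (1 + Y) ^ k * (x + z) := le_mul_of_one_le_left (by positivity) h1
  refine ⟨?_, ?_, ?_⟩ <;> linarith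

set_option maxHeartbeats 3200000 in
/-- the basic energy estimate
`√ε(‖∂_yŴ‖ + |ñ|‖Ŵ‖) ≤ C₃ M̄^{1/2}(1+M̄^{1/2})‖Ŵ‖ + C₃‖R‖^{1/2}‖Ŵ‖^{1/2}`
for solutions of the transformed linearized MHD system on one Fourier mode. -/
theorem stmt14
    (μ κ γ γbar γ₀ : ℝ) (hμ : 0 < μ) (hκ : 0 < κ)
    (hγ : 0 < γ) (hγγ : γ ≤ γbar) (hγ₀ : 0 < γ₀) :
    ∃ C₃ : ℝ, 0 < C₃ ∧
    ∀ (ε ϱ : ℝ) (n : ℤ), ε ∈ Set.Ioc (0:ℝ) 1 → 0 < ϱ → n ≠ 0 →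
    ∀ Us Hs : ℝ → ℝ, ContDiff ℝ 3 Us → ContDiff ℝ 3 Hs → Us 0 = 0 →
      (∀ Y, 0 ≤ Y → γ ≤ |Hs Y| ∧ |Hs Y| ≤ γbar) →
      (∀ Y, 0 ≤ Y → γ₀ ≤ Hs Y ^ 2 - Us Y ^ 2) →
    ∀ Mbar : ℝ,
      (∀ Y, 0 ≤ Y → ∀ k : ℕ, 1 ≤ k → k ≤ 3 →
        (1 + Y)^3 * (|iteratedDeriv k Us Y| + |iteratedDeriv k Hs Y|) ≤ Mbar) →
    ∀ (AU BU CU CH : ℝ → Matrix (Fin 2) (Fin 2) ℂ) (DU DH : ℝ → Fin 2 → ℂ),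
      Continuous AU → Continuous BU → Continuous CU → Continuous CH →
      Continuous DU → Continuous DH →
      (∀ Y, 0 ≤ Y → ∀ i j, (1 + Y) * (‖AU Y i j‖ + ‖BU Y i j‖) ≤ Mbar) →
      (∀ Y, 0 ≤ Y → ∀ i j, (1 + Y) * (‖CU Y i j‖ + ‖CH Y i j‖) ≤ Mbar * (1 + Mbar)) →
      (∀ Y, 0 ≤ Y → ∀ i, (1 + Y)^2 * (‖DU Y i‖ + ‖DH Y i‖) ≤ Mbar * (1 + Mbar)) →
    ∀ u v h g p R1 R2 R3 R4 : ℝ → ℂ,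
      ContDiff ℝ 3 u → ContDiff ℝ 3 v → ContDiff ℝ 3 h → ContDiff ℝ 3 g →
      ContDiff ℝ 2 p →
      (ML2 u ∧ ML2 v ∧ ML2 h ∧ ML2 g) →
      (ML2 (deriv u) ∧ ML2 (deriv v) ∧ ML2 (deriv h) ∧ ML2 (deriv g)) →
      (ML2 (deriv (deriv u)) ∧ ML2 (deriv (deriv v)) ∧
        ML2 (deriv (deriv h)) ∧ ML2 (deriv (deriv g))) →
      Tendsto (fun y => ‖u y‖ + ‖v y‖ + ‖h y‖ + ‖g y‖) atTop (nhds 0) →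
      Tendsto (fun y => ‖deriv u y‖ + ‖deriv v y‖ + ‖deriv h y‖ + ‖deriv g y‖)
        atTop (nhds 0) →
      Tendsto (fun y => ‖deriv (deriv u) y‖ + ‖deriv (deriv v) y‖
        + ‖deriv (deriv h) y‖ + ‖deriv (deriv g) y‖) atTop (nhds 0) →
      Tendsto (fun y => ‖p y‖ * (‖u y‖ + ‖v y‖ + ‖h y‖ + ‖g y‖)) atTop (nhds 0) →
      (ML2 R1 ∧ ML2 R2 ∧ ML2 R3 ∧ ML2 R4) →
      -- equation (E1), first and second components
      (∀ y, 0 < y →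
        Complex.I * (((n:ℝ)/ϱ : ℝ) : ℂ) *
            ((((1 + μ/κ) * Us (y / Real.sqrt ε) : ℝ) : ℂ) * u y
              - ((Hs (y / Real.sqrt ε) ^ 2 - Us (y / Real.sqrt ε) ^ 2 : ℝ) : ℂ) * h y
              + ((Real.sqrt ε : ℝ) : ℂ) *
                  (AU (y / Real.sqrt ε) 0 0 * h y + AU (y / Real.sqrt ε) 0 1 * g y))
          + ((Real.sqrt ε : ℝ) : ℂ) *
              (BU (y / Real.sqrt ε) 0 0 * deriv h y + BU (y / Real.sqrt ε) 0 1 * deriv g y)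
          + (CU (y / Real.sqrt ε) 0 0 * h y + CU (y / Real.sqrt ε) 0 1 * g y)
          + (((Real.sqrt ε)⁻¹ : ℝ) : ℂ) * (∫ s in (0:ℝ)..y, h s) * DU (y / Real.sqrt ε) 0
          + Complex.I * (((n:ℝ)/ϱ : ℝ) : ℂ) * p y
          - ((μ * ε : ℝ) : ℂ) *
              (deriv (deriv u) y - (((n:ℝ)/ϱ : ℝ) : ℂ)^2 * u y)
          = R1 y) →
      (∀ y, 0 < y →
        Complex.I * (((n:ℝ)/ϱ : ℝ) : ℂ) *
            ((((1 + μ/κ) * Us (y / Real.sqrt ε) : ℝ) : ℂ) * v y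
              - ((Hs (y / Real.sqrt ε) ^ 2 - Us (y / Real.sqrt ε) ^ 2 : ℝ) : ℂ) * g y
              + ((Real.sqrt ε : ℝ) : ℂ) *
                  (AU (y / Real.sqrt ε) 1 0 * h y + AU (y / Real.sqrt ε) 1 1 * g y))
          + ((Real.sqrt ε : ℝ) : ℂ) *
              (BU (y / Real.sqrt ε) 1 0 * deriv h y + BU (y / Real.sqrt ε) 1 1 * deriv g y)
          + (CU (y / Real.sqrt ε) 1 0 * h y + CU (y / Real.sqrt ε) 1 1 * g y)
          + (((Real.sqrt ε)⁻¹ : ℝ) : ℂ) * (∫ s in (0:ℝ)..y, h s) * DU (y / Real.sqrt ε) 1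
          + deriv p y
          - ((μ * ε : ℝ) : ℂ) *
              (deriv (deriv v) y - (((n:ℝ)/ϱ : ℝ) : ℂ)^2 * v y)
          = R2 y) →
      -- equation (E2), first and second components
      (∀ y, 0 < y →
        -(Complex.I * (((n:ℝ)/ϱ : ℝ) : ℂ)) * u y
          - ((2 * κ * Real.sqrt ε *
              (deriv Hs (y / Real.sqrt ε) / Hs (y / Real.sqrt ε)) : ℝ) : ℂ) * deriv h y
          + (CH (y / Real.sqrt ε) 0 0 * h y + CH (y / Real.sqrt ε) 0 1 * g y)
          + (((Real.sqrt ε)⁻¹ : ℝ) : ℂ) * (∫ s in (0:ℝ)..y, h s) * DH (y / Real.sqrt ε) 0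
          - ((κ * ε : ℝ) : ℂ) *
              (deriv (deriv h) y - (((n:ℝ)/ϱ : ℝ) : ℂ)^2 * h y)
          = R3 y) →
      (∀ y, 0 < y →
        -(Complex.I * (((n:ℝ)/ϱ : ℝ) : ℂ)) * v y
          - ((2 * κ * Real.sqrt ε *
              (deriv Hs (y / Real.sqrt ε) / Hs (y / Real.sqrt ε)) : ℝ) : ℂ) * deriv g y
          + (CH (y / Real.sqrt ε) 1 0 * h y + CH (y / Real.sqrt ε) 1 1 * g y)
          + (((Real.sqrt ε)⁻¹ : ℝ) : ℂ) * (∫ s in (0:ℝ)..y, h s) * DH (y / Real.sqrt ε) 1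
          - ((κ * ε : ℝ) : ℂ) *
              (deriv (deriv g) y - (((n:ℝ)/ϱ : ℝ) : ℂ)^2 * g y)
          = R4 y) →
      -- equation (E3): divergence-free conditions
      (∀ y, 0 < y →
        Complex.I * (((n:ℝ)/ϱ : ℝ) : ℂ) * u y + deriv v y = 0 ∧
        Complex.I * (((n:ℝ)/ϱ : ℝ) : ℂ) * h y + deriv g y = 0) →
      -- equation (E4): boundary conditions
      u 0 = 0 → v 0 = 0 → deriv h 0 = 0 → g 0 = 0 →
      Real.sqrt ε * (nrm4 (deriv u) (deriv v) (deriv h) (deriv g)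
          + |(n:ℝ)/ϱ| * nrm4 u v h g)
        ≤ C₃ * (Real.sqrt Mbar * (1 + Real.sqrt Mbar)) * nrm4 u v h g
          + C₃ * Real.sqrt (nrm4 R1 R2 R3 R4) * Real.sqrt (nrm4 u v h g) := by
  have hΓ : 0 < γbar := hγ.trans_le hγγ
  set c0 := min μ (κ * γ₀) with hc0d
  have hc0 : 0 < c0 := lt_min hμ (by positivity)
  set K1 := ((4 + 4 * κ * γbar ^ 2 / γ + 8 * κ * γbar) ^ 2 + 16) / (2 * c0) + 9 + 9 * γbar ^ 2
    with hK1
  set K2 := 2 + 2 * γbar ^ 2 with hK2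
  have hK10 : 0 ≤ K1 := by positivity
  have hK20 : 0 < K2 := by positivity
  refine ⟨1 + 4 / c0 * (K1 + K2), by positivity, ?_⟩
  intro ε ϱ n hε hϱ hn Us Hs hUs hHs hU0 hHb hGb Mbar hM AU BU CU CH DU DH _ _ _ _ _ _ hAB hC hD
    u v h g p R1 R2 R3 R4 hu hv hh hg hp hW hW' hW'' tW tW' _ tp hR E1 E2 E3 E4 hdiv u0 v0 h0 g0
  have hε0 := hε.1
  obtain ⟨a, ha, rfl⟩ : ∃ a : ℝ, 0 < a ∧ ε = a ^ 2 :=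
    ⟨√ε, Real.sqrt_pos.2 hε0, (Real.sq_sqrt hε0.le).symm⟩
  simp only [Real.sqrt_sq ha.le] at E1 E2 E3 E4
  generalize hN : (n:ℝ) / ϱ = N at *
  have hM0 : 0 ≤ Mbar := le_trans (by positivity) (hM 0 le_rfl 1 le_rfl (by norm_num))
  refine aux_final c0 K1 K2 (a ^ 2) N Mbar _ _ _ _ hc0 hK10 hK20.le hε0 hM0
    (Real.sqrt_nonneg _) (Real.sqrt_nonneg _) rfl ?_
  -- derivatives
  have du : ∀ y, HasDerivAt u (deriv u y) y := fun y => (hu.differentiable (by norm_num) y).hasDerivAt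
  have dv : ∀ y, HasDerivAt v (deriv v y) y := fun y => (hv.differentiable (by norm_num) y).hasDerivAt
  have dh : ∀ y, HasDerivAt h (deriv h y) y := fun y => (hh.differentiable (by norm_num) y).hasDerivAt
  have dg : ∀ y, HasDerivAt g (deriv g y) y := fun y => (hg.differentiable (by norm_num) y).hasDerivAt
  have dp : ∀ y, HasDerivAt p (deriv p y) y := fun y => (hp.differentiable (by norm_num) y).hasDerivAt
  have dd : ∀ f : ℝ → ℂ, ContDiff ℝ 3 f → ∀ y, HasDerivAt (deriv f) (deriv (deriv f) y) y := by
    intro f hf y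
    have h2 : ContDiff ℝ (2 + 1) f := hf.of_le (by norm_num)
    exact ((contDiff_succ_iff_deriv.1 h2).2.2.differentiable (by norm_num) y).hasDerivAt
  have ddu := dd u hu
  have ddv := dd v hv
  have ddh := dd h hh
  have ddg := dd g hg
  have dU : ∀ y, HasDerivAt Us (deriv Us y) y := fun y => (hUs.differentiable (by norm_num) y).hasDerivAt
  have dH : ∀ y, HasDerivAt Hs (deriv Hs y) y := fun y => (hHs.differentiable (by norm_num) y).hasDerivAt
  let ψ : ℝ → ℂ := fun y => ∫ s in (0:ℝ)..y, h s
  have dψ : ∀ y, HasDerivAt ψ (h y) y := fun y =>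
    intervalIntegral.integral_hasDerivAt_right (hh.continuous.intervalIntegrable _ _)
      (hh.continuous.stronglyMeasurableAtFilter _ _) hh.continuous.continuousAt
  let G : ℝ → ℝ := fun y => Hs (y / a) ^ 2 - Us (y / a) ^ 2
  let GY : ℝ → ℝ := fun y => 2 * Hs (y / a) * (deriv Hs (y / a) * (1 / a))
    - 2 * Us (y / a) * (deriv Us (y / a) * (1 / a))
  have dG : ∀ y, HasDerivAt G (GY y) y := by
    intro y
    have hi : HasDerivAt (fun y : ℝ => y / a) (1 / a) y := (hasDerivAt_id y).div_const a
    have h1 := ((dH (y / a)).comp y hi).pow 2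
    have h2 := ((dU (y / a)).comp y hi).pow 2
    have e : GY y = 2 * Hs (y / a) ^ (2 - 1) * (deriv Hs (y / a) * (1 / a))
        - 2 * Us (y / a) ^ (2 - 1) * (deriv Us (y / a) * (1 / a)) := by
      simp only [GY]; norm_num
    rw [e]
    exact h1.sub h2
  have hYp : ∀ y : ℝ, 0 < y → 0 ≤ y / a := fun y hy => by positivity
  have hUb : ∀ Y, 0 ≤ Y → |Us Y| ≤ γbar := fun Y hY => by
    have h1 := (hHb Y hY).2
    have h2 := hGb Y hY
    have h3 : |Us Y| ^ 2 ≤ |Hs Y| ^ 2 := by rw [sq_abs, sq_abs]; linarith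
    exact (abs_le_of_sq_le_sq' h3 (abs_nonneg _)).2.trans h1
  have hdb : ∀ Y, 0 ≤ Y → |deriv Us Y| ≤ Mbar ∧ |deriv Hs Y| ≤ Mbar := fun Y hY => by
    have h1 := hM Y hY 1 le_rfl (by norm_num)
    simp only [iteratedDeriv_one] at h1
    have h2 := aux_le_of_weight Y _ _ _ 3 hY (abs_nonneg _) (abs_nonneg _) h1
    exact ⟨h2.1, h2.2.1⟩
  have hGle : ∀ y, 0 < y → G y ≤ γbar ^ 2 := fun y hy => by
    have h1 := (hHb _ (hYp y hy)).2
    have h2 : |Hs (y / a)| ^ 2 ≤ γbar ^ 2 := by gcongr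
    rw [sq_abs] at h2
    have h3 := sq_nonneg (Us (y / a))
    simp only [G]; linarith
  have hGge : ∀ y, 0 < y → γ₀ ≤ G y := fun y hy => hGb _ (hYp y hy)
  have hGYb : ∀ y, 0 < y → a * |GY y| ≤ 4 * γbar * Mbar := fun y hy => by
    have h1 := (hHb _ (hYp y hy)).2
    have h2 := hUb _ (hYp y hy)
    obtain ⟨h3, h4⟩ := hdb _ (hYp y hy)
    have e : a * |GY y| = |2 * (Hs (y / a) * deriv Hs (y / a)) - 2 * (Us (y / a) * deriv Us (y / a))| := by
      rw [← abs_of_pos ha, ← abs_mul, abs_of_pos ha]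
      congr 1
      simp only [GY]; field_simp
    rw [e]
    refine (abs_sub _ _).trans ?_
    rw [abs_mul, abs_mul, abs_mul 2, abs_mul (Us _), abs_two]
    have m1 : |Hs (y / a)| * |deriv Hs (y / a)| ≤ γbar * Mbar := by gcongr
    have m2 : |Us (y / a)| * |deriv Us (y / a)| ≤ γbar * Mbar := by gcongr
    linarith
  let L := Mbar * (1 + Mbar) * K2
  have hL : 0 ≤ L := by positivity
  let q : ℝ → ℝ := fun y => (p y * (starRingEnd ℂ) (v y)).re
      - μ * a ^ 2 * ((deriv u y * (starRingEnd ℂ) (u y)).re + (deriv v y * (starRingEnd ℂ) (v y)).re)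
      - κ * a ^ 2 * G y * ((deriv h y * (starRingEnd ℂ) (h y)).re
        + (deriv g y * (starRingEnd ℂ) (g y)).re)
      + L * ((ψ y * (starRingEnd ℂ) (ψ y)).re / (a + y))
  let φ' : ℝ → ℝ := fun y => ((h y * (starRingEnd ℂ) (ψ y) + ψ y * (starRingEnd ℂ) (h y)).re * (a + y)
      - (ψ y * (starRingEnd ℂ) (ψ y)).re * 1) / (a + y) ^ 2
  let q' : ℝ → ℝ := fun y => (deriv p y * (starRingEnd ℂ) (v y) + p y * (starRingEnd ℂ) (deriv v y)).re
      - μ * a ^ 2 * ((deriv (deriv u) y * (starRingEnd ℂ) (u y)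
            + deriv u y * (starRingEnd ℂ) (deriv u y)).re
          + (deriv (deriv v) y * (starRingEnd ℂ) (v y) + deriv v y * (starRingEnd ℂ) (deriv v y)).re)
      - (κ * a ^ 2 * GY y * ((deriv h y * (starRingEnd ℂ) (h y)).re
        + (deriv g y * (starRingEnd ℂ) (g y)).re)
        + κ * a ^ 2 * G y * ((deriv (deriv h) y * (starRingEnd ℂ) (h y)
            + deriv h y * (starRingEnd ℂ) (deriv h y)).re
          + (deriv (deriv g) y * (starRingEnd ℂ) (g y) + deriv g y * (starRingEnd ℂ) (deriv g y)).re))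
      + L * φ' y
  have dq : ∀ y, 0 ≤ y → HasDerivAt q (q' y) y := by
    intro y hy
    have hay : a + y ≠ 0 := by positivity
    have dphi := (aux_hasDeriv (dψ y) (dψ y)).div ((hasDerivAt_id y).const_add a) hay
    exact (((aux_hasDeriv (dp y) (dv y)).sub
      (((aux_hasDeriv (ddu y) (du y)).add (aux_hasDeriv (ddv y) (dv y))).const_mul (μ * a ^ 2))).sub
      (((dG y).const_mul (κ * a ^ 2)).mul
        ((aux_hasDeriv (ddh y) (dh y)).add (aux_hasDeriv (ddg y) (dg y))))).add
      (dphi.const_mul L)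
  have q0 : q 0 ≤ 0 := by
    have : ψ 0 = 0 := by simp [ψ]
    simp [q, u0, v0, h0, g0, this]
  obtain ⟨iW, eW⟩ := aux_int4 hW
  obtain ⟨iD, eD⟩ := aux_int4 hW'
  obtain ⟨iR, eR⟩ := aux_int4 hR
  have main : ∀ lam : ℝ, 0 < lam →
      (c0 / 2 * a ^ 2 * (nrm4 (deriv u) (deriv v) (deriv h) (deriv g) ^ 2
        + N ^ 2 * nrm4 u v h g ^ 2) - K1 * (Mbar * (1 + Mbar)) * nrm4 u v h g ^ 2) / K2
      ≤ 0 + (lam / 2 * nrm4 R1 R2 R3 R4 ^ 2 + 1 / (2 * lam) * nrm4 u v h g ^ 2) := by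
    intro lam hlam
    obtain ⟨iF, eF⟩ := aux_comb _ _ _
      (K1 * (Mbar * (1 + Mbar)) + K2 * (1 / (2 * lam)) - c0 / 2 * a ^ 2 * N ^ 2)
      (K2 * (lam / 2)) (c0 / 2 * a ^ 2) iW iR iD
    have key := aux_integrate q
      (fun y => -(‖p y‖ * (‖u y‖ + ‖v y‖ + ‖h y‖ + ‖g y‖))
        - (μ * a ^ 2 + κ * a ^ 2 * γbar ^ 2) *
          ((‖deriv u y‖ + ‖deriv v y‖ + ‖deriv h y‖ + ‖deriv g y‖)
            * (‖u y‖ + ‖v y‖ + ‖h y‖ + ‖g y‖)))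
      q' _ (fun y hy => dq y hy.le)
      (fun y hy => (dq y hy).continuousAt.continuousWithinAt) q0 ?_ ?_ iF ?_
    · rw [eF, eW, eD, eR] at key
      rw [div_le_iff₀ hK20]
      linarith
    · -- lower bound
      intro y hy
      set S := ‖u y‖ + ‖v y‖ + ‖h y‖ + ‖g y‖ with hS
      set S' := ‖deriv u y‖ + ‖deriv v y‖ + ‖deriv h y‖ + ‖deriv g y‖ with hS'
      have nn := fun z : ℂ => norm_nonneg z
      have bv : ‖v y‖ ≤ S := by linarith [nn (u y), nn (v y), nn (h y), nn (g y)]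
      have b1 : |(p y * (starRingEnd ℂ) (v y)).re| ≤ ‖p y‖ * S :=
        (aux_re _ _).trans (by gcongr)
      have pu := (nn (deriv u y))
      have b2 : |(deriv u y * (starRingEnd ℂ) (u y)).re + (deriv v y * (starRingEnd ℂ) (v y)).re|
          ≤ S' * S := by
        refine (abs_add_le _ _).trans ((add_le_add (aux_re _ _) (aux_re _ _)).trans ?_)
        calc _ ≤ (‖deriv u y‖ + ‖deriv v y‖) * (‖u y‖ + ‖v y‖) := by
              nlinarith [mul_nonneg (nn (deriv u y)) (nn (v y)), mul_nonneg (nn (deriv v y)) (nn (u y))]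
          _ ≤ S' * S := by
              gcongr
              · linarith [nn (deriv h y), nn (deriv g y)]
              · linarith [nn (h y), nn (g y)]
      have b3 : |(deriv h y * (starRingEnd ℂ) (h y)).re + (deriv g y * (starRingEnd ℂ) (g y)).re|
          ≤ S' * S := by
        refine (abs_add_le _ _).trans ((add_le_add (aux_re _ _) (aux_re _ _)).trans ?_)
        calc _ ≤ (‖deriv h y‖ + ‖deriv g y‖) * (‖h y‖ + ‖g y‖) := by
              nlinarith [mul_nonneg (nn (deriv h y)) (nn (g y)), mul_nonneg (nn (deriv g y)) (nn (h y))]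
          _ ≤ S' * S := by
              gcongr
              · linarith [nn (deriv u y), nn (deriv v y)]
              · linarith [nn (u y), nn (v y)]
      have hSS : 0 ≤ S' * S := by positivity
      have hGp : 0 ≤ G y := hγ₀.le.trans (hGge y hy)
      have c2 : μ * a ^ 2 * ((deriv u y * (starRingEnd ℂ) (u y)).re
          + (deriv v y * (starRingEnd ℂ) (v y)).re) ≤ μ * a ^ 2 * (S' * S) := by
        gcongr; exact (abs_le.1 b2).2
      have c3 : κ * a ^ 2 * G y * ((deriv h y * (starRingEnd ℂ) (h y)).re
          + (deriv g y * (starRingEnd ℂ) (g y)).re) ≤ κ * a ^ 2 * γbar ^ 2 * (S' * S) := by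
        have := hGle y hy
        calc _ ≤ κ * a ^ 2 * G y * (S' * S) := by gcongr; exact (abs_le.1 b3).2
          _ ≤ _ := by gcongr
      have c4 : 0 ≤ L * ((ψ y * (starRingEnd ℂ) (ψ y)).re / (a + y)) := by
        have : 0 ≤ (ψ y * (starRingEnd ℂ) (ψ y)).re := by
          rw [Complex.mul_conj, Complex.ofReal_re]; exact Complex.normSq_nonneg _
        positivity
      have c1 := (abs_le.1 b1).1
      simp only [q]
      linarith
    · have := (tp.neg).sub ((tW'.mul tW).const_mul (μ * a ^ 2 + κ * a ^ 2 * γbar ^ 2))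
      simpa using this
    · intro y hy
      have hY := hYp y hy
      have bA : ∀ i j, ‖AU (y / a) i j‖ ≤ Mbar ∧ ‖BU (y / a) i j‖ ≤ Mbar := fun i j => by
        have := aux_le_of_weight (y / a) _ _ _ 1 hY (norm_nonneg _) (norm_nonneg _)
          (by simpa using hAB _ hY i j)
        exact ⟨this.1, this.2.1⟩
      have bC : ∀ i j, ‖CU (y / a) i j‖ ≤ Mbar * (1 + Mbar) ∧ ‖CH (y / a) i j‖ ≤ Mbar * (1 + Mbar) :=
        fun i j => by
        have := aux_le_of_weight (y / a) _ _ _ 1 hY (norm_nonneg _) (norm_nonneg _)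
          (by simpa using hC _ hY i j)
        exact ⟨this.1, this.2.1⟩
      have bD : ∀ i, (1 + y / a) ^ 2 * ‖DU (y / a) i‖ ≤ Mbar * (1 + Mbar) ∧
          (1 + y / a) ^ 2 * ‖DH (y / a) i‖ ≤ Mbar * (1 + Mbar) := fun i => by
        have h1 := hD _ hY i
        rw [mul_add] at h1
        have h2 : 0 ≤ (1 + y / a) ^ 2 * ‖DU (y / a) i‖ := by positivity
        have h3 : 0 ≤ (1 + y / a) ^ 2 * ‖DH (y / a) i‖ := by positivity
        constructor <;> linarith
      have hHy := (hHb _ hY).1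
      have hH1 := (hdb _ hY).2
      have F1 := aux_E1 a y N Mbar (Mbar * (1 + Mbar)) ha hy _ _ _ _ _ _ _ (h y) (g y) (deriv h y)
        (deriv g y) (ψ y) (bA 0 0).1 (bA 0 1).1 (bA 0 0).2 (bA 0 1).2 (bC 0 0).1 (bC 0 1).1 (bD 0).1
      have F2 := aux_E1 a y N Mbar (Mbar * (1 + Mbar)) ha hy _ _ _ _ _ _ _ (h y) (g y) (deriv h y)
        (deriv g y) (ψ y) (bA 1 0).1 (bA 1 1).1 (bA 1 0).2 (bA 1 1).2 (bC 1 0).1 (bC 1 1).1 (bD 1).1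
      have F3 := aux_E3 a y κ γ Mbar (Mbar * (1 + Mbar)) _ _ ha hy hκ hγ hHy hH1 _ _ _ (h y) (g y)
        (deriv h y) (ψ y) (bC 0 0).2 (bC 0 1).2 (bD 0).2
      have F4 := aux_E3 a y κ γ Mbar (Mbar * (1 + Mbar)) _ _ ha hy hκ hγ hHy hH1 _ _ _ (h y) (g y)
        (deriv g y) (ψ y) (bC 1 0).2 (bC 1 1).2 (bD 1).2
      have PW := aux_pointwise μ κ γ γbar γ₀ hκ hγ hΓ hγ₀ c0 hc0 (min_le_left _ _)
        (min_le_right _ _) a N Mbar (G y) (GY y) (‖ψ y‖ / (a + y)) (φ' y) ha hM0 (hGge y hy)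
        (hGle y hy) (hGYb y hy) (by positivity) (u y) (v y) (h y) (g y) (deriv u y) (deriv v y)
        (deriv h y) (deriv g y) _ _ _ _ (R1 y) (R2 y) (R3 y) (R4 y)
        (aux_hardy a y ha hy (ψ y) (h y)) F1 F2 F3 F4 lam hlam
      have ID := aux_identity N μ κ (a ^ 2) (G y) (GY y) ((1 + μ / κ) * Us (y / a))
        (u y) (v y) (h y) (g y) (deriv u y) (deriv v y) (deriv h y) (deriv g y)
        (deriv (deriv u) y) (deriv (deriv v) y) (deriv (deriv h) y) (deriv (deriv g) y)
        (p y) (deriv p y)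
        (Complex.I * (N:ℂ) * ((a:ℂ) * (AU (y / a) 0 0 * h y + AU (y / a) 0 1 * g y))
          + (a:ℂ) * (BU (y / a) 0 0 * deriv h y + BU (y / a) 0 1 * deriv g y)
          + (CU (y / a) 0 0 * h y + CU (y / a) 0 1 * g y) + ((a⁻¹ : ℝ) : ℂ) * ψ y * DU (y / a) 0)
        (Complex.I * (N:ℂ) * ((a:ℂ) * (AU (y / a) 1 0 * h y + AU (y / a) 1 1 * g y))
          + (a:ℂ) * (BU (y / a) 1 0 * deriv h y + BU (y / a) 1 1 * deriv g y)
          + (CU (y / a) 1 0 * h y + CU (y / a) 1 1 * g y) + ((a⁻¹ : ℝ) : ℂ) * ψ y * DU (y / a) 1)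
        (-(((2 * κ * a * (deriv Hs (y / a) / Hs (y / a)) : ℝ) : ℂ) * deriv h y)
          + (CH (y / a) 0 0 * h y + CH (y / a) 0 1 * g y) + ((a⁻¹ : ℝ) : ℂ) * ψ y * DH (y / a) 0)
        (-(((2 * κ * a * (deriv Hs (y / a) / Hs (y / a)) : ℝ) : ℂ) * deriv g y)
          + (CH (y / a) 1 0 * h y + CH (y / a) 1 1 * g y) + ((a⁻¹ : ℝ) : ℂ) * ψ y * DH (y / a) 1)
        (R1 y) (R2 y) (R3 y) (R4 y)
        (Eq.trans (by simp only [G, ψ]; ring) (E1 y hy)) (Eq.trans (by simp only [G, ψ]; ring) (E2 y hy))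
        (Eq.trans (by simp only [G, ψ]; ring) (E3 y hy)) (Eq.trans (by simp only [G, ψ]; ring) (E4 y hy))
        (hdiv y hy).1
      simp only [q']
      rw [ID]
      refine PW.trans (le_of_eq ?_)
      ring
  have fin := aux_lam _ 0 _ _ (Real.sqrt_nonneg _) (Real.sqrt_nonneg _) main
  change _ ≤ 0 + nrm4 R1 R2 R3 R4 * nrm4 u v h g at fin
  rw [div_le_iff₀ hK20] at fin
  linarith
end
end

section
/- There exists a constant C₄ > 0, depending only on μ, κ, γ₀ and γ̄ and in particular independent of ε, ñ and M̄, such that every solution as in the hypotheses satisfies |ñ|^{1/2}·‖Û‖_{L²} ≤ C₄·M̄^{1/2}(1+M̄^{1/2})·‖Ŵ‖_{L²} + C₄·‖R‖_{L²}^{1/2}·‖Ŵ‖_{L²}^{1/2}. -/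
open MeasureTheory Set Filter

noncomputable section

/-- L² norm of a pair of functions on `(0,∞)`. -/
def nrm2 (a b : ℝ → ℂ) : ℝ := Real.sqrt (nsq a + nsq b)


lemma energy_id (m k e G G1 N a : ℝ) (u v h g u1 v1 h1 g1 u2 v2 h2 g2 p p1 T1 T2 T3 T4 : ℂ)
    (hm : Complex.I * (N:ℂ) * u + v1 = 0)
    (E1 : Complex.I * (N:ℂ) * ((a:ℂ) * u - (G:ℂ) * h) + T1 + Complex.I * (N:ℂ) * p
      - ((m * e : ℝ) : ℂ) * (u2 - (N:ℂ)^2 * u) = 0)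
    (E2 : Complex.I * (N:ℂ) * ((a:ℂ) * v - (G:ℂ) * g) + T2 + p1
      - ((m * e : ℝ) : ℂ) * (v2 - (N:ℂ)^2 * v) = 0)
    (E3 : -(Complex.I * (N:ℂ)) * u + T3 - ((k * e : ℝ) : ℂ) * (h2 - (N:ℂ)^2 * h) = 0)
    (E4 : -(Complex.I * (N:ℂ)) * v + T4 - ((k * e : ℝ) : ℂ) * (g2 - (N:ℂ)^2 * g) = 0) :
    m * e * ((u2.re * u.re + u2.im * u.im) + (u1.re^2 + u1.im^2)
        + (v2.re * v.re + v2.im * v.im) + (v1.re^2 + v1.im^2))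
      + k * e * (G1 * ((h1.re * h.re + h1.im * h.im) + (g1.re * g.re + g1.im * g.im))
        + G * ((h2.re * h.re + h2.im * h.im) + (h1.re^2 + h1.im^2)
          + (g2.re * g.re + g2.im * g.im) + (g1.re^2 + g1.im^2)))
      - ((p1.re * v.re + p1.im * v.im) + (p.re * v1.re + p.im * v1.im))
    = m * e * ((u1.re^2 + u1.im^2) + (v1.re^2 + v1.im^2)
        + N^2 * ((u.re^2 + u.im^2) + (v.re^2 + v.im^2)))
      + k * e * G * ((h1.re^2 + h1.im^2) + (g1.re^2 + g1.im^2)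
        + N^2 * ((h.re^2 + h.im^2) + (g.re^2 + g.im^2)))
      + (T1.re * u.re + T1.im * u.im) + (T2.re * v.re + T2.im * v.im)
      + G * ((T3.re * h.re + T3.im * h.im) + (T4.re * g.re + T4.im * g.im))
      + k * e * G1 * ((h1.re * h.re + h1.im * h.im) + (g1.re * g.re + g1.im * g.im)) := by
  have r0 := congrArg Complex.re hm
  have i0 := congrArg Complex.im hm
  have r1 := congrArg Complex.re E1
  have i1 := congrArg Complex.im E1
  have r2 := congrArg Complex.re E2
  have i2 := congrArg Complex.im E2
  have r3 := congrArg Complex.re E3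
  have i3 := congrArg Complex.im E3
  have r4 := congrArg Complex.re E4
  have i4 := congrArg Complex.im E4
  simp [pow_two] at r0 i0 r1 i1 r2 i2 r3 i3 r4 i4
  linear_combination (-u.re) * r1 - u.im * i1 - v.re * r2 - v.im * i2
    - G * (h.re * r3 + h.im * i3 + g.re * r4 + g.im * i4) - p.re * r0 - p.im * i0

lemma cross_id (k e N σ : ℝ) (u v h g u1 v1 h1 g1 h2 g2 T3 T4 : ℂ)
    (E3 : -(Complex.I * (N:ℂ)) * u + T3 - ((k * e : ℝ) : ℂ) * (h2 - (N:ℂ)^2 * h) = 0)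
    (E4 : -(Complex.I * (N:ℂ)) * v + T4 - ((k * e : ℝ) : ℂ) * (g2 - (N:ℂ)^2 * g) = 0) :
    σ * N * (u.re^2 + u.im^2 + (v.re^2 + v.im^2)) =
     σ * k * e * ((h2.re * u.im - h2.im * u.re) + (h1.re * u1.im - h1.im * u1.re)
        + (g2.re * v.im - g2.im * v.re) + (g1.re * v1.im - g1.im * v1.re))
     - σ * k * e * ((h1.re * u1.im - h1.im * u1.re) + (g1.re * v1.im - g1.im * v1.re)
       + N^2 * ((h.re * u.im - h.im * u.re) + (g.re * v.im - g.im * v.re)))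
     - σ * ((T3.re * u.im - T3.im * u.re) + (T4.re * v.im - T4.im * v.re)) := by
  have r3 := congrArg Complex.re E3
  have i3 := congrArg Complex.im E3
  have r4 := congrArg Complex.re E4
  have i4 := congrArg Complex.im E4
  simp [pow_two] at r3 i3 r4 i4
  linear_combination σ * (u.im * r3 - u.re * i3 + v.im * r4 - v.re * i4)

lemma ft {f : ℝ → ℝ} {Q B : ℝ → ℝ} (hf : IntegrableOn f (Ioi 0))
    (hQc : ContinuousOn Q (Ici 0)) (hQ : ∀ y, 0 < y → ∃ q, HasDerivAt Q q y ∧ f y ≤ q) (h0 : Q 0 = 0)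
    (hB : Tendsto B atTop (nhds 0)) (hQB : ∀ y, 0 < y → Q y ≤ B y) :
    ∫ y in Ioi (0:ℝ), f y ≤ 0 := by
  have h1 := intervalIntegral_tendsto_integral_Ioi (0:ℝ) hf tendsto_id
  refine le_of_tendsto_of_tendsto h1 hB ?_
  filter_upwards [eventually_gt_atTop (0:ℝ)] with T hT
  have := intervalIntegral.integral_le_sub_of_hasDeriv_right_of_le (a := 0) (b := T) (g := Q)
    (g' := deriv Q) (φ := f) hT.le
    (hQc.mono Icc_subset_Ici_self)
    (fun x hx => by
      obtain ⟨q, hq, -⟩ := hQ x hx.1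
      exact hq.differentiableAt.hasDerivAt.hasDerivWithinAt) ?_
    (fun x hx => by
      obtain ⟨q, hq, h⟩ := hQ x hx.1
      rwa [hq.deriv])
  · simp only [id]; linarith [hQB T hT]
  · rw [integrableOn_Icc_iff_integrableOn_Ioc]
    exact hf.mono_set Ioc_subset_Ioi_self

lemma opt {x A r w K : ℝ} (hr : 0 ≤ r) (hw : 0 ≤ w)
    (h : ∀ t, 0 < t → x ≤ A + K * (t * r^2 + w^2 / t)) : x ≤ A + K * (2 * (r * w)) := by
  rcases hr.eq_or_lt with rfl | hr
  · have : Tendsto (fun t : ℝ => A + K * (t * 0^2 + w^2 / t)) atTop (nhds (A + K * 0)) := by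
      refine tendsto_const_nhds.add (Tendsto.const_mul _ ?_)
      simpa using tendsto_const_nhds.div_atTop tendsto_id
    have := ge_of_tendsto this ((eventually_gt_atTop 0).mono h)
    simpa using this
  rcases hw.eq_or_lt with rfl | hw
  · have h1 : Tendsto (fun t : ℝ => A + K * (t * r^2 + 0^2 / t)) (nhdsWithin 0 (Ioi 0)) (nhds (A + K * 0)) := by
      refine tendsto_const_nhds.add (Tendsto.const_mul _ ?_)
      refine Tendsto.mono_left ?_ nhdsWithin_le_nhds
      have : Continuous (fun t : ℝ => t * r^2) := by fun_prop
      simpa using this.tendsto 0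
    have := ge_of_tendsto h1 (by filter_upwards [self_mem_nhdsWithin] with t ht using h t ht)
    simpa using this
  · have := h (w / r) (by positivity)
    have e : w / r * r^2 + w^2 / (w/r) = 2 * (r * w) := by field_simp; ring
    rwa [e] at this

lemma dot_le (a b : ℂ) : |a.re * b.re + a.im * b.im| ≤ ‖a‖ * ‖b‖ := by
  have h : a.re * b.re + a.im * b.im = (a * (starRingEnd ℂ) b).re := by simp
  rw [h]
  refine (Complex.abs_re_le_norm _).trans ?_
  simp

lemma crs_le (a b : ℂ) : |a.re * b.im - a.im * b.re| ≤ ‖a‖ * ‖b‖ := by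
  have h : a.re * b.im - a.im * b.re = -(a * (starRingEnd ℂ) b).im := by simp; ring
  rw [h, abs_neg]
  refine (Complex.abs_im_le_norm _).trans ?_
  simp

lemma nsq_eq (a : ℂ) : a.re^2 + a.im^2 = ‖a‖^2 := by
  rw [← Complex.normSq_eq_norm_sq, Complex.normSq_apply]; ring

lemma TU_le {N s M L P W D : ℝ} {h g h1 g1 a0 a1 b0 b1 c0 c1 q R : ℂ} (hs : 0 ≤ s)
    (hM : 0 ≤ M) (hL : 0 ≤ L)
    (ha0 : ‖a0‖ ≤ M) (ha1 : ‖a1‖ ≤ M) (hb0 : ‖b0‖ ≤ M) (hb1 : ‖b1‖ ≤ M)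
    (hc0 : ‖c0‖ ≤ L) (hc1 : ‖c1‖ ≤ L) (hq : ‖q‖ ≤ L * P)
    (hW : ‖h‖ + ‖g‖ ≤ W) (hD : ‖h1‖ + ‖g1‖ ≤ D) :
    ‖Complex.I * (N:ℂ) * ((s:ℂ) * (a0 * h + a1 * g)) + (s:ℂ) * (b0 * h1 + b1 * g1)
      + (c0 * h + c1 * g) + q - R‖ ≤ M * s * (|N| * W + D) + L * (W + P) + ‖R‖ := by
  have two : ∀ {x y z w : ℂ} {B V : ℝ}, 0 ≤ B → ‖x‖ ≤ B → ‖y‖ ≤ B → ‖z‖ + ‖w‖ ≤ V →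
      ‖x * z + y * w‖ ≤ B * V := by
    intro x y z w B V hB hx hy hV
    refine (norm_add_le _ _).trans ?_
    rw [norm_mul, norm_mul]
    have := mul_le_mul_of_nonneg_right hx (norm_nonneg z)
    have := mul_le_mul_of_nonneg_right hy (norm_nonneg w)
    have := mul_le_mul_of_nonneg_left hV hB
    linarith
  have t1 := two hM ha0 ha1 hW
  have t2 := two hM hb0 hb1 hD
  have t3 := two hL hc0 hc1 hW
  refine (norm_sub_le _ _).trans ?_
  have n1 := norm_add₄_le (a := Complex.I * (N:ℂ) * ((s:ℂ) * (a0 * h + a1 * g))) (b := (s:ℂ) * (b0 * h1 + b1 * g1))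
    (c := (c0 * h + c1 * g)) (d := q)
  have e1 : ‖Complex.I * (N:ℂ) * ((s:ℂ) * (a0 * h + a1 * g))‖ ≤ |N| * (s * (M * W)) := by
    simp only [norm_mul, Complex.norm_I, Complex.norm_real, Real.norm_eq_abs, abs_of_nonneg hs, one_mul]
    gcongr
  have e2 : ‖(s:ℂ) * (b0 * h1 + b1 * g1)‖ ≤ s * (M * D) := by
    simp only [norm_mul, Complex.norm_real, Real.norm_eq_abs, abs_of_nonneg hs]
    gcongr
  linarith

lemma TH_le {s M L P W D k c b : ℝ} {h g h1 c0 c1 q R : ℂ} (hs : 0 ≤ s)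
    (hk : 0 ≤ k) (hM : 0 ≤ M) (hL : 0 ≤ L) (hc : 0 ≤ c) (hb : |b| ≤ M * c)
    (hc0 : ‖c0‖ ≤ L) (hc1 : ‖c1‖ ≤ L) (hq : ‖q‖ ≤ L * P)
    (hW : ‖h‖ + ‖g‖ ≤ W) (hD : ‖h1‖ ≤ D) :
    ‖-((2 * k * s * b : ℝ) : ℂ) * h1
      + (c0 * h + c1 * g) + q - R‖ ≤ 2 * k * c * (M * s * D) + L * (W + P) + ‖R‖ := by
  refine (norm_sub_le _ _).trans ?_
  have n1 := norm_add₃_le (a := -((2 * k * s * b : ℝ) : ℂ) * h1) (b := (c0 * h + c1 * g)) (c := q)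
  have t3 : ‖c0 * h + c1 * g‖ ≤ L * W := by
    refine (norm_add_le _ _).trans ?_
    rw [norm_mul, norm_mul]
    have := mul_le_mul_of_nonneg_right hc0 (norm_nonneg h)
    have := mul_le_mul_of_nonneg_right hc1 (norm_nonneg g)
    have := mul_le_mul_of_nonneg_left hW hL
    linarith
  have e2 : ‖-((2 * k * s * b : ℝ) : ℂ) * h1‖ ≤ 2 * k * s * (M * c) * D := by
    rw [norm_mul, norm_neg, Complex.norm_real, Real.norm_eq_abs, abs_mul, abs_of_nonneg (by positivity : 0 ≤ 2 * k * s)]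
    gcongr
  linarith

/-- energy inequality (I1) -/
lemma energy_le {m k s G G1 N γb γ₀ M J K0 W D c : ℝ}
    {u v h g u1 v1 h1 g1 T1 T2 T3 T4 : ℂ}
    (hk : 0 < k) (hs : 0 < s) (hγb : 0 < γb) (hc : c = min m (k * γ₀)) (hc0 : 0 < c)
    (hG0 : γ₀ ≤ G) (hG : G ≤ γb^2) (hG00 : 0 ≤ G) (hM : 0 ≤ M) (hJ : 0 ≤ J) (hK0 : 0 ≤ K0)
    (hMJ : M * s * D ≤ J)
    (hG1 : s * |G1| ≤ 4 * γb * M)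
    (hT1 : ‖T1‖ ≤ K0 * J) (hT2 : ‖T2‖ ≤ K0 * J) (hT3 : ‖T3‖ ≤ K0 * J) (hT4 : ‖T4‖ ≤ K0 * J)
    (hW : W = ‖u‖ + ‖v‖ + ‖h‖ + ‖g‖) (hD : D = ‖u1‖ + ‖v1‖ + ‖h1‖ + ‖g1‖) :
    c / 4 * (s^2 * (D^2 + N^2 * W^2)) - (K0 * (1 + γb^2) + 4 * k * γb) * (J * W) ≤
     m * s^2 * ((u1.re^2 + u1.im^2) + (v1.re^2 + v1.im^2)
        + N^2 * ((u.re^2 + u.im^2) + (v.re^2 + v.im^2)))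
      + k * s^2 * G * ((h1.re^2 + h1.im^2) + (g1.re^2 + g1.im^2)
        + N^2 * ((h.re^2 + h.im^2) + (g.re^2 + g.im^2)))
      + (T1.re * u.re + T1.im * u.im) + (T2.re * v.re + T2.im * v.im)
      + G * ((T3.re * h.re + T3.im * h.im) + (T4.re * g.re + T4.im * g.im))
      + k * s^2 * G1 * ((h1.re * h.re + h1.im * h.im) + (g1.re * g.re + g1.im * g.im)) := by
  simp only [nsq_eq]
  have four : ∀ a b c d : ℝ, (a+b+c+d)^2 ≤ 4 * (a^2+b^2+c^2+d^2) := by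
    intro a b c d
    nlinarith [sq_nonneg (a-b), sq_nonneg (a-c), sq_nonneg (a-d), sq_nonneg (b-c), sq_nonneg (b-d), sq_nonneg (c-d)]
  have fW := four ‖u‖ ‖v‖ ‖h‖ ‖g‖
  have fD := four ‖u1‖ ‖v1‖ ‖h1‖ ‖g1‖
  rw [← hW] at fW
  rw [← hD] at fD
  have hu := norm_nonneg u
  have hv := norm_nonneg v
  have hh := norm_nonneg h
  have hg := norm_nonneg g
  have hu1 := norm_nonneg u1
  have hv1 := norm_nonneg v1
  have hh1 := norm_nonneg h1
  have hg1 := norm_nonneg g1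
  have hW0 : 0 ≤ W := by rw [hW]; positivity
  have hD0 : 0 ≤ D := by rw [hD]; positivity
  have cm : c ≤ m := by rw [hc]; exact min_le_left _ _
  have cg : c ≤ k * G := by
    rw [hc]; exact (min_le_right _ _).trans (by gcongr)
  -- main part
  have main1 : c / 4 * (s^2 * (D^2 + N^2 * W^2)) ≤
      m * s^2 * (‖u1‖^2 + ‖v1‖^2 + N^2 * (‖u‖^2 + ‖v‖^2))
      + k * s^2 * G * (‖h1‖^2 + ‖g1‖^2 + N^2 * (‖h‖^2 + ‖g‖^2)) := by
    have q1 : D^2 + N^2 * W^2 ≤ 4 * ((‖u1‖^2 + ‖v1‖^2 + N^2 * (‖u‖^2 + ‖v‖^2)) +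
        (‖h1‖^2 + ‖g1‖^2 + N^2 * (‖h‖^2 + ‖g‖^2))) := by
      have := mul_le_mul_of_nonneg_left fW (sq_nonneg N)
      linarith
    calc c / 4 * (s^2 * (D^2 + N^2 * W^2)) ≤ c / 4 * (s^2 * (4 * ((‖u1‖^2 + ‖v1‖^2 + N^2 * (‖u‖^2 + ‖v‖^2)) +
        (‖h1‖^2 + ‖g1‖^2 + N^2 * (‖h‖^2 + ‖g‖^2))))) := by gcongr
      _ = c * (s^2 * (‖u1‖^2 + ‖v1‖^2 + N^2 * (‖u‖^2 + ‖v‖^2))) +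
        c * (s^2 * (‖h1‖^2 + ‖g1‖^2 + N^2 * (‖h‖^2 + ‖g‖^2))) := by ring
      _ ≤ m * (s^2 * (‖u1‖^2 + ‖v1‖^2 + N^2 * (‖u‖^2 + ‖v‖^2))) +
        (k * G) * (s^2 * (‖h1‖^2 + ‖g1‖^2 + N^2 * (‖h‖^2 + ‖g‖^2))) := by gcongr
      _ = _ := by ring
  have K : ∀ {T x : ℂ}, ‖T‖ ≤ K0 * J → |T.re * x.re + T.im * x.im| ≤ K0 * J * ‖x‖ := by
    intro T x hT
    exact (dot_le T x).trans (by gcongr)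
  have k1 := (abs_le.1 (K (x := u) hT1)).1
  have k2 := (abs_le.1 (K (x := v) hT2)).1
  have k3 := (abs_le.1 (K (x := h) hT3)).1
  have k4 := (abs_le.1 (K (x := g) hT4)).1
  have k34 : -(γb^2 * (K0 * J * (‖h‖ + ‖g‖))) ≤ G * ((T3.re * h.re + T3.im * h.im) + (T4.re * g.re + T4.im * g.im)) := by
    have a1 : -(G * (K0 * J * (‖h‖ + ‖g‖))) ≤ G * ((T3.re * h.re + T3.im * h.im) + (T4.re * g.re + T4.im * g.im)) := by
      rw [← mul_neg]
      exact mul_le_mul_of_nonneg_left (by linarith) hG00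
    have a2 : G * (K0 * J * (‖h‖ + ‖g‖)) ≤ γb^2 * (K0 * J * (‖h‖ + ‖g‖)) := by gcongr
    linarith
  have k5 : -(4 * k * γb * (J * W)) ≤ k * s^2 * G1 * ((h1.re * h.re + h1.im * h.im) + (g1.re * g.re + g1.im * g.im)) := by
    apply (abs_le.1 _).1
    have a1 : |(h1.re * h.re + h1.im * h.im) + (g1.re * g.re + g1.im * g.im)| ≤ D * W := by
      refine (abs_add_le _ _).trans ?_
      have := dot_le h1 h
      have := dot_le g1 g
      have b1 : ‖h1‖ * ‖h‖ ≤ D * ‖h‖ := by gcongr; linarith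
      have b2 : ‖g1‖ * ‖g‖ ≤ D * ‖g‖ := by gcongr; linarith
      have b3 : D * (‖h‖ + ‖g‖) ≤ D * W := by gcongr; linarith
      linarith
    calc |k * s^2 * G1 * ((h1.re * h.re + h1.im * h.im) + (g1.re * g.re + g1.im * g.im))|
        = k * s * (s * |G1|) * |(h1.re * h.re + h1.im * h.im) + (g1.re * g.re + g1.im * g.im)| := by
          rw [abs_mul, abs_mul, abs_of_nonneg (by positivity : 0 ≤ k * s^2)]; ring
      _ ≤ k * s * (4 * γb * M) * (D * W) := by gcongr
      _ = 4 * k * γb * ((M * s * D) * W) := by ring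
      _ ≤ _ := by gcongr
  have k6 : K0 * J * (‖u‖ + ‖v‖) + γb^2 * (K0 * J * (‖h‖ + ‖g‖)) ≤ K0 * (1 + γb^2) * (J * W) := by
    have b1 : K0 * J * (‖u‖ + ‖v‖) ≤ K0 * J * W := by
      gcongr; linarith
    have b2 : γb^2 * (K0 * J * (‖h‖ + ‖g‖)) ≤ γb^2 * (K0 * J * W) := by
      gcongr; linarith
    linarith
  linarith

/-- cross inequality (I2) -/
lemma cross_le {k s N σ J K0 W D : ℝ} {u v h g u1 v1 h1 g1 T3 T4 : ℂ}
    (hk : 0 < k) (hσ : |σ| ≤ 1) (hJ : 0 ≤ J) (hK0 : 0 ≤ K0)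
    (hT3 : ‖T3‖ ≤ K0 * J) (hT4 : ‖T4‖ ≤ K0 * J)
    (hW : W = ‖u‖ + ‖v‖ + ‖h‖ + ‖g‖) (hD : D = ‖u1‖ + ‖v1‖ + ‖h1‖ + ‖g1‖) :
    - σ * k * s^2 * ((h1.re * u1.im - h1.im * u1.re) + (g1.re * v1.im - g1.im * v1.re)
       + N^2 * ((h.re * u.im - h.im * u.re) + (g.re * v.im - g.im * v.re)))
     - σ * ((T3.re * u.im - T3.im * u.re) + (T4.re * v.im - T4.im * v.re))
     ≤ k * (s^2 * (D^2 + N^2 * W^2)) + K0 * (J * W) := by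
  have hu := norm_nonneg u
  have hv := norm_nonneg v
  have hh := norm_nonneg h
  have hg := norm_nonneg g
  have hu1 := norm_nonneg u1
  have hv1 := norm_nonneg v1
  have hh1 := norm_nonneg h1
  have hg1 := norm_nonneg g1
  have sg : ∀ {x B : ℝ}, |x| ≤ B → -σ * x ≤ B := by
    intro x B hx
    refine (le_abs_self _).trans ?_
    rw [abs_mul, abs_neg]
    have := mul_le_mul_of_nonneg_right hσ (abs_nonneg x)
    linarith
  have q : ∀ {a b c d V : ℝ}, 0 ≤ a → 0 ≤ b → 0 ≤ c → 0 ≤ d → V = a + b + c + d → c * a + d * b ≤ V^2 := by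
    intro a b c d V ha hb hc hd hV
    subst hV
    nlinarith [mul_nonneg ha hb, mul_nonneg ha hc, mul_nonneg ha hd, mul_nonneg hb hc, mul_nonneg hb hd, mul_nonneg hc hd,
      sq_nonneg a, sq_nonneg b, sq_nonneg c, sq_nonneg d]
  have a1 : |(h1.re * u1.im - h1.im * u1.re) + (g1.re * v1.im - g1.im * v1.re)| ≤ D^2 := by
    refine (abs_add_le _ _).trans ?_
    linarith [crs_le h1 u1, crs_le g1 v1, q hu1 hv1 hh1 hg1 hD]
  have a2 : |(h.re * u.im - h.im * u.re) + (g.re * v.im - g.im * v.re)| ≤ W^2 := by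
    refine (abs_add_le _ _).trans ?_
    linarith [crs_le h u, crs_le g v, q hu hv hh hg hW]
  have a3 : |(T3.re * u.im - T3.im * u.re) + (T4.re * v.im - T4.im * v.re)| ≤ K0 * (J * W) := by
    refine (abs_add_le _ _).trans ?_
    have b1 : ‖T3‖ * ‖u‖ ≤ K0 * J * ‖u‖ := by gcongr
    have b2 : ‖T4‖ * ‖v‖ ≤ K0 * J * ‖v‖ := by gcongr
    have b3 : K0 * J * (‖u‖ + ‖v‖) ≤ K0 * J * W := by gcongr; linarith
    linarith [crs_le T3 u, crs_le T4 v]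
  have a4 : |(h1.re * u1.im - h1.im * u1.re) + (g1.re * v1.im - g1.im * v1.re)
       + N^2 * ((h.re * u.im - h.im * u.re) + (g.re * v.im - g.im * v.re))| ≤ D^2 + N^2 * W^2 := by
    refine (abs_add_le _ _).trans ?_
    rw [abs_mul, abs_of_nonneg (sq_nonneg N)]
    have := mul_le_mul_of_nonneg_left a2 (sq_nonneg N)
    linarith
  have c1 := sg a3
  have c2 := mul_le_mul_of_nonneg_left (sg a4) (by positivity : 0 ≤ k * s^2)
  linarith

/-- combination of the pointwise inequalities -/
lemma combine {k c K0 K1 lam K3 s N J X W P M L Rr t LHS q1 q2 q3 : ℝ}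
    (hk : 0 < k) (hc : 0 < c) (hK0 : 0 < K0) (hK1 : 0 ≤ K1) (hM : 0 ≤ M)
    (hL : L = M * (1 + M)) (ht : 0 < t) {D : ℝ} 
    (hX : X = s^2 * (D^2 + N^2 * W^2)) (hJ : J = M * s * (|N| * W + D) + L * (W + P) + Rr)
    (hlam : lam = 4 * (k + 1) / c) (hK3 : K3 = K0 + lam * K1)
    (I1 : c / 4 * X - K1 * (J * W) ≤ q1)
    (I2 : LHS ≤ q2 + k * X + K0 * (J * W))
    (I3 : P^2 / 2 - 2 * W^2 ≤ q3) :
    LHS ≤ q2 + lam * q1 + 2 * K3 * L * q3 + K3 * (K3 / 2 + 6) * (L * W^2) + K3 * (t * Rr^2 + W^2 / t) := by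
  have hlam0 : 0 < lam := by rw [hlam]; positivity
  have hK30 : 0 < K3 := by rw [hK3]; positivity
  have hL0 : 0 ≤ L := by rw [hL]; positivity
  have hlc : lam * (c / 4) = k + 1 := by rw [hlam]; field_simp
  have y1 : K3 * (M * s * (|N| * W + D) * W) ≤ X + K3 * (K3 / 2) * (M^2 * W^2) := by
    rw [hX, ← sq_abs N]
    nlinarith [sq_nonneg (s * (|N| * W) - K3 / 2 * (M * W)), sq_nonneg (s * D - K3 / 2 * (M * W))]
  have y2 : M^2 * W^2 ≤ L * W^2 := by
    rw [hL]; nlinarith [mul_nonneg hM (sq_nonneg W)]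
  have y3 : L * (W + P) * W ≤ L * (6 * W^2) + 2 * L * q3 := by
    have : (W + P) * W ≤ 6 * W^2 + 2 * q3 := by
      nlinarith [sq_nonneg (W - P), sq_nonneg W]
    have := mul_le_mul_of_nonneg_left this hL0
    linarith
  have y4 : Rr * W ≤ t * Rr^2 + W^2 / t := by
    have : t * (Rr * W) ≤ t * (t * Rr^2 + W^2 / t) := by
      have : t * (t * Rr^2 + W^2 / t) = (t * Rr)^2 + W^2 := by field_simp
      rw [this]
      nlinarith [sq_nonneg (t * Rr - W), sq_nonneg (t * Rr + W)]
    exact le_of_mul_le_mul_left this ht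
  have z1 := mul_le_mul_of_nonneg_left I1 hlam0.le
  have z2 : LHS ≤ q2 + lam * q1 - X + K3 * (J * W) := by
    rw [hK3]
    have : lam * (c / 4 * X - K1 * (J * W)) = (k + 1) * X - lam * K1 * (J * W) := by rw [← hlc]; ring
    linarith
  have z3 := mul_le_mul_of_nonneg_left y3 hK30.le
  have z4 := mul_le_mul_of_nonneg_left y4 hK30.le
  have z5 := mul_le_mul_of_nonneg_left y2 (by positivity : 0 ≤ K3 * (K3 / 2))
  have z6 : K3 * (J * W) = K3 * (M * s * (|N| * W + D) * W) + K3 * (L * (W + P) * W) + K3 * (Rr * W) := by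
    rw [hJ]; ring
  linarith

lemma dot_deriv {a b : ℝ → ℂ} {a' b' : ℂ} {y : ℝ} (ha : HasDerivAt a a' y) (hb : HasDerivAt b b' y) :
    HasDerivAt (fun y => (a y).re * (b y).re + (a y).im * (b y).im)
      ((a'.re * (b y).re + a'.im * (b y).im) + ((a y).re * b'.re + (a y).im * b'.im)) y := by
  have e1 : HasDerivAt (fun y => (a y).re) a'.re y := Complex.reCLM.hasFDerivAt.comp_hasDerivAt y ha
  have e2 : HasDerivAt (fun y => (a y).im) a'.im y := Complex.imCLM.hasFDerivAt.comp_hasDerivAt y ha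
  have e3 : HasDerivAt (fun y => (b y).re) b'.re y := Complex.reCLM.hasFDerivAt.comp_hasDerivAt y hb
  have e4 : HasDerivAt (fun y => (b y).im) b'.im y := Complex.imCLM.hasFDerivAt.comp_hasDerivAt y hb
  refine ((e1.mul e3).add (e2.mul e4)).congr_deriv ?_
  ring

lemma crs_deriv {a b : ℝ → ℂ} {a' b' : ℂ} {y : ℝ} (ha : HasDerivAt a a' y) (hb : HasDerivAt b b' y) :
    HasDerivAt (fun y => (a y).re * (b y).im - (a y).im * (b y).re)
      ((a'.re * (b y).im - a'.im * (b y).re) + ((a y).re * b'.im - (a y).im * b'.re)) y := by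
  have e1 : HasDerivAt (fun y => (a y).re) a'.re y := Complex.reCLM.hasFDerivAt.comp_hasDerivAt y ha
  have e2 : HasDerivAt (fun y => (a y).im) a'.im y := Complex.imCLM.hasFDerivAt.comp_hasDerivAt y ha
  have e3 : HasDerivAt (fun y => (b y).re) b'.re y := Complex.reCLM.hasFDerivAt.comp_hasDerivAt y hb
  have e4 : HasDerivAt (fun y => (b y).im) b'.im y := Complex.imCLM.hasFDerivAt.comp_hasDerivAt y hb
  refine ((e1.mul e4).sub (e2.mul e3)).congr_deriv ?_
  ring

lemma hardy_pt {h : ℝ → ℂ} (hh : Continuous h) {s y : ℝ} (hs : 0 < s) (hy : 0 < y) :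
    ∃ q, HasDerivAt (fun y => - (‖∫ t in (0:ℝ)..y, h t‖^2 / (s + y))) q y ∧
      (‖∫ t in (0:ℝ)..y, h t‖ / (s + y))^2 / 2 - 2 * ‖h y‖^2 ≤ q := by
  have hd : HasDerivAt (fun y => ∫ t in (0:ℝ)..y, h t) (h y) y :=
    intervalIntegral.integral_hasDerivAt_right (hh.intervalIntegrable _ _)
      (hh.stronglyMeasurableAtFilter _ _) hh.continuousAt
  have d1 := dot_deriv hd hd
  have d2 : HasDerivAt (fun y : ℝ => s + y) 1 y := (hasDerivAt_id y).const_add s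
  have hsy : 0 < s + y := by linarith
  have d3 := (d1.div d2 hsy.ne').neg
  have e : (fun y => - (‖∫ t in (0:ℝ)..y, h t‖^2 / (s + y))) =
     -((fun y => ((∫ t in (0:ℝ)..y, h t).re * (∫ t in (0:ℝ)..y, h t).re + (∫ t in (0:ℝ)..y, h t).im * (∫ t in (0:ℝ)..y, h t).im)) / (fun y : ℝ => s + y)) := by
    funext z
    simp only [Pi.neg_apply, Pi.div_apply]
    rw [← nsq_eq]; ring
  rw [e]
  refine ⟨_, d3, ?_⟩
  set ψ := ∫ t in (0:ℝ)..y, h t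
  have b := (abs_le.1 (dot_le ψ (h y))).2
  have n := nsq_eq ψ
  have e2 : (ψ.re * ψ.re + ψ.im * ψ.im) = ‖ψ‖^2 := by rw [← n]; ring
  rw [e2]
  have e3 : -((((h y).re * ψ.re + (h y).im * ψ.im + (ψ.re * (h y).re + ψ.im * (h y).im)) * (s + y) - ‖ψ‖ ^ 2 * 1) / (s + y) ^ 2)
     = (‖ψ‖ / (s+y))^2 - 2 * ((ψ.re * (h y).re + ψ.im * (h y).im) / (s + y)) := by
    field_simp; ring
  rw [e3]
  have e4 : (ψ.re * (h y).re + ψ.im * (h y).im) / (s + y) ≤ ‖ψ‖ / (s + y) * ‖h y‖ := by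
    rw [div_mul_eq_mul_div]; gcongr
  nlinarith [sq_nonneg (‖ψ‖ / (s+y) - 2 * ‖h y‖)]

lemma coef_le {Y x z M : ℝ} (hY : 0 ≤ Y) (hx : 0 ≤ x) (hz : 0 ≤ z) (h : (1 + Y) * (x + z) ≤ M) :
    x ≤ M ∧ z ≤ M := by
  constructor <;> nlinarith [mul_nonneg hY hx, mul_nonneg hY hz]

lemma coef3_le {Y x z M : ℝ} (hY : 0 ≤ Y) (hx : 0 ≤ x) (hz : 0 ≤ z) (h : (1 + Y)^3 * (x + z) ≤ M) :
    x ≤ M ∧ z ≤ M := by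
  have h1 : (1:ℝ) ≤ (1 + Y)^3 := one_le_pow₀ (by linarith)
  have := mul_le_mul_of_nonneg_right h1 (add_nonneg hx hz)
  constructor <;> linarith

lemma D_le {s y L : ℝ} {ψ d : ℂ} {z : ℝ} (hs : 0 < s) (hy : 0 < y) (hz : 0 ≤ z)
    (h : (1 + y / s)^2 * (‖d‖ + z) ≤ L) :
    ‖((s⁻¹ : ℝ) : ℂ) * ψ * d‖ ≤ L * (‖ψ‖ / (s + y)) := by
  have h1 : (1 + y/s)^2 * ‖d‖ ≤ L := by
    refine le_trans ?_ h
    gcongr; linarith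
  have h2 : (1 + y / s) * ‖d‖ ≤ L := by
    refine le_trans ?_ h1
    gcongr
    have : 0 ≤ y / s := by positivity
    nlinarith
  rw [norm_mul, norm_mul, Complex.norm_real, Real.norm_eq_abs, abs_of_pos (by positivity)]
  have : s⁻¹ * ‖ψ‖ * ‖d‖ = ((1 + y / s) * ‖d‖) * (‖ψ‖ / (s + y)) := by
    have : s + y ≠ 0 := by positivity
    field_simp
  rw [this]
  gcongr

lemma pair_le {a b c d : ℂ} {D W : ℝ} (h1 : ‖a‖ + ‖c‖ ≤ D) (h2 : ‖b‖ ≤ W) (h3 : ‖d‖ ≤ W) :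
    ‖a‖ * ‖b‖ + ‖c‖ * ‖d‖ ≤ D * W := by
  have hW := (norm_nonneg b).trans h2
  have b1 : ‖a‖ * ‖b‖ ≤ ‖a‖ * W := by gcongr
  have b2 : ‖c‖ * ‖d‖ ≤ ‖c‖ * W := by gcongr
  have b3 := mul_le_mul_of_nonneg_right h1 hW
  linarith

lemma G_deriv {Us Hs : ℝ → ℝ} (hU : Differentiable ℝ Us) (hH : Differentiable ℝ Hs) {s y γb M : ℝ}
    (hs : 0 < s) (hH1 : |Hs (y/s)| ≤ γb) (hU1 : |Us (y/s)| ≤ γb)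
    (hU2 : |deriv Us (y/s)| ≤ M) (hH2 : |deriv Hs (y/s)| ≤ M) :
    ∃ G1, HasDerivAt (fun y => Hs (y/s)^2 - Us (y/s)^2) G1 y ∧ s * |G1| ≤ 4 * γb * M := by
  have d0 : HasDerivAt (fun y : ℝ => y / s) (1 / s) y := (hasDerivAt_id y).div_const s
  have d1 : HasDerivAt (fun y => Hs (y/s)) (deriv Hs (y/s) * (1/s)) y := (hH (y/s)).hasDerivAt.comp y d0
  have d2 : HasDerivAt (fun y => Us (y/s)) (deriv Us (y/s) * (1/s)) y := (hU (y/s)).hasDerivAt.comp y d0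
  refine ⟨_, (d1.pow 2).sub (d2.pow 2), ?_⟩
  rw [← abs_of_pos hs, ← abs_mul, abs_of_pos hs]
  have : s * (((2:ℕ):ℝ) * Hs (y/s)^(2-1) * (deriv Hs (y/s) * (1/s)) - ((2:ℕ):ℝ) * Us (y/s)^(2-1) * (deriv Us (y/s) * (1/s)))
    = 2 * (Hs (y/s) * deriv Hs (y/s)) - 2 * (Us (y/s) * deriv Us (y/s)) := by
    field_simp; norm_num; ring
  rw [this]
  refine (abs_sub _ _).trans ?_
  simp only [abs_mul, abs_two]
  have hb : 0 ≤ γb := (abs_nonneg _).trans hH1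
  have q1 : |Hs (y/s)| * |deriv Hs (y/s)| ≤ γb * M := by gcongr
  have q2 : |Us (y/s)| * |deriv Us (y/s)| ≤ γb * M := by gcongr
  linarith

lemma int4 {a b c d : ℝ → ℂ} (ha : IntegrableOn (fun y => ‖a y‖ ^ 2) (Ioi 0))
    (hb : IntegrableOn (fun y => ‖b y‖ ^ 2) (Ioi 0)) (hc : IntegrableOn (fun y => ‖c y‖ ^ 2) (Ioi 0))
    (hd : IntegrableOn (fun y => ‖d y‖ ^ 2) (Ioi 0)) :
    ∫ y in Ioi (0:ℝ), (‖a y‖^2 + ‖b y‖^2 + ‖c y‖^2 + ‖d y‖^2) = nsq a + nsq b + nsq c + nsq d := by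
  have hab : IntegrableOn (fun y => ‖a y‖ ^ 2 + ‖b y‖^2) (Ioi 0) := ha.add hb
  have habc : IntegrableOn (fun y => ‖a y‖ ^ 2 + ‖b y‖^2 + ‖c y‖^2) (Ioi 0) := hab.add hc
  rw [integral_add habc hd, integral_add hab hc, integral_add ha hb]
  rfl


set_option maxHeartbeats 4000000
/-- the estimate
`|ñ|^{1/2}‖Û‖_{L²} ≤ C₄ M̄^{1/2}(1+M̄^{1/2})‖Ŵ‖ + C₄‖R‖^{1/2}‖Ŵ‖^{1/2}`
for solutions of the transformed linearized MHD system on one Fourier mode. -/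
theorem stmt15
    (μ κ γ γbar γ₀ : ℝ) (hμ : 0 < μ) (hκ : 0 < κ)
    (hγ : 0 < γ) (hγγ : γ ≤ γbar) (hγ₀ : 0 < γ₀) :
    ∃ C₄ : ℝ, 0 < C₄ ∧
    ∀ (ε ϱ : ℝ) (n : ℤ), ε ∈ Set.Ioc (0:ℝ) 1 → 0 < ϱ → n ≠ 0 →
    ∀ Us Hs : ℝ → ℝ, ContDiff ℝ 3 Us → ContDiff ℝ 3 Hs → Us 0 = 0 →
      (∀ Y, 0 ≤ Y → γ ≤ |Hs Y| ∧ |Hs Y| ≤ γbar) →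
      (∀ Y, 0 ≤ Y → γ₀ ≤ Hs Y ^ 2 - Us Y ^ 2) →
    ∀ Mbar : ℝ,
      (∀ Y, 0 ≤ Y → ∀ k : ℕ, 1 ≤ k → k ≤ 3 →
        (1 + Y)^3 * (|iteratedDeriv k Us Y| + |iteratedDeriv k Hs Y|) ≤ Mbar) →
    ∀ (AU BU CU CH : ℝ → Matrix (Fin 2) (Fin 2) ℂ) (DU DH : ℝ → Fin 2 → ℂ),
      Continuous AU → Continuous BU → Continuous CU → Continuous CH →
      Continuous DU → Continuous DH →
      (∀ Y, 0 ≤ Y → ∀ i j, (1 + Y) * (‖AU Y i j‖ + ‖BU Y i j‖) ≤ Mbar) →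
      (∀ Y, 0 ≤ Y → ∀ i j, (1 + Y) * (‖CU Y i j‖ + ‖CH Y i j‖) ≤ Mbar * (1 + Mbar)) →
      (∀ Y, 0 ≤ Y → ∀ i, (1 + Y)^2 * (‖DU Y i‖ + ‖DH Y i‖) ≤ Mbar * (1 + Mbar)) →
    ∀ u v h g p R1 R2 R3 R4 : ℝ → ℂ,
      ContDiff ℝ 3 u → ContDiff ℝ 3 v → ContDiff ℝ 3 h → ContDiff ℝ 3 g →
      ContDiff ℝ 2 p →
      (ML2 u ∧ ML2 v ∧ ML2 h ∧ ML2 g) →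
      (ML2 (deriv u) ∧ ML2 (deriv v) ∧ ML2 (deriv h) ∧ ML2 (deriv g)) →
      (ML2 (deriv (deriv u)) ∧ ML2 (deriv (deriv v)) ∧
        ML2 (deriv (deriv h)) ∧ ML2 (deriv (deriv g))) →
      Tendsto (fun y => ‖u y‖ + ‖v y‖ + ‖h y‖ + ‖g y‖) atTop (nhds 0) →
      Tendsto (fun y => ‖deriv u y‖ + ‖deriv v y‖ + ‖deriv h y‖ + ‖deriv g y‖)
        atTop (nhds 0) →
      Tendsto (fun y => ‖deriv (deriv u) y‖ + ‖deriv (deriv v) y‖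
        + ‖deriv (deriv h) y‖ + ‖deriv (deriv g) y‖) atTop (nhds 0) →
      Tendsto (fun y => ‖p y‖ * (‖u y‖ + ‖v y‖ + ‖h y‖ + ‖g y‖)) atTop (nhds 0) →
      (ML2 R1 ∧ ML2 R2 ∧ ML2 R3 ∧ ML2 R4) →
      -- equation (E1), first and second components
      (∀ y, 0 < y →
        Complex.I * (((n:ℝ)/ϱ : ℝ) : ℂ) *
            ((((1 + μ/κ) * Us (y / Real.sqrt ε) : ℝ) : ℂ) * u y
              - ((Hs (y / Real.sqrt ε) ^ 2 - Us (y / Real.sqrt ε) ^ 2 : ℝ) : ℂ) * h y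
              + ((Real.sqrt ε : ℝ) : ℂ) *
                  (AU (y / Real.sqrt ε) 0 0 * h y + AU (y / Real.sqrt ε) 0 1 * g y))
          + ((Real.sqrt ε : ℝ) : ℂ) *
              (BU (y / Real.sqrt ε) 0 0 * deriv h y + BU (y / Real.sqrt ε) 0 1 * deriv g y)
          + (CU (y / Real.sqrt ε) 0 0 * h y + CU (y / Real.sqrt ε) 0 1 * g y)
          + (((Real.sqrt ε)⁻¹ : ℝ) : ℂ) * (∫ s in (0:ℝ)..y, h s) * DU (y / Real.sqrt ε) 0
          + Complex.I * (((n:ℝ)/ϱ : ℝ) : ℂ) * p y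
          - ((μ * ε : ℝ) : ℂ) *
              (deriv (deriv u) y - (((n:ℝ)/ϱ : ℝ) : ℂ)^2 * u y)
          = R1 y) →
      (∀ y, 0 < y →
        Complex.I * (((n:ℝ)/ϱ : ℝ) : ℂ) *
            ((((1 + μ/κ) * Us (y / Real.sqrt ε) : ℝ) : ℂ) * v y
              - ((Hs (y / Real.sqrt ε) ^ 2 - Us (y / Real.sqrt ε) ^ 2 : ℝ) : ℂ) * g y
              + ((Real.sqrt ε : ℝ) : ℂ) *
                  (AU (y / Real.sqrt ε) 1 0 * h y + AU (y / Real.sqrt ε) 1 1 * g y))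
          + ((Real.sqrt ε : ℝ) : ℂ) *
              (BU (y / Real.sqrt ε) 1 0 * deriv h y + BU (y / Real.sqrt ε) 1 1 * deriv g y)
          + (CU (y / Real.sqrt ε) 1 0 * h y + CU (y / Real.sqrt ε) 1 1 * g y)
          + (((Real.sqrt ε)⁻¹ : ℝ) : ℂ) * (∫ s in (0:ℝ)..y, h s) * DU (y / Real.sqrt ε) 1
          + deriv p y
          - ((μ * ε : ℝ) : ℂ) *
              (deriv (deriv v) y - (((n:ℝ)/ϱ : ℝ) : ℂ)^2 * v y)
          = R2 y) →
      -- equation (E2), first and second components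
      (∀ y, 0 < y →
        -(Complex.I * (((n:ℝ)/ϱ : ℝ) : ℂ)) * u y
          - ((2 * κ * Real.sqrt ε *
              (deriv Hs (y / Real.sqrt ε) / Hs (y / Real.sqrt ε)) : ℝ) : ℂ) * deriv h y
          + (CH (y / Real.sqrt ε) 0 0 * h y + CH (y / Real.sqrt ε) 0 1 * g y)
          + (((Real.sqrt ε)⁻¹ : ℝ) : ℂ) * (∫ s in (0:ℝ)..y, h s) * DH (y / Real.sqrt ε) 0
          - ((κ * ε : ℝ) : ℂ) *
              (deriv (deriv h) y - (((n:ℝ)/ϱ : ℝ) : ℂ)^2 * h y)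
          = R3 y) →
      (∀ y, 0 < y →
        -(Complex.I * (((n:ℝ)/ϱ : ℝ) : ℂ)) * v y
          - ((2 * κ * Real.sqrt ε *
              (deriv Hs (y / Real.sqrt ε) / Hs (y / Real.sqrt ε)) : ℝ) : ℂ) * deriv g y
          + (CH (y / Real.sqrt ε) 1 0 * h y + CH (y / Real.sqrt ε) 1 1 * g y)
          + (((Real.sqrt ε)⁻¹ : ℝ) : ℂ) * (∫ s in (0:ℝ)..y, h s) * DH (y / Real.sqrt ε) 1
          - ((κ * ε : ℝ) : ℂ) *
              (deriv (deriv g) y - (((n:ℝ)/ϱ : ℝ) : ℂ)^2 * g y)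
          = R4 y) →
      -- equation (E3): divergence-free conditions
      (∀ y, 0 < y →
        Complex.I * (((n:ℝ)/ϱ : ℝ) : ℂ) * u y + deriv v y = 0 ∧
        Complex.I * (((n:ℝ)/ϱ : ℝ) : ℂ) * h y + deriv g y = 0) →
      -- equation (E4): boundary conditions
      u 0 = 0 → v 0 = 0 → deriv h 0 = 0 → g 0 = 0 →
      Real.sqrt |(n:ℝ)/ϱ| * nrm2 u v
        ≤ C₄ * (Real.sqrt Mbar * (1 + Real.sqrt Mbar)) * nrm4 u v h g
          + C₄ * Real.sqrt (nrm4 R1 R2 R3 R4) * Real.sqrt (nrm4 u v h g) := by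
  have hγb : 0 < γbar := hγ.trans_le hγγ
  obtain ⟨c, hc⟩ : ∃ c, c = min μ (κ * γ₀) := ⟨_, rfl⟩
  have hc0 : 0 < c := by rw [hc]; exact lt_min hμ (by positivity)
  obtain ⟨K0, hK0⟩ : ∃ K0, K0 = 1 + 2 * κ * (1 / γ) := ⟨_, rfl⟩
  have hK00 : 0 < K0 := by rw [hK0]; positivity
  obtain ⟨K1, hK1⟩ : ∃ K1, K1 = K0 * (1 + γbar^2) + 4 * κ * γbar := ⟨_, rfl⟩
  have hK10 : 0 ≤ K1 := by rw [hK1]; positivity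
  obtain ⟨lam, hlam⟩ : ∃ lam, lam = 4 * (κ + 1) / c := ⟨_, rfl⟩
  have hlam0 : 0 < lam := by rw [hlam]; positivity
  obtain ⟨K3, hK3⟩ : ∃ K3, K3 = K0 + lam * K1 := ⟨_, rfl⟩
  have hK30 : 0 < K3 := by rw [hK3]; positivity
  obtain ⟨K, hK⟩ : ∃ K, K = 4 * (K3 * (K3 / 2 + 6)) + 4 * K3 := ⟨_, rfl⟩
  have hKpos : 0 < K := by rw [hK]; positivity
  refine ⟨Real.sqrt (2 * K), by positivity, ?_⟩
  intro ε ϱ n hε hϱ hn Us Hs hUs hHs hU0 hHb hGb M hder AU BU CU CH DU DH _ _ _ _ _ _ hAB hCC hDD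
    u v h g p R1 R2 R3 R4 hu hv hh hg hp hL0 hL1 hL2 lim0 lim1 lim2 limp hR E1 E2 E3 E4 hdiv u0 v0 h10 g0
  obtain ⟨s, hs, rfl⟩ : ∃ s : ℝ, 0 < s ∧ ε = s^2 :=
    ⟨Real.sqrt ε, Real.sqrt_pos.2 hε.1, (Real.sq_sqrt hε.1.le).symm⟩
  rw [Real.sqrt_sq hs.le] at E1 E2 E3 E4
  generalize hN : (n:ℝ) / ϱ = N at *
  have hM : 0 ≤ M := by
    have := hder 0 le_rfl 1 le_rfl (by norm_num)
    exact le_trans (by positivity) this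
  obtain ⟨L, hL⟩ : ∃ L, L = M * (1 + M) := ⟨_, rfl⟩
  have hLn : 0 ≤ L := by rw [hL]; positivity
  rw [← hL] at hCC hDD
  obtain ⟨σ, hσ, hσN⟩ : ∃ σ : ℝ, |σ| ≤ 1 ∧ σ * N = |N| := by
    rcases le_total 0 N with h | h
    · exact ⟨1, by simp, by rw [abs_of_nonneg h]; ring⟩
    · exact ⟨-1, by simp, by rw [abs_of_nonpos h]; ring⟩
  have hUd : Differentiable ℝ Us := hUs.differentiable (by norm_num)
  have hHd : Differentiable ℝ Hs := hHs.differentiable (by norm_num)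
  have D1 : ∀ {f : ℝ → ℂ}, ContDiff ℝ 3 f → ∀ y, HasDerivAt f (deriv f y) y :=
    fun hf y => ((hf.differentiable (by norm_num)) y).hasDerivAt
  have CD1 : ∀ {f : ℝ → ℂ}, ContDiff ℝ 3 f → ContDiff ℝ 2 (deriv f) :=
    fun hf => ((contDiff_succ_iff_deriv (n := 2)).1 (by
      have : (2:WithTop ℕ∞) + 1 = 3 := by norm_num
      rw [this]; exact hf)).2.2
  have D2 : ∀ {f : ℝ → ℂ}, ContDiff ℝ 3 f → ∀ y, HasDerivAt (deriv f) (deriv (deriv f) y) y :=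
    fun hf y => (((CD1 hf).differentiable (by norm_num)) y).hasDerivAt
  have Dp : ∀ y, HasDerivAt p (deriv p y) y := fun y => ((hp.differentiable (by norm_num)) y).hasDerivAt
  obtain ⟨G, hG⟩ : ∃ G : ℝ → ℝ, G = fun y => Hs (y/s)^2 - Us (y/s)^2 := ⟨_, rfl⟩
  have hGy : ∀ y, Hs (y/s)^2 - Us (y/s)^2 = G y := fun y => by rw [hG]
  have hGlow : ∀ y, 0 ≤ y → γ₀ ≤ G y := fun y hy => by rw [← hGy]; exact hGb _ (by positivity)
  have hHle : ∀ y, 0 ≤ y → |Hs (y/s)| ≤ γbar := fun y hy => (hHb _ (by positivity)).2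
  have hGup : ∀ y, 0 ≤ y → G y ≤ γbar^2 := fun y hy => by
    rw [← hGy, ← sq_abs (Hs _)]
    have := hHle y hy
    have : |Hs (y/s)|^2 ≤ γbar^2 := by gcongr
    linarith [sq_nonneg (Us (y/s))]
  have hUle : ∀ y, 0 ≤ y → |Us (y/s)| ≤ γbar := fun y hy => by
    refine abs_le_of_sq_le_sq ?_ hγb.le
    have := hGlow y hy
    rw [← hGy] at this
    have h2 : |Hs (y/s)|^2 ≤ γbar^2 := by have := hHle y hy; gcongr
    rw [sq_abs] at h2
    linarith
  have hder1 : ∀ y, 0 ≤ y → |deriv Us (y/s)| ≤ M ∧ |deriv Hs (y/s)| ≤ M := fun y hy => by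
    have := hder (y/s) (by positivity) 1 le_rfl (by norm_num)
    simp only [iteratedDeriv_one] at this
    exact coef3_le (by positivity) (abs_nonneg _) (abs_nonneg _) this
  obtain ⟨Q1, hQ1⟩ : ∃ Q1 : ℝ → ℝ, Q1 = fun y =>
      μ * s^2 * (((deriv u y).re * (u y).re + (deriv u y).im * (u y).im)
        + ((deriv v y).re * (v y).re + (deriv v y).im * (v y).im))
      + κ * s^2 * (G y * (((deriv h y).re * (h y).re + (deriv h y).im * (h y).im)
        + ((deriv g y).re * (g y).re + (deriv g y).im * (g y).im)))
      - ((p y).re * (v y).re + (p y).im * (v y).im) := ⟨_, rfl⟩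
  obtain ⟨Q2, hQ2⟩ : ∃ Q2 : ℝ → ℝ, Q2 = fun y =>
      σ * κ * s^2 * (((deriv h y).re * (u y).im - (deriv h y).im * (u y).re)
        + ((deriv g y).re * (v y).im - (deriv g y).im * (v y).re)) := ⟨_, rfl⟩
  obtain ⟨Q3, hQ3⟩ : ∃ Q3 : ℝ → ℝ, Q3 = fun y => -(‖∫ t in (0:ℝ)..y, h t‖^2 / (s + y)) := ⟨_, rfl⟩
  obtain ⟨w, hw⟩ : ∃ w : ℝ → ℝ, w = fun y => ‖u y‖^2 + ‖v y‖^2 + ‖h y‖^2 + ‖g y‖^2 := ⟨_, rfl⟩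
  obtain ⟨r, hr⟩ : ∃ r : ℝ → ℝ, r = fun y => ‖R1 y‖^2 + ‖R2 y‖^2 + ‖R3 y‖^2 + ‖R4 y‖^2 := ⟨_, rfl⟩
  have four : ∀ a b c d : ℝ, (a+b+c+d)^2 ≤ 4 * (a^2+b^2+c^2+d^2) := by
    intro a b c d
    nlinarith [sq_nonneg (a-b), sq_nonneg (a-c), sq_nonneg (a-d), sq_nonneg (b-c), sq_nonneg (b-d), sq_nonneg (c-d)]
  -- pointwise key inequality
  have key : ∀ t, 0 < t → ∀ y, 0 < y → ∃ q, HasDerivAt (fun y => Q2 y + lam * Q1 y + 2 * K3 * L * Q3 y) q y ∧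
      |N| * (‖u y‖^2 + ‖v y‖^2) - K * (L * w y + (t * r y + w y / t)) ≤ q := by
    intro t ht y hy
    obtain ⟨G1, dG, hG1⟩ := G_deriv hUd hHd hs (hHle y hy.le) (hUle y hy.le) (hder1 y hy.le).1 (hder1 y hy.le).2
    rw [← hG] at dG
    obtain ⟨q3, dQ3, I3⟩ := hardy_pt hh.continuous hs hy
    rw [← hQ3] at dQ3
    have hYpos : 0 ≤ y / s := by positivity
    have e1 := E1 y hy
    have e2 := E2 y hy
    have e3 := E3 y hy
    have e4 := E4 y hy
    rw [hGy] at e1 e2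
    obtain ⟨ed, -⟩ := hdiv y hy
    have hAn : ∀ i j, ‖AU (y/s) i j‖ ≤ M ∧ ‖BU (y/s) i j‖ ≤ M := fun i j =>
      coef_le hYpos (norm_nonneg _) (norm_nonneg _) (hAB _ hYpos i j)
    have hCn : ∀ i j, ‖CU (y/s) i j‖ ≤ L ∧ ‖CH (y/s) i j‖ ≤ L := fun i j =>
      coef_le hYpos (norm_nonneg _) (norm_nonneg _) (hCC _ hYpos i j)
    obtain ⟨ψ, hψ⟩ : ∃ ψ, ψ = ∫ t in (0:ℝ)..y, h t := ⟨_, rfl⟩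
    rw [← hψ] at e1 e2 e3 e4 I3
    have hDU : ∀ i, ‖((s⁻¹ : ℝ) : ℂ) * ψ * DU (y/s) i‖ ≤ L * (‖ψ‖ / (s + y)) := fun i =>
      D_le hs hy (norm_nonneg _) (hDD _ hYpos i)
    have hDH : ∀ i, ‖((s⁻¹ : ℝ) : ℂ) * ψ * DH (y/s) i‖ ≤ L * (‖ψ‖ / (s + y)) := fun i =>
      D_le hs hy (norm_nonneg _) (by rw [add_comm ‖DH _ _‖]; exact hDD _ hYpos i)
    have hb : |deriv Hs (y/s) / Hs (y/s)| ≤ M * (1 / γ) := by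
      rw [abs_div, div_eq_mul_one_div]
      have := (hder1 y hy.le).2
      have := (hHb _ hYpos).1
      gcongr
    obtain ⟨W, hW⟩ : ∃ W, W = ‖u y‖ + ‖v y‖ + ‖h y‖ + ‖g y‖ := ⟨_, rfl⟩
    obtain ⟨D, hD⟩ : ∃ D, D = ‖deriv u y‖ + ‖deriv v y‖ + ‖deriv h y‖ + ‖deriv g y‖ := ⟨_, rfl⟩
    obtain ⟨Rr, hRr⟩ : ∃ Rr, Rr = ‖R1 y‖ + ‖R2 y‖ + ‖R3 y‖ + ‖R4 y‖ := ⟨_, rfl⟩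
    obtain ⟨P, hP⟩ : ∃ P, P = ‖ψ‖ / (s + y) := ⟨_, rfl⟩
    rw [← hP] at hDU hDH I3
    have hP0 : 0 ≤ P := by rw [hP]; positivity
    have hW0 : 0 ≤ W := by rw [hW]; positivity
    have hD0 : 0 ≤ D := by rw [hD]; positivity
    have hR0 : 0 ≤ Rr := by rw [hRr]; positivity
    have nu := norm_nonneg (u y)
    have nv := norm_nonneg (v y)
    have nh := norm_nonneg (h y)
    have ng := norm_nonneg (g y)
    have nu1 := norm_nonneg (deriv u y)
    have nv1 := norm_nonneg (deriv v y)
    have nh1 := norm_nonneg (deriv h y)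
    have ng1 := norm_nonneg (deriv g y)
    have nR1 := norm_nonneg (R1 y)
    have nR2 := norm_nonneg (R2 y)
    have nR3 := norm_nonneg (R3 y)
    have nR4 := norm_nonneg (R4 y)
    obtain ⟨J, hJ⟩ : ∃ J, J = M * s * (|N| * W + D) + L * (W + P) + Rr := ⟨_, rfl⟩
    have hJ0 : 0 ≤ J := by rw [hJ]; positivity
    have hMJ : M * s * D ≤ J := by
      rw [hJ]
      have : 0 ≤ M * s * (|N| * W) := by positivity
      have : 0 ≤ L * (W + P) := by positivity
      linarith
    have hJK : 2 * κ * (1 / γ) * (M * s * D) + J ≤ K0 * J := by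
      have : 2 * κ * (1 / γ) * (M * s * D) ≤ 2 * κ * (1 / γ) * J := by gcongr
      rw [hK0]; linarith
    have hJK' : J ≤ K0 * J := by
      have : 0 ≤ 2 * κ * (1 / γ) * (M * s * D) := by positivity
      linarith
    have hJK2 : 2 * κ * (1 / γ) * (M * s * D) + L * (W + P) + Rr ≤ K0 * J := by
      have : 0 ≤ M * s * (|N| * W + D) := by positivity
      linarith
    have B1 := TU_le (N := N) (s := s) (h := h y) (g := g y) (h1 := deriv h y) (g1 := deriv g y) (R := R1 y) (W := W) (D := D) hs.le hM hLn
      (hAn 0 0).1 (hAn 0 1).1 (hAn 0 0).2 (hAn 0 1).2 (hCn 0 0).1 (hCn 0 1).1 (hDU 0) (by linarith) (by linarith)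
    have B2 := TU_le (N := N) (s := s) (h := h y) (g := g y) (h1 := deriv h y) (g1 := deriv g y) (R := R2 y) (W := W) (D := D) hs.le hM hLn
      (hAn 1 0).1 (hAn 1 1).1 (hAn 1 0).2 (hAn 1 1).2 (hCn 1 0).1 (hCn 1 1).1 (hDU 1) (by linarith) (by linarith)
    have B3 := TH_le (s := s) (h := h y) (g := g y) (h1 := deriv h y) (R := R3 y) (W := W) (D := D) hs.le hκ.le hM hLn
      (by positivity) hb (hCn 0 0).2 (hCn 0 1).2 (hDH 0) (by linarith) (by linarith)
    have B4 := TH_le (s := s) (h := h y) (g := g y) (h1 := deriv g y) (R := R4 y) (W := W) (D := D) hs.le hκ.le hM hLn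
      (by positivity) hb (hCn 1 0).2 (hCn 1 1).2 (hDH 1) (by linarith) (by linarith)
    replace B1 := B1.trans (show _ ≤ K0 * J by linarith)
    replace B2 := B2.trans (show _ ≤ K0 * J by linarith)
    replace B3 := B3.trans (show _ ≤ K0 * J by linarith)
    replace B4 := B4.trans (show _ ≤ K0 * J by linarith)
    obtain ⟨T1, hT1⟩ : ∃ T, T = Complex.I * (N:ℂ) * ((s:ℂ) * (AU (y/s) 0 0 * h y + AU (y/s) 0 1 * g y)) + (s:ℂ) * (BU (y/s) 0 0 * deriv h y + BU (y/s) 0 1 * deriv g y)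
      + (CU (y/s) 0 0 * h y + CU (y/s) 0 1 * g y) + ((s⁻¹ : ℝ) : ℂ) * ψ * DU (y/s) 0 - R1 y := ⟨_, rfl⟩
    obtain ⟨T2, hT2⟩ : ∃ T, T = Complex.I * (N:ℂ) * ((s:ℂ) * (AU (y/s) 1 0 * h y + AU (y/s) 1 1 * g y)) + (s:ℂ) * (BU (y/s) 1 0 * deriv h y + BU (y/s) 1 1 * deriv g y)
      + (CU (y/s) 1 0 * h y + CU (y/s) 1 1 * g y) + ((s⁻¹ : ℝ) : ℂ) * ψ * DU (y/s) 1 - R2 y := ⟨_, rfl⟩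
    obtain ⟨T3, hT3⟩ : ∃ T, T = -((2 * κ * s * (deriv Hs (y/s) / Hs (y/s)) : ℝ) : ℂ) * deriv h y
      + (CH (y/s) 0 0 * h y + CH (y/s) 0 1 * g y) + ((s⁻¹ : ℝ) : ℂ) * ψ * DH (y/s) 0 - R3 y := ⟨_, rfl⟩
    obtain ⟨T4, hT4⟩ : ∃ T, T = -((2 * κ * s * (deriv Hs (y/s) / Hs (y/s)) : ℝ) : ℂ) * deriv g y
      + (CH (y/s) 1 0 * h y + CH (y/s) 1 1 * g y) + ((s⁻¹ : ℝ) : ℂ) * ψ * DH (y/s) 1 - R4 y := ⟨_, rfl⟩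
    rw [← hT1] at B1
    rw [← hT2] at B2
    rw [← hT3] at B3
    rw [← hT4] at B4
    have f1 : Complex.I * (N:ℂ) * ((((1 + μ/κ) * Us (y/s) : ℝ):ℂ) * u y - (G y:ℂ) * h y) + T1 + Complex.I * (N:ℂ) * p y
      - ((μ * s^2 : ℝ) : ℂ) * (deriv (deriv u) y - (N:ℂ)^2 * u y) = 0 := by
      rw [hT1]; linear_combination e1
    have f2 : Complex.I * (N:ℂ) * ((((1 + μ/κ) * Us (y/s) : ℝ):ℂ) * v y - (G y:ℂ) * g y) + T2 + deriv p y
      - ((μ * s^2 : ℝ) : ℂ) * (deriv (deriv v) y - (N:ℂ)^2 * v y) = 0 := by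
      rw [hT2]; linear_combination e2
    have f3 : -(Complex.I * (N:ℂ)) * u y + T3 - ((κ * s^2 : ℝ) : ℂ) * (deriv (deriv h) y - (N:ℂ)^2 * h y) = 0 := by
      rw [hT3]; linear_combination e3
    have f4 : -(Complex.I * (N:ℂ)) * v y + T4 - ((κ * s^2 : ℝ) : ℂ) * (deriv (deriv g) y - (N:ℂ)^2 * g y) = 0 := by
      rw [hT4]; linear_combination e4
    have id1 := energy_id μ κ (s^2) (G y) G1 N _ _ _ _ _ (deriv u y) (deriv v y) (deriv h y) (deriv g y) _ _ _ _ _ _ _ _ _ _ ed f1 f2 f3 f4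
    have id2 := cross_id κ (s^2) N σ _ _ _ _ (deriv u y) (deriv v y) (deriv h y) (deriv g y) _ _ _ _ f3 f4
    have ee := energy_le (N := N) hκ hs hγb hc hc0 (hGlow y hy.le) (hGup y hy.le) (hγ₀.le.trans (hGlow y hy.le)) hM hJ0 hK00.le hMJ hG1
      B1 B2 B3 B4 hW hD
    rw [← id1, ← hK1] at ee
    have cc := cross_le (N := N) (s := s) hκ hσ hJ0 hK00.le B3 B4 hW hD
    -- derivatives
    have dQ1 := (((((dot_deriv (D2 hu y) (D1 hu y)).add (dot_deriv (D2 hv y) (D1 hv y))).const_mul (μ * s^2)).add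
      ((dG.mul ((dot_deriv (D2 hh y) (D1 hh y)).add (dot_deriv (D2 hg y) (D1 hg y)))).const_mul (κ * s^2)))).sub
      (dot_deriv (Dp y) (D1 hv y))
    have dQ2 := ((crs_deriv (D2 hh y) (D1 hu y)).add (crs_deriv (D2 hg y) (D1 hv y))).const_mul (σ * κ * s^2)
    have I3' : P^2 / 2 - 2 * W^2 ≤ q3 := by
      have : ‖h y‖^2 ≤ W^2 := by gcongr; linarith
      linarith
    obtain ⟨q1, dQ1', I1⟩ : ∃ q1, HasDerivAt Q1 q1 y ∧
        c / 4 * (s^2 * (D^2 + N^2 * W^2)) - K1 * (J * W) ≤ q1 := by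
      rw [hQ1]
      refine ⟨_, dQ1, ee.trans (le_of_eq ?_)⟩
      simp only [Pi.add_apply]
      ring
    obtain ⟨q2, dQ2', I2⟩ : ∃ q2, HasDerivAt Q2 q2 y ∧
        |N| * (‖u y‖^2 + ‖v y‖^2) ≤ q2 + κ * (s^2 * (D^2 + N^2 * W^2)) + K0 * (J * W) := by
      rw [hQ2]
      refine ⟨_, dQ2, ?_⟩
      rw [← hσN, ← nsq_eq, ← nsq_eq, id2]
      linarith only [cc]
    refine ⟨_, (dQ2'.add (dQ1'.const_mul lam)).add (dQ3.const_mul (2 * K3 * L)), ?_⟩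
    have fin := combine (t := t) hκ hc0 hK00 hK10 hM hL ht rfl hJ hlam hK3 I1 I2 I3'
    have fW : W^2 ≤ 4 * w y := by rw [hW, hw]; exact four _ _ _ _
    have fR : Rr^2 ≤ 4 * r y := by rw [hRr, hr]; exact four _ _ _ _
    have hw0 : 0 ≤ w y := by rw [hw]; positivity
    have hr0 : 0 ≤ r y := by rw [hr]; positivity
    have g1 : K3 * (K3 / 2 + 6) * (L * W^2) ≤ K3 * (K3 / 2 + 6) * (L * (4 * w y)) := by gcongr
    have g2 : K3 * (t * Rr^2 + W^2 / t) ≤ K3 * (t * (4 * r y) + 4 * w y / t) := by gcongr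
    have g3 : K3 * (t * (4 * r y) + 4 * w y / t) = 4 * K3 * (t * r y + w y / t) := by ring
    have g4 : 0 ≤ 4 * K3 * (L * w y) := by positivity
    have g5 : 0 ≤ 4 * (K3 * (K3 / 2 + 6)) * (t * r y + w y / t) := by positivity
    rw [hK]
    linarith
  -- continuity of Q
  have cu := hu.continuous
  have cv := hv.continuous
  have ch := hh.continuous
  have cg := hg.continuous
  have cp := hp.continuous
  have cu1 := (CD1 hu).continuous
  have cv1 := (CD1 hv).continuous
  have ch1 := (CD1 hh).continuous
  have cg1 := (CD1 hg).continuous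
  have cU := hUs.continuous
  have cH := hHs.continuous
  have cG : Continuous G := by
    rw [hG]
    exact ((cH.comp (continuous_id.div_const s)).pow 2).sub ((cU.comp (continuous_id.div_const s)).pow 2)
  have cre := Complex.continuous_re
  have cim := Complex.continuous_im
  have cQ1 : Continuous Q1 := by rw [hQ1]; fun_prop
  have cQ2 : Continuous Q2 := by rw [hQ2]; fun_prop
  have cψ : Continuous (fun y => ∫ t in (0:ℝ)..y, h t) :=
    intervalIntegral.continuous_primitive (fun a b => ch.intervalIntegrable a b) 0
  have cQ3 : ContinuousOn Q3 (Ici 0) := by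
    rw [hQ3]
    refine (ContinuousOn.div (by fun_prop) (by fun_prop) ?_).neg
    intro y hy
    have : (0:ℝ) ≤ y := hy
    positivity
  have cQ : ContinuousOn (fun y => Q2 y + lam * Q1 y + 2 * K3 * L * Q3 y) (Ici 0) :=
    (cQ2.continuousOn.add (continuousOn_const.mul cQ1.continuousOn)).add (continuousOn_const.mul cQ3)
  have Q0 : Q2 0 + lam * Q1 0 + 2 * K3 * L * Q3 0 = 0 := by
    rw [hQ1, hQ2, hQ3]; simp [u0, v0, h10, g0]
  have hB : Tendsto (fun y => Q2 y + lam * Q1 y) atTop (nhds 0) := by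
    have l1 := (lim1.mul lim0).const_mul (κ * s^2 + lam * (μ * s^2 + κ * s^2 * γbar^2))
    have l2 := l1.add (limp.const_mul lam)
    rw [mul_zero, mul_zero, mul_zero, add_zero] at l2
    refine squeeze_zero_norm' ?_ l2
    filter_upwards [eventually_gt_atTop (0:ℝ)] with y hy
    have nu := norm_nonneg (u y)
    have nv := norm_nonneg (v y)
    have nh := norm_nonneg (h y)
    have ng := norm_nonneg (g y)
    have nu1 := norm_nonneg (deriv u y)
    have nv1 := norm_nonneg (deriv v y)
    have nh1 := norm_nonneg (deriv h y)
    have ng1 := norm_nonneg (deriv g y)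
    obtain ⟨W, hW⟩ : ∃ W, W = ‖u y‖ + ‖v y‖ + ‖h y‖ + ‖g y‖ := ⟨_, rfl⟩
    obtain ⟨D, hD⟩ : ∃ D, D = ‖deriv u y‖ + ‖deriv v y‖ + ‖deriv h y‖ + ‖deriv g y‖ := ⟨_, rfl⟩
    rw [← hW, ← hD, Real.norm_eq_abs]
    have hW0 : 0 ≤ W := by rw [hW]; positivity
    have hD0 : 0 ≤ D := by rw [hD]; positivity
    have a1 : |((deriv u y).re * (u y).re + (deriv u y).im * (u y).im)
        + ((deriv v y).re * (v y).re + (deriv v y).im * (v y).im)| ≤ D * W :=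
      (abs_add_le _ _).trans ((add_le_add (dot_le _ _) (dot_le _ _)).trans (pair_le (by linarith) (by linarith) (by linarith)))
    have a2 : |((deriv h y).re * (h y).re + (deriv h y).im * (h y).im)
        + ((deriv g y).re * (g y).re + (deriv g y).im * (g y).im)| ≤ D * W :=
      (abs_add_le _ _).trans ((add_le_add (dot_le _ _) (dot_le _ _)).trans (pair_le (by linarith) (by linarith) (by linarith)))
    have a3 : |((deriv h y).re * (u y).im - (deriv h y).im * (u y).re)
        + ((deriv g y).re * (v y).im - (deriv g y).im * (v y).re)| ≤ D * W :=
      (abs_add_le _ _).trans ((add_le_add (crs_le _ _) (crs_le _ _)).trans (pair_le (by linarith) (by linarith) (by linarith)))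
    have a4 : |(p y).re * (v y).re + (p y).im * (v y).im| ≤ ‖p y‖ * W :=
      (dot_le _ _).trans (by gcongr; linarith)
    have hGa : |G y| ≤ γbar^2 := by
      rw [abs_of_nonneg (hγ₀.le.trans (hGlow y hy.le))]; exact hGup y hy.le
    have b1 : |Q1 y| ≤ μ * s^2 * (D * W) + κ * s^2 * (γbar^2 * (D * W)) + ‖p y‖ * W := by
      rw [hQ1]
      refine (abs_sub _ _).trans (add_le_add ((abs_add_le _ _).trans (add_le_add ?_ ?_)) a4)
      · rw [abs_mul, abs_of_nonneg (by positivity : 0 ≤ μ * s^2)]; gcongr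
      · rw [abs_mul, abs_of_nonneg (by positivity : 0 ≤ κ * s^2), abs_mul]; gcongr
    have b2 : |Q2 y| ≤ κ * s^2 * (D * W) := by
      rw [hQ2]
      simp only
      rw [mul_assoc σ, abs_mul, abs_mul, abs_of_nonneg (by positivity : 0 ≤ κ * s^2)]
      calc |σ| * (κ * s^2) * _ ≤ 1 * (κ * s^2) * (D * W) := by gcongr
        _ = _ := by ring
    refine (abs_add_le _ _).trans ?_
    rw [abs_mul, abs_of_pos hlam0]
    have := mul_le_mul_of_nonneg_left b1 hlam0.le
    linarith
  have hQB : ∀ y, 0 < y → Q2 y + lam * Q1 y + 2 * K3 * L * Q3 y ≤ Q2 y + lam * Q1 y := by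
    intro y hy
    have : Q3 y ≤ 0 := by
      rw [hQ3]; simp only [Left.neg_nonpos_iff]; positivity
    have := mul_nonneg (by positivity : 0 ≤ 2 * K3 * L) (neg_nonneg.2 this)
    linarith
  -- integrate
  obtain ⟨iu, iv, ih, ig⟩ := hL0
  obtain ⟨j1, j2, j3, j4⟩ := hR
  unfold ML2 at iu iv ih ig j1 j2 j3 j4
  have iw : IntegrableOn w (Ioi 0) := by rw [hw]; exact ((iu.add iv).add ih).add ig
  have ir : IntegrableOn r (Ioi 0) := by rw [hr]; exact ((j1.add j2).add j3).add j4
  have sw : ∫ y in Ioi (0:ℝ), w y = nsq u + nsq v + nsq h + nsq g := by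
    rw [hw]; exact int4 iu iv ih ig
  have sr : ∫ y in Ioi (0:ℝ), r y = nsq R1 + nsq R2 + nsq R3 + nsq R4 := by
    rw [hr]; exact int4 j1 j2 j3 j4
  have suv : ∫ y in Ioi (0:ℝ), (‖u y‖^2 + ‖v y‖^2) = nsq u + nsq v := by
    rw [nsq, nsq, ← integral_add iu iv]
  have nn : ∀ f, 0 ≤ nsq f := fun f => integral_nonneg (fun y => by positivity)
  have w2 : nrm4 u v h g ^ 2 = ∫ y in Ioi (0:ℝ), w y := by
    rw [sw, nrm4, Real.sq_sqrt (by linarith [nn u, nn v, nn h, nn g])]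
  have r2 : nrm4 R1 R2 R3 R4 ^ 2 = ∫ y in Ioi (0:ℝ), r y := by
    rw [sr, nrm4, Real.sq_sqrt (by linarith [nn R1, nn R2, nn R3, nn R4])]
  have uv2 : nrm2 u v ^ 2 = nsq u + nsq v := by
    rw [nrm2, Real.sq_sqrt (by linarith [nn u, nn v])]
  have est : ∀ t, 0 < t → |N| * nrm2 u v ^ 2 ≤ K * (L * nrm4 u v h g ^ 2)
      + K * (t * nrm4 R1 R2 R3 R4 ^ 2 + nrm4 u v h g ^ 2 / t) := by
    intro t ht
    have i1 : IntegrableOn (fun y => |N| * (‖u y‖^2 + ‖v y‖^2)) (Ioi 0) := (iu.add iv).const_mul _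
    have i4 : IntegrableOn (fun y => t * r y + w y / t) (Ioi 0) := (ir.const_mul t).add (iw.div_const t)
    have i3 : IntegrableOn (fun y => L * w y + (t * r y + w y / t)) (Ioi 0) := (iw.const_mul L).add i4
    have i2 : IntegrableOn (fun y => K * (L * w y + (t * r y + w y / t))) (Ioi 0) := i3.const_mul K
    have := ft (i1.sub i2) cQ (key t ht) Q0 hB hQB
    simp only [Pi.sub_apply] at this
    rw [integral_sub i1 i2, integral_const_mul, integral_const_mul, integral_add (iw.const_mul L) i4,
      integral_add (ir.const_mul t) (iw.div_const t), integral_const_mul, integral_const_mul, integral_div,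
      suv, ← uv2, ← w2, ← r2] at this
    linarith
  have w0 : 0 ≤ nrm4 u v h g := Real.sqrt_nonneg _
  have r0 : 0 ≤ nrm4 R1 R2 R3 R4 := Real.sqrt_nonneg _
  have n0 : 0 ≤ nrm2 u v := Real.sqrt_nonneg _
  have fin := opt r0 w0 est
  generalize nrm4 u v h g = w at *
  generalize nrm4 R1 R2 R3 R4 = r at *
  generalize nrm2 u v = x at *
  have e1 : Real.sqrt |N| * x = Real.sqrt (|N| * x^2) := by
    rw [Real.sqrt_mul (abs_nonneg N), Real.sqrt_sq n0]
  rw [e1]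
  have sM := Real.sqrt_nonneg M
  have hSM := Real.sq_sqrt hM
  have sK := Real.sqrt_nonneg (2 * K)
  have hSK := Real.sq_sqrt (by positivity : 0 ≤ 2 * K)
  have hsr := Real.sq_sqrt r0
  have hsw := Real.sq_sqrt w0
  have srn := Real.sqrt_nonneg r
  have swn := Real.sqrt_nonneg w
  apply Real.sqrt_le_iff.2
  refine ⟨by positivity, fin.trans ?_⟩
  have z1 : (Real.sqrt (2 * K) * (Real.sqrt M * (1 + Real.sqrt M)) * w)^2 = 2 * K * (M * (1 + Real.sqrt M)^2 * w^2) := by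
    rw [mul_pow, mul_pow, mul_pow, hSK, hSM]; ring
  have z2 : (Real.sqrt (2 * K) * Real.sqrt r * Real.sqrt w)^2 = 2 * K * (r * w) := by
    rw [mul_pow, mul_pow, hSK, hsr, hsw]; ring
  have z3 : 0 ≤ (Real.sqrt (2 * K) * (Real.sqrt M * (1 + Real.sqrt M)) * w) * (Real.sqrt (2 * K) * Real.sqrt r * Real.sqrt w) := by
    positivity
  rw [add_sq, z1, z2]
  have z4 : L * w^2 ≤ M * (1 + Real.sqrt M)^2 * w^2 := by
    rw [hL]; gcongr; nlinarith
  have z5 := mul_le_mul_of_nonneg_left z4 hKpos.le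
  have z6 : 0 ≤ K * (M * (1 + Real.sqrt M)^2 * w^2) := by positivity
  linarith
end
end
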